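/- Let k be a field of characteristic zero and let A = k[X,Y,Z,T]/(XY − F(X,Z,T)) where F ∈ k[X,Z,T] ≅ k^[3]. Then A is isomorphic as a k-algebra to the polynomial ring k^[3] in three variables if and only if F(0,Z,T) is a variable of k[Z,T], i.e., there exists G ∈ k[Z,T] with k[Z,T] = k[F(0,Z,T), G]. -/

import Mathlib

section

open Polynomial

/-- Every Taylor coefficient of `p` at `τ`, weighted by powers of `r`, is bounded by `c`. -/
def TaylorBound {L Γ : Type*} [Field L] [LinearOrderedCommGroupWithZero Γ] (w : Valuation L Γ)
    (r : Γ) (τ : L) (p : L[X]) (c : Γ) : Prop :=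
  ∀ i, w ((taylor τ p).coeff i) * r ^ i ≤ c

namespace TaylorBound

variable {L Γ : Type*} [Field L] [LinearOrderedCommGroupWithZero Γ] {w : Valuation L Γ}
  {r : Γ} {τ : L} {p q : L[X]} {c d : Γ}

theorem mono (h : TaylorBound w r τ p c) (hcd : c ≤ d) : TaylorBound w r τ p d :=
  fun i => (h i).trans hcd

theorem zero : TaylorBound w r τ 0 c := fun i => by simp

theorem add (hp : TaylorBound w r τ p c) (hq : TaylorBound w r τ q c) :
    TaylorBound w r τ (p + q) c := fun i => by
  rw [map_add, coeff_add]
  rcases le_max_iff.1 (w.map_add ((taylor τ p).coeff i) ((taylor τ q).coeff i)) with h | h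
  · exact (mul_le_mul_left h _).trans (hp i)
  · exact (mul_le_mul_left h _).trans (hq i)

theorem neg (hp : TaylorBound w r τ p c) : TaylorBound w r τ (-p) c := fun i => by
  simpa using hp i

theorem sub (hp : TaylorBound w r τ p c) (hq : TaylorBound w r τ q c) :
    TaylorBound w r τ (p - q) c := by
  simpa [sub_eq_add_neg] using hp.add hq.neg

theorem sum {ι : Type*} (s : Finset ι) (P : ι → L[X])
    (h : ∀ i ∈ s, TaylorBound w r τ (P i) c) : TaylorBound w r τ (∑ i ∈ s, P i) c := by
  classical
  induction s using Finset.induction_on with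
  | empty => simpa using zero
  | insert a s ha ih =>
    rw [Finset.sum_insert ha]
    exact (h a (by simp)).add (ih fun i hi => h i (by simp [hi]))

theorem mul (hp : TaylorBound w r τ p c) (hq : TaylorBound w r τ q d) :
    TaylorBound w r τ (p * q) (c * d) := fun i => by
  rw [taylor_mul, coeff_mul]
  have h : ∀ x ∈ Finset.HasAntidiagonal.antidiagonal i,
      w ((taylor τ p).coeff x.1 * (taylor τ q).coeff x.2) * r ^ i ≤ c * d := by
    intro x hx
    rw [← Finset.HasAntidiagonal.mem_antidiagonal.1 hx, map_mul, pow_add, mul_mul_mul_comm]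
    exact mul_le_mul' (hp _) (hq _)
  by_cases hr : r ^ i = 0
  · rw [hr, mul_zero]; exact zero_le
  · rw [← le_mul_inv_iff₀ (zero_lt_iff.2 hr)]
    refine w.map_sum_le fun x hx => ?_
    rw [le_mul_inv_iff₀ (zero_lt_iff.2 hr)]
    exact h x hx

theorem C_of_le {a : L} (h : w a ≤ c) : TaylorBound w r τ (C a) c := fun i => by
  rcases Nat.eq_zero_or_pos i with rfl | hi
  · simpa using h
  · simp [coeff_C, hi.ne']

theorem X_sub_C (b : L) : TaylorBound w r τ (X - C b) (max r (w (τ - b))) := fun i => by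
  rw [map_sub, taylor_X, taylor_C]
  match i with
  | 0 => simp
  | 1 => simp
  | (n+2) => simp [coeff_X]

theorem prod {ι : Type*} (s : Finset ι) (P : ι → L[X]) (b : ι → Γ)
    (h : ∀ i ∈ s, TaylorBound w r τ (P i) (b i)) :
    TaylorBound w r τ (∏ i ∈ s, P i) (∏ i ∈ s, b i) := by
  classical
  induction s using Finset.induction_on with
  | empty => simpa using C_of_le (w := w) (r := r) (τ := τ) (a := 1) (c := 1) (by simp)
  | insert a s ha ih =>
    rw [Finset.prod_insert ha, Finset.prod_insert ha]
    exact (h a (by simp)).mul (ih fun i hi => h i (by simp [hi]))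

theorem pow (hp : TaylorBound w r τ p c) (n : ℕ) : TaylorBound w r τ (p ^ n) (c ^ n) := by
  simpa using prod (Finset.range n) (fun _ => p) (fun _ => c) fun _ _ => hp

theorem eval_le (hp : TaylorBound w r τ p c) : w (p.eval τ) ≤ c := by
  simpa using hp 0

theorem of_X_sub_C_mul {b : L} (hr : 0 < r) (h : TaylorBound w r τ ((X - C b) * q) c) :
    TaylorBound w r τ q (c * (max r (w (τ - b)))⁻¹) := by
  have h0 : max r (w (τ - b)) ≠ 0 := (hr.trans_le (le_max_left _ _)).ne'
  set e := τ - b with he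
  have hco : ∀ i, (taylor τ ((X - C b) * q)).coeff (i + 1) =
      (taylor τ q).coeff i + e * (taylor τ q).coeff (i + 1) := by
    intro i
    have : taylor τ ((X - C b) * q) = X * taylor τ q + C e * taylor τ q := by
      rw [taylor_mul, map_sub, taylor_X, taylor_C, he, C_sub]; ring
    rw [this, coeff_add, coeff_X_mul, coeff_C_mul]
  have hc0 : (taylor τ ((X - C b) * q)).coeff 0 = e * (taylor τ q).coeff 0 := by
    simp [taylor_coeff_zero, he]
  intro i
  rw [le_mul_inv_iff₀ (zero_lt_iff.2 h0)]
  rcases le_total (w e) r with her | her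
  · rw [max_eq_left her]
    have key : ∀ n i, q.natDegree < i + n → w ((taylor τ q).coeff i) * r ^ i * r ≤ c := by
      intro n
      induction n with
      | zero =>
        intro i hi
        rw [coeff_eq_zero_of_natDegree_lt (by rw [natDegree_taylor]; simpa using hi)]
        simp
      | succ n ih =>
        intro i hi
        have h1 := h (i + 1)
        have h2 := ih (i + 1) (by omega)
        have : (taylor τ q).coeff i = (taylor τ ((X - C b) * q)).coeff (i + 1) -
          e * (taylor τ q).coeff (i + 1) := by rw [hco]; ring
        rw [mul_assoc, ← pow_succ, this]
        rcases le_max_iff.1 (w.map_sub ((taylor τ ((X - C b) * q)).coeff (i + 1))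
          (e * (taylor τ q).coeff (i + 1))) with h3 | h3
        · exact (mul_le_mul_left h3 _).trans h1
        · refine (mul_le_mul_left h3 _).trans (le_trans ?_ h2)
          rw [map_mul, mul_comm (w e), mul_right_comm]
          exact mul_le_mul_right her _
    exact key (q.natDegree + 1) i (by omega)
  · rw [max_eq_right her]
    induction i with
    | zero => simpa [hc0, mul_comm] using h 0
    | succ i ih =>
      have h1 := h (i + 1)
      have : e * (taylor τ q).coeff (i + 1) = (taylor τ ((X - C b) * q)).coeff (i + 1) -
        (taylor τ q).coeff i := by rw [hco]; ring
      have h3' := w.map_sub ((taylor τ ((X - C b) * q)).coeff (i + 1)) ((taylor τ q).coeff i)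
      rw [mul_right_comm, mul_comm (w _) (w e), ← map_mul, this]
      rcases le_max_iff.1 h3' with h3 | h3
      · exact (mul_le_mul_left h3 _).trans h1
      · refine (mul_le_mul_left h3 _).trans (le_trans ?_ ih)
        rw [pow_succ, ← mul_assoc]
        exact mul_le_mul_right her _

end TaylorBound

end

section

open Polynomial

section Tschirnhausen

variable {A : Type*} [CommRing A]

theorem natDegree_sub_lt_of_monic [Nontrivial A] {N : ℕ} (hN : 0 < N) {P Q : A[X]} (hP : P.Monic)
    (hQ : Q.Monic) (hPd : P.natDegree = N) (hQd : Q.natDegree = N) : (P - Q).natDegree < N := by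

  by_cases h0 : P - Q = 0
  · simpa [h0] using hN
  rw [← hPd]
  refine (natDegree_lt_natDegree_iff h0).2 (degree_sub_lt_left ?_ hP.ne_zero ?_)
  · rw [degree_eq_natDegree hP.ne_zero, degree_eq_natDegree hQ.ne_zero, hPd, hQd]
  · rw [hP.leadingCoeff, hQ.leadingCoeff]

theorem exists_add_pow_eq {N : ℕ} (P Q : A[X]) (hP : P.natDegree ≤ N) (hQ : Q.natDegree ≤ N)
    (j : ℕ) : ∃ S : A[X], S.natDegree ≤ N * j ∧
      (P + Q) ^ (j + 2) = P ^ (j + 2) + C ((j : A) + 2) * (P ^ (j + 1) * Q) + Q ^ 2 * S := by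
  induction j with
  | zero => exact ⟨1, by simp, by simp only [Nat.cast_zero, zero_add, C_ofNat]; ring⟩
  | succ j ih =>
    obtain ⟨S, hS, h⟩ := ih
    refine ⟨S * (P + Q) + C ((j : A) + 2) * P ^ (j + 1), ?_, ?_⟩
    · refine natDegree_add_le_of_degree_le ?_ ?_
      · refine natDegree_mul_le.trans ?_
        have := natDegree_add_le_of_degree_le hP hQ
        rw [mul_add, mul_one]; omega
      · refine (natDegree_C_mul_le _ _).trans (natDegree_pow_le.trans ?_)
        rw [mul_comm]; gcongr
    · rw [pow_succ, h]
      simp only [Nat.cast_add, Nat.cast_one, C_add, C_ofNat, map_natCast, map_one]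
      ring

theorem exists_approx_root [Algebra ℚ A] [Nontrivial A] {N j : ℕ} (hN : 0 < N) {f : A[X]}
    (hf : f.Monic) (hfd : f.natDegree = N * (j + 2)) (Cl : A[X] → Prop)
    (hstep : ∀ P : A[X], P.Monic → P.natDegree = N → Cl P →
      (f - P ^ (j + 2)).natDegree < N * (j + 2) →
      Cl (P + C (algebraMap ℚ A (1 / (j + 2))) * ((f - P ^ (j + 2)) /ₘ P ^ (j + 1))))
    {P : A[X]} (hP : P.Monic) (hPd : P.natDegree = N) (hC : Cl P) :
    ∃ P : A[X], P.Monic ∧ P.natDegree = N ∧ Cl P ∧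
      (f - P ^ (j + 2)).natDegree < N * (j + 1) := by
  induction hn : (f - P ^ (j + 2)).natDegree using Nat.strong_induction_on generalizing P with
  | _ n ih =>
  by_cases hlt : n < N * (j + 1)
  · exact ⟨P, hP, hPd, hC, hn ▸ hlt⟩
  set E := f - P ^ (j + 2) with hE
  have hEd : E.natDegree < N * (j + 2) := by
    refine natDegree_sub_lt_of_monic (by positivity) hf (hP.pow _) hfd ?_
    rw [hP.natDegree_pow, hPd, mul_comm]
  set Q := C (algebraMap ℚ A (1 / (j + 2))) * (E /ₘ P ^ (j + 1)) with hQ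
  have hmon := hP.pow (j + 1)
  have hmd : (P ^ (j + 1)).natDegree = N * (j + 1) := by
    rw [hP.natDegree_pow, hPd, mul_comm]
  obtain ⟨α, hα⟩ := Nat.exists_eq_add_of_le (not_lt.1 hlt)
  have hQd : Q.natDegree ≤ α := by
    refine (natDegree_C_mul_le _ _).trans ?_
    rw [natDegree_divByMonic _ hmon, hmd, hn]; omega
  have hαN : α < N := by
    have : N * (j + 2) = N * (j + 1) + N := by ring
    omega
  obtain ⟨S, hS, hexp⟩ := exists_add_pow_eq P Q hPd.le (hQd.trans hαN.le) j
  have hkey : f - (P + Q) ^ (j + 2) = E %ₘ P ^ (j + 1) - Q ^ 2 * S := by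
    have h1 := modByMonic_add_div E (P ^ (j + 1))
    have h2 : C ((j : A) + 2) * (P ^ (j + 1) * Q) = P ^ (j + 1) * (E /ₘ P ^ (j + 1)) := by
      have h3 : ((j : A) + 2) * algebraMap ℚ A (1 / (j + 2)) = 1 := by
        have : ((j : A) + 2) = algebraMap ℚ A (j + 2) := by simp [map_ofNat]
        rw [this, ← map_mul, mul_one_div_cancel (by positivity), map_one]
      rw [hQ]
      calc _ = (C ((j : A) + 2) * C (algebraMap ℚ A (1 / (j + 2)))) *
            (P ^ (j + 1) * (E /ₘ P ^ (j + 1))) := by ring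
        _ = _ := by rw [← C_mul, h3, C_1, one_mul]
    rw [hexp, h2]
    linear_combination hE - h1
  have hlt2 : (f - (P + Q) ^ (j + 2)).natDegree < n := by
    rw [hkey, hα]
    have hn0 : N * (j + 1) + α ≠ 0 := by positivity
    refine lt_of_le_of_lt (natDegree_sub_le _ _) (max_lt ?_ ?_)
    · refine lt_of_lt_of_le (natDegree_modByMonic_lt E hmon ?_) (by rw [hmd]; omega)
      intro h1; rw [h1] at hmd; simp at hmd; omega
    · calc _ ≤ (Q ^ 2).natDegree + S.natDegree := natDegree_mul_le
        _ ≤ 2 * α + N * j := add_le_add (natDegree_pow_le.trans (by gcongr)) hS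
        _ < _ := by rw [mul_add, mul_one]; omega
  have hQlt : Q.degree < P.degree := by
    rw [degree_eq_natDegree hP.ne_zero, hPd]
    exact lt_of_le_of_lt degree_le_natDegree (by exact_mod_cast lt_of_le_of_lt hQd hαN)
  exact ih _ (hn ▸ hlt2) (hP.add_of_left hQlt)
    (by rw [natDegree_add_eq_left_of_degree_lt hQlt, hPd]) (hstep P hP hPd hC hEd) rfl

theorem approx_root_unique [IsDomain A] [CharZero A] {N j : ℕ} (hN : 0 < N) {f P P' : A[X]}
    (hP : P.Monic) (hPd : P.natDegree = N) (hP' : P'.Monic) (hPd' : P'.natDegree = N)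
    (h : (f - P ^ (j + 2)).natDegree < N * (j + 1))
    (h' : (f - P' ^ (j + 2)).natDegree < N * (j + 1)) : P' = P := by
  by_contra hne
  set D := P' - P with hD
  have hD0 : D ≠ 0 := sub_ne_zero.2 hne
  have hDd : D.natDegree < N := natDegree_sub_lt_of_monic hN hP' hP hPd' hPd
  obtain ⟨S, hS, hexp⟩ := exists_add_pow_eq P D hPd.le hDd.le j
  rw [show P + D = P' by rw [hD]; ring] at hexp
  have h1 : (C ((j : A) + 2) * (P ^ (j + 1) * D)).natDegree = N * (j + 1) + D.natDegree := by
    have h0 : ((j : A) + 2) ≠ 0 := by exact_mod_cast (Nat.succ_ne_zero (j + 1))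
    rw [natDegree_C_mul h0, natDegree_mul (hP.pow _).ne_zero hD0, hP.natDegree_pow, hPd, mul_comm]
  have h3 : C ((j : A) + 2) * (P ^ (j + 1) * D) =
      (f - P ^ (j + 2)) - (f - P' ^ (j + 2)) - D ^ 2 * S := by rw [hexp]; ring
  have h4 : (D ^ 2 * S).natDegree < N * (j + 1) + D.natDegree := by
    calc _ ≤ (D ^ 2).natDegree + S.natDegree := natDegree_mul_le
        _ ≤ 2 * D.natDegree + N * j := add_le_add natDegree_pow_le hS
        _ < _ := by rw [mul_add, mul_one]; omega
  have h5 := (natDegree_sub_le ((f - P ^ (j + 2)) - (f - P' ^ (j + 2))) (D ^ 2 * S))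
  have h6 := (natDegree_sub_le (f - P ^ (j + 2)) (f - P' ^ (j + 2)))
  rw [← h3, h1] at h5
  have h7 := max_lt (lt_of_le_of_lt h6
    (lt_of_lt_of_le (max_lt h h') (Nat.le_add_right _ D.natDegree))) h4
  omega

end Tschirnhausen

end

section

open Polynomial

section DivBound

variable {L Γ : Type*} [Field L] [LinearOrderedCommGroupWithZero Γ] {w : Valuation L Γ}
  {r lam : Γ} {R : Finset L} {P Q : L[X]}

/-- Division by `P` divides Gauss norm bounds at the points of `R` by `lam`. -/
def DivBound (w : Valuation L Γ) (r : Γ) (R : Finset L) (P : L[X]) (lam : Γ) : Prop :=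
  ∀ (p : L[X]) (c : Γ), (∀ τ ∈ R, TaylorBound w r τ p c) →
    ∀ τ ∈ R, TaylorBound w r τ (p /ₘ P) (c * lam⁻¹)

theorem DivBound.pow (h : DivBound w r R P lam) (hP : P.Monic) (n : ℕ) :
    DivBound w r R (P ^ n) (lam ^ n) := by
  induction n with
  | zero =>
    intro p c hp τ hτ
    simpa using hp τ hτ
  | succ n ih =>
    intro p c hp τ hτ
    have h1 : p /ₘ P ^ (n + 1) = (p /ₘ P ^ n) /ₘ P := by
      have e1 := modByMonic_add_div p (P ^ n)
      have e2 := modByMonic_add_div (p /ₘ P ^ n) P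
      refine (div_modByMonic_unique (f := p) ((p /ₘ P ^ n) /ₘ P)
        (p %ₘ P ^ n + P ^ n * ((p /ₘ P ^ n) %ₘ P)) (hP.pow (n + 1)) ⟨?_, ?_⟩).1
      · rw [pow_succ]; linear_combination e1 + P ^ n * e2
      · have hPn : (P ^ n).degree + P.degree = (P ^ (n + 1)).degree := by
          rw [pow_succ, degree_mul]
        rw [← hPn]
        refine lt_of_le_of_lt (degree_add_le _ _) (max_lt ?_ ?_)
        · refine lt_of_lt_of_le (degree_modByMonic_lt _ (hP.pow n)) ?_
          rw [degree_eq_natDegree hP.ne_zero, degree_eq_natDegree (hP.pow n).ne_zero]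
          exact_mod_cast Nat.le_add_right _ _
        · rw [degree_mul]
          have := degree_modByMonic_lt (p /ₘ P ^ n) hP
          refine WithBot.add_lt_add_left ?_ this
          exact (degree_ne_bot.2 (hP.pow n).ne_zero)
    rw [h1, pow_succ, mul_inv, ← mul_assoc]
    exact h _ _ (ih p c hp) τ hτ

theorem DivBound.add (h : DivBound w r R P lam) (hlam : lam ≠ 0) (hP : P.Monic)
    (hPb : ∀ τ ∈ R, TaylorBound w r τ P lam) (hQ : Q.degree < P.degree)
    (hQb : ∀ τ ∈ R, TaylorBound w r τ Q lam) : DivBound w r R (P + Q) lam := by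
  intro p
  induction hn : p.natDegree using Nat.strong_induction_on generalizing p with
  | _ n ih =>
  intro c hp τ hτ
  have hPQ := hP.add_of_left hQ
  have hdeg : (P + Q).degree = P.degree := degree_add_eq_left_of_degree_lt hQ
  by_cases hlt : p.degree < (P + Q).degree
  · rw [(divByMonic_eq_zero_iff hPQ).2 hlt]; exact .zero
  have hA := h p c hp
  have e1 := modByMonic_add_div p P
  have hcan : lam * (c * lam⁻¹) = c := by rw [mul_comm, inv_mul_cancel_right₀ hlam]
  have hM : ∀ τ ∈ R, TaylorBound w r τ (p %ₘ P) c := by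
    intro τ hτ
    rw [← eq_sub_iff_add_eq] at e1
    rw [e1]
    exact (hp τ hτ).sub (((hPb τ hτ).mul (hA τ hτ)).mono hcan.le)
  set p' := p %ₘ P - Q * (p /ₘ P) with hp'
  have hp'b : ∀ τ ∈ R, TaylorBound w r τ p' c := fun τ hτ =>
    (hM τ hτ).sub (((hQb τ hτ).mul (hA τ hτ)).mono hcan.le)
  have hdiv : p /ₘ (P + Q) = p /ₘ P + p' /ₘ (P + Q) := by
    have e2 := modByMonic_add_div p' (P + Q)
    refine (div_modByMonic_unique (f := p) _ (p' %ₘ (P + Q)) hPQ ⟨?_, ?_⟩).1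
    · linear_combination e1 + e2
    · exact degree_modByMonic_lt _ hPQ
  rw [hdiv]
  refine (hA τ hτ).add ?_
  by_cases h0 : p' = 0
  · rw [h0, zero_divByMonic]; exact .zero
  have hp0 : p ≠ 0 := by
    rintro rfl
    exact hlt (by rw [degree_zero]; exact bot_lt_iff_ne_bot.2 (degree_ne_bot.2 hPQ.ne_zero))
  refine ih p'.natDegree ?_ p' rfl c hp'b τ hτ
  rw [← hn]
  refine (natDegree_lt_natDegree_iff h0).2 ?_
  rw [hdeg, not_lt] at hlt
  refine lt_of_le_of_lt (degree_sub_le _ _) (max_lt ?_ ?_)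
  · exact (degree_modByMonic_lt _ hP).trans_le hlt
  · rw [degree_mul, ← degree_add_divByMonic hP hlt]
    refine WithBot.add_lt_add_right ?_ hQ
    refine degree_ne_bot.2 fun h1 => ?_
    rw [divByMonic_eq_zero_iff hP] at h1
    exact absurd hlt (not_le.2 h1)

theorem TaylorBound.of_prod_X_sub_C_mul (hr : 0 < r) {τ : L} {c : Γ} (s : Finset L) :
    ∀ {q : L[X]}, TaylorBound w r τ ((∏ b ∈ s, (X - C b)) * q) c →
    TaylorBound w r τ q (c * (∏ b ∈ s, max r (w (τ - b)))⁻¹) := by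
  classical
  induction s using Finset.induction_on with
  | empty => intro q h; simpa using h
  | insert a s ha ih =>
    intro q h
    rw [Finset.prod_insert ha, mul_inv, ← mul_assoc, mul_right_comm]
    rw [Finset.prod_insert ha, mul_comm (X - C a), mul_assoc] at h
    exact of_X_sub_C_mul hr (ih h)

theorem max_valuation_sub_eq {x y τ : L} (h : w (x - y) ≤ r) :
    max r (w (τ - x)) = max r (w (τ - y)) := by
  have h' : w (y - x) ≤ r := by rwa [w.map_sub_swap]
  apply le_antisymm
  · refine max_le (le_max_left _ _) ?_
    rw [show τ - x = (τ - y) + (y - x) by ring]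
    exact (w.map_add _ _).trans (max_le (le_max_right _ _) (h'.trans (le_max_left _ _)))
  · refine max_le (le_max_left _ _) ?_
    rw [show τ - y = (τ - x) + (x - y) by ring]
    exact (w.map_add _ _).trans (max_le (le_max_right _ _) (h.trans (le_max_left _ _)))

theorem divBound_prod_X_sub_C [DecidableEq L] (hr : 0 < r) {S : Finset L} (hSR : S ⊆ R) {κ : Γ}
    (hκ0 : κ ≠ 0) (hκ : ∀ b ∈ S, ∏ b' ∈ S.erase b, w (b - b') = κ)
    (hprod : ∀ τ ∈ R, ∏ b ∈ S, max r (w (τ - b)) = r * κ) :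
    DivBound w r R (∏ b ∈ S, (X - C b)) (r * κ) := by
  intro p c hp τ hτ
  set P : L[X] := ∏ b ∈ S, (X - C b) with hPdef
  have hP : P.Monic := monic_prod_of_monic _ _ fun b _ => monic_X_sub_C b
  have e1 := modByMonic_add_div p P
  have hM : TaylorBound w r τ (p %ₘ P) c := by
    have hintegral : p %ₘ P = Lagrange.interpolate S id (fun b => p.eval b) := by
      refine Lagrange.eq_interpolate_of_eval_eq _ (Set.injOn_id _) ?_ ?_
      · refine (degree_modByMonic_lt _ hP).trans_le ?_
        rw [hPdef, degree_prod]
        simp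
      · intro b hb
        have : P.eval b = 0 := by
          rw [hPdef, eval_prod]; exact Finset.prod_eq_zero hb (by simp)
        conv_rhs => rw [← e1]
        simp [this]
    rw [hintegral, Lagrange.interpolate_apply]
    refine TaylorBound.sum _ _ fun b hb => ?_
    have h1 : TaylorBound w r τ (Lagrange.basis S id b)
        (∏ b' ∈ S.erase b, ((w (b - b'))⁻¹ * max r (w (τ - b')))) := by
      unfold Lagrange.basis
      refine TaylorBound.prod _ _ _ fun b' _ => ?_
      exact (TaylorBound.C_of_le (by simp)).mul (TaylorBound.X_sub_C b')
    have h2 : ∏ b' ∈ S.erase b, ((w (b - b'))⁻¹ * max r (w (τ - b'))) ≤ 1 := by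
      rw [Finset.prod_mul_distrib, Finset.prod_inv_distrib, hκ b hb]
      rw [inv_mul_le_iff₀ (zero_lt_iff.2 hκ0), mul_one]
      have h3 := hprod τ hτ
      rw [← Finset.mul_prod_erase S _ hb] at h3
      rw [← mul_le_mul_iff_right₀ hr, ← h3]
      exact mul_le_mul_left (le_max_left _ _) _
    have h4 := (TaylorBound.C_of_le (w := w) (r := r) (τ := τ)
      ((hp b (hSR hb)).eval_le)).mul h1
    exact h4.mono (mul_le_of_le_one_right' h2)
  rw [← hprod τ hτ]
  refine TaylorBound.of_prod_X_sub_C_mul hr S ?_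
  rw [← hPdef, show P * (p /ₘ P) = p - p %ₘ P by linear_combination e1]
  exact (hp τ hτ).sub hM

end DivBound

end

section

open Polynomial

section Cluster

variable {L Γ : Type*} [Field L] [LinearOrderedCommGroupWithZero Γ] {w : Valuation L Γ}
  {r : Γ} {R : Finset L}

theorem exists_cluster_reps [DecidableEq L] (w : Valuation L Γ) (r : Γ) (R : Finset L) :
    ∃ rep : L → L, (∀ x ∈ R, rep x ∈ R) ∧ (∀ x ∈ R, w (x - rep x) ≤ r) ∧
      ∀ x y, w (x - y) ≤ r → rep x = rep y := by
  let s : Setoid L :=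
    { r := fun x y => w (x - y) ≤ r
      iseqv :=
        ⟨fun x => by simp, fun {x y} h => by rwa [w.map_sub_swap], fun {x y z} h1 h2 => by
          rw [show x - z = (x - y) + (y - z) by ring]
          exact (w.map_add _ _).trans (max_le h1 h2)⟩ }
  classical
  let f : Quotient s → L := fun q => if h : ∃ y ∈ R, (Quotient.mk s y) = q then h.choose else 0
  have hf : ∀ x ∈ R, f (Quotient.mk s x) ∈ R ∧
      Quotient.mk s (f (Quotient.mk s x)) = Quotient.mk s x := by
    intro x hx
    have h : ∃ y ∈ R, (Quotient.mk s y) = Quotient.mk s x := ⟨x, hx, rfl⟩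
    simp only [f, dif_pos h]
    exact h.choose_spec
  refine ⟨fun x => f (Quotient.mk s x), fun x hx => (hf x hx).1, fun x hx => ?_, fun x y h => ?_⟩
  · exact Quotient.exact (s := s) (hf x hx).2.symm
  · exact congrArg f (Quotient.sound (s := s) h)

theorem exists_monic_small_of_cluster [DecidableEq L] {A : Type*} [CommRing A] [IsDomain A]
    [CharZero A]
    [Algebra ℚ A] (φ : A →+* L) (hφ : Function.Injective φ) [CharZero L]
    (hwQ : ∀ q : ℚ, w (algebraMap ℚ L q) ≤ 1) (hr : 0 < r) (hR : R.Nonempty) {j : ℕ} {K : Γ}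
    (hj : ∀ x ∈ R, (R.filter fun y => w (x - y) ≤ r).card = j + 2)
    (hK : ∀ x ∈ R, ∏ y ∈ R with r < w (x - y), w (x - y) = K)
    (hrK : r ^ (j + 2) * K ≤ 1) {f : A[X]} (hf : f.map φ = ∏ τ ∈ R, (X - C τ)) :
    ∃ g : A[X], g.Monic ∧ 0 < g.natDegree ∧ g.natDegree < R.card ∧
      ∀ τ ∈ R, w ((g.map φ).eval τ) ≤ 1 := by
  obtain ⟨rep, hrepR, hrep, hrepeq⟩ := exists_cluster_reps w r R
  set S := R.image rep with hS
  have hrepS : ∀ x ∈ R, rep x ∈ S := fun x hx => Finset.mem_image_of_mem _ hx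
  have hSR : S ⊆ R := by
    intro b hb; obtain ⟨x, hx, rfl⟩ := Finset.mem_image.1 hb; exact hrepR x hx
  have hrepid : ∀ b ∈ S, rep b = b := by
    intro b hb; obtain ⟨x, hx, rfl⟩ := Finset.mem_image.1 hb; exact (hrepeq _ _ (hrep x hx)).symm
  have hiff : ∀ b ∈ S, ∀ x ∈ R, rep x = b ↔ w (b - x) ≤ r := by
    intro b hb x hx
    constructor
    · rintro rfl; rw [w.map_sub_swap]; exact hrep x hx
    · intro h; rw [← hrepeq _ _ h, hrepid b hb]
  have hfib : ∀ b ∈ S, (R.filter fun x => rep x = b).card = j + 2 := by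
    intro b hb
    rw [← hj b (hSR hb)]
    congr 1
    exact Finset.filter_congr fun x hx => hiff b hb x hx
  have hsep : ∀ b ∈ S, ∀ b' ∈ S, b ≠ b' → r < w (b - b') := by
    intro b hb b' hb' hne
    by_contra h
    have := (hiff b hb b' (hSR hb')).2 (not_lt.1 h)
    exact hne (by rw [← this, hrepid b' hb'])
  have hcard : R.card = S.card * (j + 2) := by
    rw [Finset.card_eq_sum_card_fiberwise hrepS, Finset.sum_const_nat hfib]
  set N := S.card with hN
  have hSne : S.Nonempty := hR.image _
  have hNpos : 0 < N := hSne.card_pos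
  -- distances from a point to a cluster
  have hmax : ∀ τ, ∏ y ∈ R, max r (w (τ - y)) = (∏ b ∈ S, max r (w (τ - b))) ^ (j + 2) := by
    intro τ
    rw [← Finset.prod_fiberwise_of_maps_to hrepS, ← Finset.prod_pow]
    refine Finset.prod_congr rfl fun b hb => ?_
    rw [← hfib b hb, ← Finset.prod_const]
    refine Finset.prod_congr rfl fun y hy => ?_
    rw [Finset.mem_filter] at hy
    exact max_valuation_sub_eq (hy.2 ▸ hrep y hy.1)
  have hprodmax : ∀ τ ∈ R, ∏ b ∈ S, max r (w (τ - b)) =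
      r * ∏ b ∈ S.erase (rep τ), w (rep τ - b) := by
    intro τ hτ
    rw [← Finset.mul_prod_erase S _ (hrepS τ hτ), max_eq_left (hrep τ hτ)]
    congr 1
    refine Finset.prod_congr rfl fun b hb => ?_
    rw [Finset.mem_erase] at hb
    have h1 := hsep _ (hrepS τ hτ) b hb.2 hb.1.symm
    have h2 := max_valuation_sub_eq (τ := b) (hrep τ hτ)
    rw [w.map_sub_swap b, w.map_sub_swap b, max_eq_right (a := r) (b := w (rep τ - b)) h1.le] at h2
    exact h2
  have hpw : ∀ b ∈ S, (∏ b' ∈ S.erase b, w (b - b')) ^ (j + 2) = K := by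
    intro b hb
    have h1 := hmax b
    have h2 := hprodmax b (hSR hb)
    rw [hrepid b hb] at h2
    rw [h2, mul_pow] at h1
    have h3 : ∏ y ∈ R, max r (w (b - y)) = r ^ (j + 2) * K := by
      rw [← Finset.prod_filter_mul_prod_filter_not R (fun y => w (b - y) ≤ r)]
      congr 1
      · rw [← hj b (hSR hb), ← Finset.prod_const]
        exact Finset.prod_congr rfl fun y hy => max_eq_left (Finset.mem_filter.1 hy).2
      · rw [← hK b (hSR hb)]
        simp only [not_le]
        exact Finset.prod_congr rfl fun y hy => max_eq_right (Finset.mem_filter.1 hy).2.le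
    rw [h3] at h1
    exact (mul_left_cancel₀ (pow_ne_zero _ hr.ne') h1).symm
  obtain ⟨b₀, hb₀⟩ := hSne
  set κ := ∏ b' ∈ S.erase b₀, w (b₀ - b') with hκdef
  have hκ : ∀ b ∈ S, ∏ b' ∈ S.erase b, w (b - b') = κ := by
    intro b hb
    refine (pow_left_inj₀ zero_le zero_le (Nat.succ_ne_zero (j + 1))).1 ?_
    rw [Nat.succ_eq_add_one, add_assoc, hpw b hb, hpw b₀ hb₀]
  have hκ0 : κ ≠ 0 := Finset.prod_ne_zero_iff.2 fun b' hb' =>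
    (hr.trans (hsep _ hb₀ _ (Finset.mem_of_mem_erase hb') (Finset.ne_of_mem_erase hb').symm)).ne'
  have hprod : ∀ τ ∈ R, ∏ b ∈ S, max r (w (τ - b)) = r * κ := fun τ hτ => by
    rw [hprodmax τ hτ, hκ _ (hrepS τ hτ)]
  set lam := r * κ with hlam
  have hlam0 : lam ≠ 0 := mul_ne_zero hr.ne' hκ0
  have hlam1 : lam ≤ 1 := by
    rw [← pow_le_one_iff_of_nonneg zero_le (Nat.succ_ne_zero (j + 1)), Nat.succ_eq_add_one,
      add_assoc,
      hlam, mul_pow, hpw b₀ hb₀]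
    exact hrK
  set F : L[X] := ∏ τ ∈ R, (X - C τ) with hF
  have hFm : F.Monic := monic_prod_of_monic _ _ fun b _ => monic_X_sub_C b
  have hFd : F.natDegree = N * (j + 2) := by
    rw [hF, natDegree_prod_of_monic _ _ fun b _ => monic_X_sub_C b]; simp [hcard]
  have hFb : ∀ τ ∈ R, TaylorBound w r τ F (lam ^ (j + 2)) := by
    intro τ hτ
    rw [← hprod τ hτ, ← hmax]
    exact TaylorBound.prod _ _ _ fun b _ => TaylorBound.X_sub_C b
  set P₀ : L[X] := ∏ b ∈ S, (X - C b) with hP₀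
  have hP₀m : P₀.Monic := monic_prod_of_monic _ _ fun b _ => monic_X_sub_C b
  have hP₀d : P₀.natDegree = N := by
    rw [hP₀, natDegree_prod_of_monic _ _ fun b _ => monic_X_sub_C b]; simp [hN]
  have hP₀b : ∀ τ ∈ R, TaylorBound w r τ P₀ lam := by
    intro τ hτ
    rw [← hprod τ hτ]
    exact TaylorBound.prod _ _ _ fun b _ => TaylorBound.X_sub_C b
  have hstep : ∀ P : L[X], P.Monic → P.natDegree = N →
      ((∀ τ ∈ R, TaylorBound w r τ P lam) ∧ DivBound w r R P lam) →
      (F - P ^ (j + 2)).natDegree < N * (j + 2) →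
      ((∀ τ ∈ R, TaylorBound w r τ (P + C (algebraMap ℚ L (1 / (j + 2))) *
        ((F - P ^ (j + 2)) /ₘ P ^ (j + 1))) lam) ∧
        DivBound w r R (P + C (algebraMap ℚ L (1 / (j + 2))) *
        ((F - P ^ (j + 2)) /ₘ P ^ (j + 1))) lam) := by
    intro P hP hPd ⟨hPb, hPD⟩ hlt
    have h1 : ∀ τ ∈ R, TaylorBound w r τ (F - P ^ (j + 2)) (lam ^ (j + 2)) :=
      fun τ hτ => (hFb τ hτ).sub ((hPb τ hτ).pow _)
    have h2 := hPD.pow hP (j + 1) _ _ h1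
    have h3 : ∀ τ ∈ R, TaylorBound w r τ (C (algebraMap ℚ L (1 / (j + 2))) *
        ((F - P ^ (j + 2)) /ₘ P ^ (j + 1))) lam := by
      intro τ hτ
      refine ((TaylorBound.C_of_le (hwQ _)).mul (h2 τ hτ)).mono ?_
      rw [one_mul, show j + 2 = (j + 1) + 1 by rfl, pow_succ, mul_comm, ← mul_assoc,
        inv_mul_cancel₀ (pow_ne_zero _ hlam0), one_mul]
    refine ⟨fun τ hτ => (hPb τ hτ).add (h3 τ hτ), hPD.add hlam0 hP hPb ?_ h3⟩
    rw [degree_eq_natDegree hP.ne_zero, hPd]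
    refine lt_of_le_of_lt degree_le_natDegree ?_
    refine Nat.cast_lt.2 (lt_of_le_of_lt (natDegree_C_mul_le _ _) ?_)
    rw [natDegree_divByMonic _ (hP.pow _), hP.natDegree_pow, hPd]
    have e1 : N * (j + 2) = N * (j + 1) + N := by ring
    have e2 : (j + 1) * N = N * (j + 1) := by ring
    omega
  obtain ⟨G, hGm, hGd, ⟨hGb, -⟩, hGlt⟩ := exists_approx_root (A := L) hNpos hFm hFd
    (fun P => (∀ τ ∈ R, TaylorBound w r τ P lam) ∧ DivBound w r R P lam) hstep hP₀m hP₀d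
    ⟨hP₀b, divBound_prod_X_sub_C hr hSR hκ0 hκ hprod⟩
  have hfm : f.Monic := monic_of_injective hφ (hf ▸ hFm)
  have hfd : f.natDegree = N * (j + 2) := by
    rw [← natDegree_map_eq_of_injective hφ, hf, hFd]
  obtain ⟨g, hgm, hgd, -, hglt⟩ := exists_approx_root (A := A) hNpos hfm hfd (fun _ => True)
    (fun _ _ _ _ _ => trivial) (monic_X_pow N) (natDegree_X_pow N) trivial
  refine ⟨g, hgm, hgd ▸ hNpos, ?_, fun τ hτ => ?_⟩
  · rw [hgd, hcard]; nlinarith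
  have hgG : g.map φ = G := by
    refine approx_root_unique hNpos hGm hGd (hgm.map φ) (by rw [hgm.natDegree_map, hgd]) hGlt ?_
    rw [← hf, ← Polynomial.map_pow, ← Polynomial.map_sub]
    exact lt_of_le_of_lt natDegree_map_le hglt
  rw [hgG]
  exact (hGb τ hτ).eval_le.trans hlam1

end Cluster

end

section

open Polynomial

section Dominant

variable {L Γ : Type*} [Field L] [LinearOrderedCommGroupWithZero Γ] {w : Valuation L Γ}
  {r : Γ} {R : Finset L}

/-- `a` is the last index at which `w (h.coeff i) * r ^ i` is maximal, with `w (h.coeff a) = v`. -/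
structure IsDominant (w : Valuation L Γ) (r : Γ) (h : L[X]) (a : ℕ) (v : Γ) : Prop where
  ne_zero : v ≠ 0
  le : ∀ i, w (h.coeff i) * r ^ i ≤ v * r ^ a
  eq : w (h.coeff a) = v
  lt : ∀ i, a < i → w (h.coeff i) * r ^ i < v * r ^ a

theorem IsDominant.unique {h h' : L[X]} {a a' : ℕ} {v v' : Γ} (H : IsDominant w r h a v)
    (H' : IsDominant w r h' a' v') (hh : ∀ i, w (h.coeff i) = w (h'.coeff i)) :
    a = a' ∧ v = v' := by
  have key : a = a' := by
    rcases lt_trichotomy a a' with h1 | h1 | h1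
    · have h2 := H.lt _ h1
      have h3 := H'.le a
      rw [hh, H'.eq] at h2
      rw [← hh, H.eq] at h3
      exact absurd h2 (not_lt.2 h3)
    · exact h1
    · have h2 := H'.lt _ h1
      have h3 := H.le a'
      rw [← hh, H.eq] at h2
      rw [hh, H'.eq] at h3
      exact absurd h2 (not_lt.2 h3)
  subst key
  exact ⟨rfl, by rw [← H.eq, hh, H'.eq]⟩

theorem IsDominant.X_sub_C_mul_of_le (hr : 0 < r) {h : L[X]} {a : ℕ} {v : Γ}
    (H : IsDominant w r h a v) {e : L} (he : w e ≤ r) :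
    IsDominant w r ((X - C e) * h) (a + 1) v := by
  have hco : ∀ i, ((X - C e) * h).coeff i = (X * h).coeff i - e * h.coeff i := by
    intro i; rw [sub_mul, coeff_sub, coeff_C_mul]
  have hX : ∀ i, w ((X * h).coeff i) * r ^ i ≤ v * r ^ (a + 1) := by
    intro i
    rcases i with _ | i
    · simp
    · rw [coeff_X_mul, pow_succ, pow_succ, ← mul_assoc, ← mul_assoc]
      exact mul_le_mul_left (H.le i) _
  have hXlt : ∀ i, a + 1 < i → w ((X * h).coeff i) * r ^ i < v * r ^ (a + 1) := by
    intro i hi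
    rcases i with _ | i
    · omega
    · rw [coeff_X_mul, pow_succ, pow_succ, ← mul_assoc, ← mul_assoc]
      exact mul_lt_mul_of_pos_right (H.lt i (by omega)) hr
  have hE : ∀ i, w (e * h.coeff i) * r ^ i ≤ v * r ^ (a + 1) := by
    intro i
    rw [map_mul, mul_assoc, pow_succ, ← mul_assoc v, mul_comm]
    exact mul_le_mul' (H.le i) he
  have hElt : ∀ i, a < i → w (e * h.coeff i) * r ^ i < v * r ^ (a + 1) := by
    intro i hi
    rw [map_mul, mul_assoc, pow_succ, ← mul_assoc v, mul_comm]
    exact (mul_le_mul_right he _).trans_lt (mul_lt_mul_of_pos_right (H.lt i hi) hr)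
  refine ⟨H.ne_zero, fun i => ?_, ?_, fun i hi => ?_⟩
  · rw [hco]
    rcases le_max_iff.1 (w.map_sub ((X * h).coeff i) (e * h.coeff i)) with h3 | h3
    · exact (mul_le_mul_left h3 _).trans (hX i)
    · exact (mul_le_mul_left h3 _).trans (hE i)
  · rw [hco, coeff_X_mul, Valuation.map_sub_eq_of_lt_left, H.eq]
    rw [H.eq]
    exact lt_of_mul_lt_mul_right (hElt (a + 1) (by omega)) zero_le
  · rw [hco]
    rcases le_max_iff.1 (w.map_sub ((X * h).coeff i) (e * h.coeff i)) with h3 | h3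
    · exact (mul_le_mul_left h3 _).trans_lt (hXlt i hi)
    · exact (mul_le_mul_left h3 _).trans_lt (hElt i (by omega))

theorem IsDominant.X_sub_C_mul_of_lt (hr : 0 < r) {h : L[X]} {a : ℕ} {v : Γ}
    (H : IsDominant w r h a v) {e : L} (he : r < w e) :
    IsDominant w r ((X - C e) * h) a (w e * v) := by
  have hv := zero_lt_iff.2 H.ne_zero
  have hco : ∀ i, ((X - C e) * h).coeff i = (X * h).coeff i - e * h.coeff i := by
    intro i; rw [sub_mul, coeff_sub, coeff_C_mul]
  have hX : ∀ i, w ((X * h).coeff i) * r ^ i < w e * v * r ^ a := by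
    intro i
    rcases i with _ | i
    · rw [coeff_X_mul_zero, map_zero, zero_mul]
      exact mul_pos (mul_pos (hr.trans he) hv) (pow_pos hr _)
    · rw [coeff_X_mul, pow_succ, ← mul_assoc, mul_comm _ r, mul_assoc (w e)]
      exact (mul_le_mul_right (H.le i) _).trans_lt
        (mul_lt_mul_of_pos_right he (mul_pos hv (pow_pos hr _)))
  have hE : ∀ i, w (e * h.coeff i) * r ^ i ≤ w e * v * r ^ a := by
    intro i
    rw [map_mul, mul_assoc, mul_assoc]
    exact mul_le_mul_right (H.le i) _
  have hElt : ∀ i, a < i → w (e * h.coeff i) * r ^ i < w e * v * r ^ a := by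
    intro i hi
    rw [map_mul, mul_assoc, mul_assoc]
    exact mul_lt_mul_of_pos_left (H.lt i hi) (hr.trans he)
  refine ⟨mul_ne_zero (hr.trans he).ne' H.ne_zero, fun i => ?_, ?_, fun i hi => ?_⟩
  · rw [hco]
    rcases le_max_iff.1 (w.map_sub ((X * h).coeff i) (e * h.coeff i)) with h3 | h3
    · exact (mul_le_mul_left h3 _).trans (hX i).le
    · exact (mul_le_mul_left h3 _).trans (hE i)
  · rw [hco, Valuation.map_sub_eq_of_lt_right, map_mul, H.eq]
    rw [map_mul, H.eq]
    exact lt_of_mul_lt_mul_right (hX a) zero_le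
  · rw [hco]
    rcases le_max_iff.1 (w.map_sub ((X * h).coeff i) (e * h.coeff i)) with h3 | h3
    · exact (mul_le_mul_left h3 _).trans_lt (hX i)
    · exact (mul_le_mul_left h3 _).trans_lt (hElt i (by omega))

theorem isDominant_prod (hr : 0 < r) [DecidableEq L] (e : L → L) (s : Finset L) :
    IsDominant w r (∏ y ∈ s, (X - C (e y))) (s.filter fun y => w (e y) ≤ r).card
      (∏ y ∈ s with r < w (e y), w (e y)) := by
  induction s using Finset.induction_on with
  | empty =>
    refine ⟨by simp, fun i => ?_, by simp, fun i hi => ?_⟩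
    · rcases i with _ | i <;> simp [coeff_one]
    · simp only [Finset.filter_empty, Finset.card_empty] at hi
      simp [coeff_one, hi.ne']
  | insert a s ha ih =>
    rw [Finset.prod_insert ha, Finset.filter_insert, Finset.filter_insert]
    by_cases h : w (e a) ≤ r
    · rw [if_pos h, if_neg (not_lt.2 h), Finset.card_insert_of_notMem (by simp [ha])]
      exact ih.X_sub_C_mul_of_le hr h
    · rw [if_neg h, if_pos (not_le.1 h), Finset.prod_insert (by simp [ha])]
      exact ih.X_sub_C_mul_of_lt hr (not_le.1 h)

theorem exists_monic_small [DecidableEq L] {A : Type*} [CommRing A] [IsDomain A]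
    [CharZero A]
    [Algebra ℚ A] (φ : A →+* L) (hφ : Function.Injective φ) [CharZero L]
    (hwQ : ∀ q : ℚ, w (algebraMap ℚ L q) ≤ 1) {f : A[X]} (hf : f.map φ = ∏ τ ∈ R, (X - C τ))
    (hhom : ∀ x ∈ R, ∀ y ∈ R, ∀ i,
      w ((taylor x (f.map φ)).coeff i) = w ((taylor y (f.map φ)).coeff i))
    (hmin : ∀ x ∈ R, ∀ y ∈ R, x ≠ y → r ≤ w (x - y))
    (hatt : ∃ x ∈ R, ∃ y ∈ R, x ≠ y ∧ w (x - y) = r)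
    (hr1 : ∃ x ∈ R, r * ∏ y ∈ R.erase x, w (x - y) ≤ 1) :
    ∃ g : A[X], g.Monic ∧ 0 < g.natDegree ∧ g.natDegree < R.card ∧
      ∀ τ ∈ R, w ((g.map φ).eval τ) ≤ 1 := by
  obtain ⟨x₀, hx₀, y₀, hy₀, hne, hxy⟩ := hatt
  have hr : 0 < r := by rw [← hxy, zero_lt_iff, w.ne_zero_iff]; exact sub_ne_zero.2 hne
  have hdom : ∀ x ∈ R, IsDominant w r (taylor x (f.map φ)) (R.filter fun y => w (x - y) ≤ r).card
      (∏ y ∈ R with r < w (x - y), w (x - y)) := by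
    intro x hx
    have h1 := isDominant_prod (w := w) hr (fun y => y - x) R
    have h2 : taylor x (f.map φ) = ∏ y ∈ R, (X - C (y - x)) := by
      rw [hf, ← taylorAlgHom_apply, map_prod]
      refine Finset.prod_congr rfl fun y _ => ?_
      rw [taylorAlgHom_apply, map_sub, taylor_X, taylor_C, C_sub]; ring
    simp only [w.map_sub_swap _ x] at h1
    rw [h2]; exact h1
  have huniq : ∀ x ∈ R, _ := fun x hx => (hdom x hx).unique (hdom x₀ hx₀) (hhom x hx x₀ hx₀)
  obtain ⟨j, hj⟩ : ∃ j, (R.filter fun y => w (x₀ - y) ≤ r).card = j + 2 := by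
    refine ⟨_, (Nat.sub_add_cancel ?_).symm⟩
    have : ({x₀, y₀} : Finset L) ⊆ R.filter fun y => w (x₀ - y) ≤ r := by
      intro y hy
      rcases Finset.mem_insert.1 hy with rfl | hy
      · simp [hx₀]
      · rw [Finset.mem_singleton.1 hy]; simp [hy₀, hxy]
    calc 2 = ({x₀, y₀} : Finset L).card := (Finset.card_pair hne).symm
      _ ≤ _ := Finset.card_le_card this
  refine exists_monic_small_of_cluster φ hφ hwQ hr ⟨x₀, hx₀⟩ (j := j)
    (K := ∏ y ∈ R with r < w (x₀ - y), w (x₀ - y))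
    (fun x hx => (huniq x hx).1.trans hj) (fun x hx => (huniq x hx).2) ?_ hf
  obtain ⟨x, hx, hx1⟩ := hr1
  refine le_trans (le_of_eq ?_) hx1
  rw [← (huniq x hx).2, ← hj, ← (huniq x hx).1]
  have h1 : ∏ y ∈ R, max r (w (x - y)) = r * ∏ y ∈ R.erase x, w (x - y) := by
    rw [← Finset.mul_prod_erase R _ hx]
    congr 1
    · simp
    · refine Finset.prod_congr rfl fun y hy => max_eq_right ?_
      exact hmin _ hx _ (Finset.mem_of_mem_erase hy) (Finset.ne_of_mem_erase hy).symm
  rw [← h1, ← Finset.prod_filter_mul_prod_filter_not R (fun y => w (x - y) ≤ r)]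
  congr 1
  · rw [← Finset.prod_const]
    exact Finset.prod_congr rfl fun y hy => (max_eq_left (Finset.mem_filter.1 hy).2).symm
  · simp only [not_le]
    exact Finset.prod_congr rfl fun y hy => (max_eq_right (Finset.mem_filter.1 hy).2.le).symm

end Dominant

end

section

open Polynomial

theorem exists_valuationSubring_one_lt {k L : Type*} [Field k] [Field L] [Algebra k L] {s : L}
    (hs : Transcendental k s) :
    ∃ V : ValuationSubring L, V.valuation.IsTrivialOn k ∧ 1 < V.valuation s := by
  have hsR : s ∉ (integralClosure k L).toSubring := fun h => hs (IsIntegral.isAlgebraic h)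
  have : IsIntegrallyClosedIn (integralClosure k L).toSubring L :=
    inferInstanceAs (IsIntegrallyClosedIn (integralClosure k L) L)
  obtain ⟨V, hV, hsV⟩ := Subring.exists_le_valuationSubring_of_isIntegrallyClosedIn hsR
  refine ⟨V, ⟨fun a ha => ?_⟩, ?_⟩
  · have hm : ∀ b : k, V.valuation (algebraMap k L b) ≤ 1 := fun b =>
      (V.valuation_le_one_iff _).2 (hV ((integralClosure k L).algebraMap_mem b))
    refine le_antisymm (hm a) ?_
    have h1 := hm a⁻¹
    have h0 : V.valuation (algebraMap k L a) ≠ 0 := by simpa using ha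
    rwa [map_inv₀, map_inv₀, inv_le_one₀ (zero_lt_iff.2 h0)] at h1
  · by_contra h
    exact hsV ((V.valuation_le_one_iff _).1 (not_lt.1 h))

theorem exists_eq_prod_eval {A L ι : Type*} [CommRing A] [CommRing L] [IsDomain L] (φ : A →+* L)
    {p : A[X]} (q : A[X]) (hp : p.Monic) (s : Finset ι) (x : ι → L)
    (h : p.map φ = ∏ i ∈ s, (X - C (x i))) :
    ∃ a : A, φ a = ∏ i ∈ s, (q.map φ).eval (x i) := by
  refine ⟨resultant p q p.natDegree q.natDegree, ?_⟩
  have hd : p.natDegree = (∏ i ∈ s, (X - C (x i))).natDegree := by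
    rw [← h, hp.natDegree_map]
  rw [← resultant_map_map, h, hd, resultant_prod_left _ _ _ _ (by simp) natDegree_map_le]
  refine Finset.prod_congr rfl fun i _ => ?_
  rw [natDegree_X_sub_C, resultant_X_sub_C_left _ _ _ natDegree_map_le]

section Val

variable {k L Γ : Type*} [Field k] [Field L] [Algebra k L] [LinearOrderedCommGroupWithZero Γ]
  (w : Valuation L Γ) [w.IsTrivialOn k]

theorem valuation_aeval_le_one {x : L} (hx : w x ≤ 1) (p : k[X]) : w (aeval x p) ≤ 1 := by
  rw [aeval_eq_sum_range]
  refine w.map_sum_le fun i _ => ?_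
  rw [Algebra.smul_def, map_mul, map_pow]
  refine mul_le_one' ?_ (pow_le_one₀ zero_le hx)
  rcases eq_or_ne (p.coeff i) 0 with h | h
  · simp [h]
  · exact (Valuation.IsTrivialOn.eq_one _ h).le

theorem valuation_eq_of_aeval_eq {p : k[X]} (hp : 0 < p.natDegree) {x s : L} (hs : 1 < w s)
    (h : aeval x p = aeval s p) : w x = w s := by
  have hp0 : p ≠ 0 := by rintro rfl; simp at hp
  have h1 := valuation_aeval_eq_valuation_X_pow_natDegree_of_one_lt_valuation_X (v := w) s hs hp0
  have hx : 1 < w x := by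
    by_contra hx
    have h2 := valuation_aeval_le_one w (not_lt.1 hx) p
    rw [h, h1] at h2
    exact absurd h2 (not_le.2 (one_lt_pow₀ hs hp.ne'))
  have h2 := valuation_aeval_eq_valuation_X_pow_natDegree_of_one_lt_valuation_X (v := w) x hx hp0
  rw [h, h1] at h2
  exact ((pow_left_inj₀ zero_le zero_le hp.ne').1 h2).symm

theorem valuation_algebraMap_rat_le_one [CharZero k] [CharZero L] (q : ℚ) :
    w (algebraMap ℚ L q) ≤ 1 := by
  have : algebraMap ℚ L q = algebraMap k L q := by simp
  rw [this]
  rcases eq_or_ne (q : k) 0 with h | h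
  · simp [h]
  · exact (Valuation.IsTrivialOn.eq_one _ h).le

end Val

end

section

open Polynomial

section Roots

variable {k L : Type*} [Field k] [Field L] [Algebra k L]

theorem prod_erase_sub_eq [DecidableEq L] {z : k[X]} {c : L} {R : Finset L}
    (hR : z.map (algebraMap k L) - C c = ∏ x ∈ R, (X - C x)) {y : L} (hy : y ∈ R) :
    ∏ x ∈ R.erase y, (y - x) = aeval y (derivative z) := by
  have h := congrArg (fun p => (derivative p).eval y) hR
  simp only [derivative_sub, derivative_C, sub_zero, derivative_map, eval_map_algebraMap] at h
  rw [h, ← Finset.mul_prod_erase R _ hy, derivative_mul]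
  simp [eval_prod]

variable [CharZero k]

theorem exists_root_finset [IsAlgClosed L] [DecidableEq L] {z : k[X]} (hz : z.Monic)
    (hzd : 0 < z.natDegree) {s : L} (hs : Transcendental k s) :
    ∃ R : Finset L, (∀ x, x ∈ R ↔ aeval x z = aeval s z) ∧ R.card = z.natDegree ∧
      z.map (algebraMap k L) - C (aeval s z) = ∏ x ∈ R, (X - C x) := by
  set h : L[X] := z.map (algebraMap k L) - C (aeval s z) with hh
  have hlt : (C (aeval s z)).degree < (z.map (algebraMap k L)).degree := by
    refine degree_C_le.trans_lt ?_
    rw [degree_map, degree_eq_natDegree hz.ne_zero]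
    exact_mod_cast hzd
  have hm : h.Monic := (hz.map _).sub_of_left hlt
  have hd : h.natDegree = z.natDegree := by
    rw [hh, natDegree_sub_C, hz.natDegree_map]
  have hroot : ∀ x, x ∈ h.roots ↔ aeval x z = aeval s z := fun x => by
    rw [mem_roots hm.ne_zero, IsRoot.def, hh, eval_sub, eval_C, eval_map_algebraMap, sub_eq_zero]
  have hnd : h.roots.Nodup := by
    refine nodup_roots ?_
    rw [Polynomial.separable_def]
    refine isCoprime_of_irreducible_dvd (fun h0 => hm.ne_zero h0.1) fun q hq hq1 hq2 => ?_
    obtain ⟨x, hx⟩ := IsAlgClosed.exists_root q hq.degree_pos.ne'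
    have h1 : x ∈ h.roots := (mem_roots hm.ne_zero).2 (hx.dvd hq1)
    have h2 : aeval x (derivative z) = 0 := by
      have := hx.dvd hq2
      rwa [IsRoot.def, hh, derivative_sub, derivative_C, sub_zero, derivative_map,
        eval_map_algebraMap] at this
    have h3 : derivative z ≠ 0 := fun h0 => by
      have := derivative_eq_zero.1 h0; omega
    have h4 : IsAlgebraic k x := ⟨_, h3, h2⟩
    have h5 : IsAlgebraic k (aeval x z) := by
      have h6 := (aeval (⟨x, h4.isIntegral⟩ : integralClosure k L) z).2
      rw [aeval_subalgebra_coe] at h6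
      exact IsIntegral.isAlgebraic h6
    rw [(hroot x).1 h1] at h5
    exact absurd h5 (hs.aeval z hzd.ne'
      (mem_nonZeroDivisors_of_ne_zero (leadingCoeff_ne_zero.2 hz.ne_zero)))
  refine ⟨h.roots.toFinset, fun x => by rw [Multiset.mem_toFinset, hroot], ?_, ?_⟩
  · rw [Multiset.toFinset_card_of_nodup hnd, ← hd, IsAlgClosed.card_roots_eq_natDegree]
  · rw [Finset.prod_eq_multiset_prod, Multiset.toFinset_val, hnd.dedup]
    exact (IsAlgClosed.splits h).eq_prod_roots_of_monic hm

variable {Γ : Type*} [LinearOrderedCommGroupWithZero Γ] {w : Valuation L Γ} [w.IsTrivialOn k]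

theorem valuation_sub_roots_eq [DecidableEq L] {z : k[X]} {s : L} {R : Finset L}
    (hzd : 0 < z.natDegree) (hs : 1 < w s)
    (hR : z.map (algebraMap k L) - C (aeval s z) = ∏ x ∈ R, (X - C x))
    (hmem : ∀ x, x ∈ R ↔ aeval x z = aeval s z) (hcard : R.card = z.natDegree)
    {x y : L} (hx : x ∈ R) (hy : y ∈ R) (hxy : x ≠ y) : w (y - x) = w s := by
  have hw : ∀ x ∈ R, w x = w s := fun x hx => valuation_eq_of_aeval_eq w hzd hs ((hmem x).1 hx)
  have h1 := congrArg w (prod_erase_sub_eq hR hy)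
  have h3 : derivative z ≠ 0 := fun h0 => by
      have := derivative_eq_zero.1 h0; omega
  rw [valuation_aeval_eq_valuation_X_pow_natDegree_of_one_lt_valuation_X (v := w) y
    (by rwa [hw y hy]) h3, hw y hy, natDegree_derivative, map_prod] at h1
  have hle : ∀ x ∈ R.erase y, w (y - x) ≤ w s := fun x hx => by
    refine (w.map_sub _ _).trans (max_le (hw y hy).le (hw x (Finset.mem_of_mem_erase hx)).le)
  by_contra hne
  have hx' : x ∈ R.erase y := Finset.mem_erase.2 ⟨hxy, hx⟩
  have hlt := lt_of_le_of_ne (hle x hx') hne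
  have h0 : 0 < w s := zero_lt_one.trans hs
  rw [← Finset.mul_prod_erase _ _ hx'] at h1
  have h5 : ∏ a ∈ (R.erase y).erase x, w (y - a) ≤ w s ^ ((R.erase y).erase x).card := by
    rw [← Finset.prod_const]
    exact Finset.prod_le_prod' fun a ha => hle a (Finset.mem_of_mem_erase ha)
  have h6 : z.natDegree - 1 = ((R.erase y).erase x).card + 1 := by
    rw [Finset.card_erase_add_one hx', Finset.card_erase_of_mem hy, hcard]
  rw [h6, pow_succ'] at h1
  refine absurd h1 (ne_of_lt ?_)
  calc _ ≤ w (y - x) * _ := mul_le_mul_right h5 _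
    _ < _ := mul_lt_mul_of_pos_right hlt (pow_pos h0 _)

theorem prod_valuation_sub_eq [DecidableEq L] {z t : k[X]} {σ : k[X][X]}
    (hσ : (σ.map (aeval z : k[X] →ₐ[k] k[X]).toRingHom).eval t = X) (hz : z.Monic)
    (hzd : 0 < z.natDegree) {s : L} {R : Finset L} (hs : 1 < w s)
    (hR : z.map (algebraMap k L) - C (aeval s z) = ∏ x ∈ R, (X - C x)) (hsR : s ∈ R) :
    ∏ x ∈ R.erase s, w (aeval s t - aeval x t) = w s ^ (z.natDegree - 1) := by
  have h3 : derivative z ≠ 0 := fun h0 => by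
      have := derivative_eq_zero.1 h0; omega
  set φ : k[X] →+* L := (aeval s : k[X] →ₐ[k] L).toRingHom with hφ
  have hφC : φ.comp C = algebraMap k L := by ext; simp [hφ]
  have hφX : φ X = s := by simp [hφ]
  have hφinj : ∀ a, φ a = 0 → a = 0 := by
    intro a ha
    by_contra h0
    have := valuation_aeval_eq_valuation_X_pow_natDegree_of_one_lt_valuation_X (v := w) s hs h0
    change w (φ a) = _ at this
    rw [ha, map_zero] at this
    exact (pow_pos (zero_lt_one.trans hs) _).ne this
  obtain ⟨t₁, ht₁⟩ := X_sub_C_dvd_sub_C_eval (a := X) (p := t.map (C : k →+* k[X]))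
  obtain ⟨z₁, hz₁⟩ := X_sub_C_dvd_sub_C_eval (a := X) (p := z.map (C : k →+* k[X]))
  have hzX : ∀ p : k[X], (p.map (C : k →+* k[X])).eval X = p := fun p => by
    rw [eval_map]; exact eval₂_C_X
  obtain ⟨σ₁, hσ₁⟩ := X_sub_C_dvd_sub_C_eval (a := t)
    (p := σ.map (aeval z : k[X] →ₐ[k] k[X]).toRingHom)
  rw [hzX] at ht₁ hz₁
  rw [hσ] at hσ₁
  have hz₁m : z₁.Monic := by
    have h1 : (z.map (C : k →+* k[X]) - C z).Monic := by
      refine (hz.map _).sub_of_left (degree_C_le.trans_lt ?_)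
      rw [hz.degree_map, degree_eq_natDegree hz.ne_zero]
      exact_mod_cast hzd
    exact (monic_X_sub_C (X : k[X])).of_mul_monic_left (hz₁ ▸ h1)
  have hz₁p : z₁.map φ = ∏ x ∈ R.erase s, (X - C x) := by
    have h1 := congrArg (Polynomial.map φ) hz₁
    rw [Polynomial.map_sub, Polynomial.map_map, hφC, map_C, Polynomial.map_mul, Polynomial.map_sub,
      map_X, map_C, hφX] at h1
    change z.map (algebraMap k L) - C (aeval s z) = _ at h1
    rw [hR, ← Finset.mul_prod_erase R _ hsR] at h1
    exact (mul_left_cancel₀ (X_sub_C_ne_zero s) h1).symm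
  obtain ⟨a, ha⟩ := exists_eq_prod_eval φ t₁ hz₁m _ id hz₁p
  obtain ⟨b, hb⟩ := exists_eq_prod_eval φ (σ₁.comp (t.map C)) hz₁m _ id hz₁p
  simp only [id] at ha hb
  have hzx : ∀ x ∈ R, aeval x z = aeval s z := fun x hx => by
    have h1 := congrArg (Polynomial.eval x) hR
    rw [eval_prod, Finset.prod_eq_zero hx (by simp), eval_sub, eval_C, eval_map_algebraMap,
      sub_eq_zero] at h1
    exact h1
  have hAT : ∀ x, aeval x t - aeval s t = (x - s) * (t₁.map φ).eval x := fun x => by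
    have h1 := congrArg (fun p => (p.map φ).eval x) ht₁
    simp only [Polynomial.map_sub, Polynomial.map_mul, Polynomial.map_map, hφC, map_C, map_X,
      eval_sub, eval_mul, eval_C, eval_X, hφX, eval_map_algebraMap] at h1
    exact h1
  have hBT : ∀ x ∈ R, x - s = (aeval x t - aeval s t) * ((σ₁.comp (t.map C)).map φ).eval x := by
    intro x hx
    have h1 := congrArg (fun p => (p.map φ).eval (aeval x t)) hσ₁
    simp only [Polynomial.map_sub, Polynomial.map_mul, Polynomial.map_map, map_C, map_X,
      eval_sub, eval_mul, eval_C, eval_X, hφX] at h1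
    have h2 : (σ.map (φ.comp (aeval z : k[X] →ₐ[k] k[X]).toRingHom)).eval (aeval x t) = x := by
      have h4 := congrArg (aeval x) hσ
      rw [aeval_X] at h4
      conv_rhs => rw [← h4]
      have h5 : φ.comp (aeval z : k[X] →ₐ[k] k[X]).toRingHom =
          (aeval x : k[X] →ₐ[k] L).toRingHom.comp (aeval z : k[X] →ₐ[k] k[X]).toRingHom := by
        ext
        · simp [hφ]
        · simp [hφ, hzx x hx]
      rw [h5, ← Polynomial.map_map, eval_map]
      exact eval₂_at_apply (aeval x : k[X] →ₐ[k] L).toRingHom t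
    rw [h2] at h1
    rw [Polynomial.map_comp, Polynomial.map_map, hφC, eval_comp, eval_map_algebraMap]
    exact h1
  have hab : a * b = 1 := by
    rw [← sub_eq_zero]
    apply hφinj
    rw [map_sub, map_one, map_mul, ha, hb, ← Finset.prod_mul_distrib, sub_eq_zero]
    refine Finset.prod_eq_one fun x hx => ?_
    have hne : x - s ≠ 0 := sub_ne_zero.2 (Finset.ne_of_mem_erase hx)
    have h1 := hBT x (Finset.mem_of_mem_erase hx)
    rw [hAT x, mul_assoc] at h1
    exact (mul_left_cancel₀ hne (by rw [mul_one]; exact h1)).symm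
  have hwa : w (φ a) = 1 := by
    obtain ⟨c, hc, hca⟩ := isUnit_iff.1 (IsUnit.of_mul_eq_one _ hab)
    rw [← hca]
    change w (aeval s (C c)) = 1
    rw [aeval_C]
    exact Valuation.IsTrivialOn.eq_one _ hc.ne_zero
  have h6 : ∏ x ∈ R.erase s, w (aeval s t - aeval x t) =
      w (∏ x ∈ R.erase s, (s - x)) * w (φ a) := by
    rw [ha, ← map_mul, ← Finset.prod_mul_distrib, map_prod]
    refine Finset.prod_congr rfl fun x _ => ?_
    rw [w.map_sub_swap, hAT, map_mul, map_mul, w.map_sub_swap]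
  rw [h6, hwa, mul_one, prod_erase_sub_eq hR hsR,
    valuation_aeval_eq_valuation_X_pow_natDegree_of_one_lt_valuation_X (v := w) s hs h3,
    natDegree_derivative]

end Roots

end

section

open Polynomial

theorem dvd_or_dvd_of_mul_sub_gcd_le {n m : ℕ} (hn : 0 < n) (hm : 0 < m)
    (h : m * (n - n.gcd m) ≤ (n - 1) * n.gcd m) : n ∣ m ∨ m ∣ n := by
  obtain ⟨a, ha⟩ := n.gcd_dvd_left m
  obtain ⟨b, hb⟩ := n.gcd_dvd_right m
  have hd : 0 < n.gcd m := Nat.gcd_pos_of_pos_left _ hn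
  set d := n.gcd m
  have ha0 : 0 < a := Nat.pos_of_ne_zero fun h0 => by simp [h0] at ha; omega
  have hb0 : 0 < b := Nat.pos_of_ne_zero fun h0 => by simp [h0] at hb; omega
  by_contra hcon
  rw [not_or] at hcon
  have ha2 : 2 ≤ a := by
    by_contra h1
    have : a = 1 := by omega
    exact hcon.1 ⟨b, by rw [ha, this, mul_one]; exact hb⟩
  have hb2 : 2 ≤ b := by
    by_contra h1
    have : b = 1 := by omega
    exact hcon.2 ⟨a, by rw [hb, this, mul_one]; exact ha⟩
  obtain ⟨a, rfl⟩ := Nat.exists_eq_add_of_le ha2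
  obtain ⟨b, rfl⟩ := Nat.exists_eq_add_of_le hb2
  have h1 : n - d = d * (1 + a) := by rw [ha]; exact Nat.sub_eq_of_eq_add (by ring)
  rw [h1] at h
  have h2 : (n - 1) * d < n * d := Nat.mul_lt_mul_of_pos_right (by omega) hd
  have h3 : m * (d * (1 + a)) < n * d := h.trans_lt h2
  rw [ha, hb] at h3
  have h4 : d * d * ((2 + b) * (1 + a)) < d * d * (2 + a) := by
    calc _ = d * (2 + b) * (d * (1 + a)) := by ring
      _ < _ := h3
      _ = _ := by ring
  have := Nat.lt_of_mul_lt_mul_left h4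
  nlinarith

section Val

variable {k L : Type*} [Field k] [Field L] [Algebra k L]

theorem card_le_gcd_of_valuation_pow_sub_one_lt (V : ValuationSubring L) (D : Finset L) {n m : ℕ}
    (hn : 0 < n) (hD : ∀ u ∈ D, V.valuation u ≤ 1) (hDn : ∀ u ∈ D, V.valuation (u ^ n - 1) < 1)
    (hDm : ∀ u ∈ D, V.valuation (u ^ m - 1) < 1)
    (hdist : ∀ u ∈ D, ∀ v ∈ D, u ≠ v → V.valuation (u - v) = 1) : D.card ≤ n.gcd m := by
  classical
  let ρ : D → IsLocalRing.ResidueField V := fun u =>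
    IsLocalRing.residue V ⟨u, (V.valuation_le_one_iff _).1 (hD u u.2)⟩
  have hpow : ∀ (u : D) (j : ℕ), V.valuation ((u : L) ^ j - 1) < 1 → ρ u ^ j = 1 := by
    intro u j h
    rw [← sub_eq_zero, ← map_pow, ← map_one (IsLocalRing.residue V), ← map_sub,
      IsLocalRing.residue_eq_zero_iff, V.valuation_lt_one_iff]
    exact h
  have hinj : Function.Injective ρ := by
    intro u v huv
    by_contra hne
    rw [← sub_eq_zero, ← map_sub, IsLocalRing.residue_eq_zero_iff, V.valuation_lt_one_iff] at huv
    exact huv.ne (hdist u u.2 v v.2 (fun h => hne (Subtype.ext h)))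
  have hg : 0 < n.gcd m := Nat.gcd_pos_of_pos_left _ hn
  calc D.card = (Finset.univ.image ρ).card := by
        rw [Finset.card_image_of_injective _ hinj, Finset.card_univ, Fintype.card_coe]
    _ ≤ (nthRoots (n.gcd m) (1 : IsLocalRing.ResidueField V)).toFinset.card := by
        refine Finset.card_le_card fun y hy => ?_
        obtain ⟨u, -, rfl⟩ := Finset.mem_image.1 hy
        rw [Multiset.mem_toFinset, mem_nthRoots hg]
        exact pow_gcd_eq_one.2 ⟨hpow u n (hDn u u.2), hpow u m (hDm u u.2)⟩
    _ ≤ _ := (Multiset.toFinset_card_le _).trans (card_nthRoots _ _)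

variable {Γ : Type*} [LinearOrderedCommGroupWithZero Γ] {w : Valuation L Γ} [w.IsTrivialOn k]

theorem valuation_aeval_eraseLead_lt {p : k[X]} {x : L} (hx : 1 < w x) :
    w (aeval x p.eraseLead) < w x ^ p.natDegree := by
  rcases eraseLead_natDegree_lt_or_eraseLead_eq_zero p with h | h
  · by_cases h0 : p.eraseLead = 0
    · rw [h0, map_zero, map_zero]
      exact pow_pos (zero_lt_one.trans hx) _
    · rw [valuation_aeval_eq_valuation_X_pow_natDegree_of_one_lt_valuation_X (v := w) x hx h0]
      exact pow_lt_pow_right₀ hx h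
  · rw [h, map_zero, map_zero]
    exact pow_pos (zero_lt_one.trans hx) _

theorem valuation_div_pow_sub_one_lt {p : k[X]} (hp : 0 < p.natDegree) {x s : L} (hs : 1 < w s)
    (hx : w x = w s) (h : w (aeval s p - aeval x p) < w s ^ p.natDegree) :
    w ((x / s) ^ p.natDegree - 1) < 1 := by
  have h0 : 0 < w s := zero_lt_one.trans hs
  have hs0 : s ≠ 0 := (w.pos_iff).1 h0
  have hlc : p.leadingCoeff ≠ 0 := leadingCoeff_ne_zero.2 fun h => by simp [h] at hp
  have key : ∀ y : L, aeval y p = aeval y p.eraseLead +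
      algebraMap k L p.leadingCoeff * y ^ p.natDegree := fun y => by
    have h2 := congrArg (aeval y) (eraseLead_add_C_mul_X_pow p)
    rw [map_add, map_mul, map_pow, aeval_C, aeval_X] at h2
    exact h2.symm
  have h1 : algebraMap k L p.leadingCoeff * (x ^ p.natDegree - s ^ p.natDegree) =
      aeval s p.eraseLead - aeval x p.eraseLead - (aeval s p - aeval x p) := by
    rw [key s, key x]; ring
  have h2 : w (x ^ p.natDegree - s ^ p.natDegree) < w s ^ p.natDegree := by
    have h3 := congrArg w h1
    rw [map_mul, Valuation.IsTrivialOn.eq_one _ hlc, one_mul] at h3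
    rw [h3]
    refine w.map_sub_lt (w.map_sub_lt (valuation_aeval_eraseLead_lt hs) ?_) h
    rw [← hx]
    exact valuation_aeval_eraseLead_lt (hx ▸ hs)
  have h4 : (x / s) ^ p.natDegree - 1 =
      (x ^ p.natDegree - s ^ p.natDegree) / s ^ p.natDegree := by
    rw [div_pow, sub_div, div_self (pow_ne_zero _ hs0)]
  rw [h4, map_div₀, map_pow]
  exact (div_lt_one₀ (pow_pos h0 _)).2 h2

theorem aeval_eval_map_aeval (z t : k[X]) (p : k[X][X]) (x : L) :
    aeval x ((p.map (aeval z : k[X] →ₐ[k] k[X]).toRingHom).eval t) =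
      (p.map (aeval (aeval x z) : k[X] →ₐ[k] L).toRingHom).eval (aeval x t) := by
  have h5 : (aeval (aeval x z) : k[X] →ₐ[k] L).toRingHom =
      (aeval x : k[X] →ₐ[k] L).toRingHom.comp (aeval z : k[X] →ₐ[k] k[X]).toRingHom := by
    ext <;> simp
  rw [h5, ← Polynomial.map_map]
  exact ((eval_map _ _).trans (eval₂_at_apply (aeval x : k[X] →ₐ[k] L).toRingHom t)).symm

theorem natDegree_eq_zero_of_valuation_aeval_le_one {p : k[X]} {s : L} (hs : 1 < w s)
    (h : w (aeval s p) ≤ 1) : p.natDegree = 0 := by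
  by_contra h0
  have hp : p ≠ 0 := fun h => by simp [h] at h0
  rw [valuation_aeval_eq_valuation_X_pow_natDegree_of_one_lt_valuation_X (v := w) s hs hp] at h
  exact absurd h (not_le.2 (one_lt_pow₀ hs h0))

theorem aeval_injective_of_one_lt_valuation {s : L} (hs : 1 < w s) :
    Function.Injective (aeval s : k[X] →ₐ[k] L) := by
  rw [injective_iff_map_eq_zero]
  intro p hp
  have h1 := natDegree_eq_zero_of_valuation_aeval_le_one (w := w) hs (p := p) (by simp [hp])
  rw [eq_C_of_natDegree_eq_zero h1, aeval_C, map_eq_zero] at hp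
  rw [eq_C_of_natDegree_eq_zero h1, hp, C_0]

variable [CharZero k]

theorem one_lt_valuation_sub_mul_pow [DecidableEq L] {z t : k[X]} {σ : k[X][X]}
    (hσ : (σ.map (aeval z : k[X] →ₐ[k] k[X]).toRingHom).eval t = X) (hz : z.Monic)
    (hzd : 0 < z.natDegree) {s : L} {R : Finset L} (hs : 1 < w s)
    (hR : z.map (algebraMap k L) - C (aeval s z) = ∏ x ∈ R, (X - C x))
    (hmem : ∀ x, x ∈ R ↔ aeval x z = aeval s z) (hcard : R.card = z.natDegree)
    {x y : L} (hx : x ∈ R) (hy : y ∈ R) (hxy : x ≠ y) :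
    1 < w (aeval x t - aeval y t) * w s ^ (z.natDegree - 1) := by
  have : CharZero L := charZero_of_injective_algebraMap (algebraMap k L).injective
  set ψ : k[X] →+* L := (aeval (aeval s z) : k[X] →ₐ[k] L).toRingHom with hψ
  have hev : ∀ x ∈ R, ∀ p : k[X][X], (p.map ψ).eval (aeval x t) =
      aeval x ((p.map (aeval z : k[X] →ₐ[k] k[X]).toRingHom).eval t) := fun x hx p => by
    rw [aeval_eval_map_aeval, (hmem x).1 hx]
  have hsR : s ∈ R := (hmem s).2 rfl
  have hz0 : z ≠ 0 := hz.ne_zero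
  have hwx : ∀ x ∈ R, w x = w s := fun x hx => valuation_eq_of_aeval_eq w hzd hs ((hmem x).1 hx)
  have hψinj : Function.Injective ψ := by
    refine aeval_injective_of_one_lt_valuation (w := w) ?_
    rw [valuation_aeval_eq_valuation_X_pow_natDegree_of_one_lt_valuation_X (v := w) s hs hz0]
    exact one_lt_pow₀ hs hzd.ne'
  have htinj : Set.InjOn (fun x => aeval x t) (R : Set L) := by
    intro a ha b hb hab
    have h1 := hev a ha σ
    have h2 := hev b hb σ
    rw [hσ, aeval_X] at h1 h2
    rw [← h1, ← h2]
    exact congrArg (fun u => (σ.map ψ).eval u) hab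
  let R' : Finset L := R.image (fun x => aeval x t)
  have hcard' : R'.card = z.natDegree := by rw [Finset.card_image_of_injOn htinj, hcard]
  have hne : (R ×ˢ R).filter (fun a => a.1 ≠ a.2) |>.Nonempty :=
    ⟨(x, y), Finset.mem_filter.2 ⟨Finset.mem_product.2 ⟨hx, hy⟩, hxy⟩⟩
  obtain ⟨⟨a, b⟩, hab, hmin⟩ := Finset.exists_min_image _
    (fun a : L × L => w (aeval a.1 t - aeval a.2 t)) hne
  simp only [Finset.mem_filter, Finset.mem_product] at hab hmin
  obtain ⟨⟨ha, hb⟩, hab⟩ := hab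
  have h0 : 0 < w s ^ (z.natDegree - 1) := pow_pos (zero_lt_one.trans hs) _
  refine lt_of_lt_of_le ?_ (mul_le_mul_left (hmin (x, y) ⟨⟨hx, hy⟩, hxy⟩) _)
  by_contra hcon
  rw [not_lt] at hcon
  have hΦ : ∃ f : k[X][X], f.map ψ = ∏ x ∈ R, (X - C (aeval x t)) := by
    have h1 : ((z.map ((C : k[X] →+* k[X][X]).comp C)) - C (C (X : k[X]))).map (mapRingHom ψ) =
        ∏ x ∈ R, (X - C (C x)) := by
      have h2 := congrArg (Polynomial.map (C : L →+* L[X])) hR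
      simp only [Polynomial.map_sub, Polynomial.map_map, Polynomial.map_prod, map_X, map_C] at h2
      rw [← h2, Polynomial.map_sub, Polynomial.map_map, map_C]
      congr 2
      · ext x
        simp [hψ]
      · simp [hψ]
    have h3 : ((z.map ((C : k[X] →+* k[X][X]).comp C)) - C (C (X : k[X]))).Monic := by
      refine (hz.map _).sub_of_left (degree_C_le.trans_lt ?_)
      rw [hz.degree_map, degree_eq_natDegree hz.ne_zero]
      exact_mod_cast hzd
    obtain ⟨f, hf⟩ := exists_eq_prod_eval (mapRingHom ψ)
      (C (X : k[X][X]) - t.map ((C : k[X] →+* k[X][X]).comp C)) h3 R (fun x => C x) h1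
    refine ⟨f, ?_⟩
    change mapRingHom ψ f = _
    rw [hf]
    refine Finset.prod_congr rfl fun x _ => ?_
    rw [Polynomial.map_sub, Polynomial.map_map, map_C, eval_sub, eval_C]
    congr 1
    · simp
    · have h4 : (mapRingHom ψ).comp ((C : k[X] →+* k[X][X]).comp C) =
          (C : L →+* L[X]).comp (algebraMap k L) := by
        ext; simp [hψ]
      rw [h4, ← Polynomial.map_map, eval_map, eval₂_at_apply, eval_map_algebraMap]
  obtain ⟨f, hf⟩ := hΦ
  have hf' : f.map ψ = ∏ τ ∈ R', (X - C τ) := by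
    rw [hf, Finset.prod_image htinj]
  have hcoeff : ∀ x ∈ R, ∀ i, w ((taylor (aeval x t) (f.map ψ)).coeff i) =
      w ((taylor (aeval s t) (f.map ψ)).coeff i) := by
    have h1 : ∀ x ∈ R, ∀ i, (taylor (aeval x t) (f.map ψ)).coeff i =
        aeval x ((taylor t (f.map (aeval z : k[X] →ₐ[k] k[X]).toRingHom)).coeff i) := by
      intro x hx i
      have h5 : ψ = (aeval x : k[X] →ₐ[k] L).toRingHom.comp
          (aeval z : k[X] →ₐ[k] k[X]).toRingHom := by
        ext
        · simp [hψ]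
        · simp [hψ, (hmem x).1 hx]
      have h6 := map_taylor (f.map (aeval z : k[X] →ₐ[k] k[X]).toRingHom) t
        (aeval x : k[X] →ₐ[k] L).toRingHom
      rw [Polynomial.map_map, ← h5] at h6
      have h7 := congrArg (fun p => p.coeff i) h6
      simp only [coeff_map] at h7
      exact h7.symm
    intro x hx i
    rw [h1 x hx, h1 s hsR]
    set G := (taylor t (f.map (aeval z : k[X] →ₐ[k] k[X]).toRingHom)).coeff i
    by_cases hG : G = 0
    · simp [hG]
    · rw [valuation_aeval_eq_valuation_X_pow_natDegree_of_one_lt_valuation_X (v := w) s hs hG,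
        valuation_aeval_eq_valuation_X_pow_natDegree_of_one_lt_valuation_X (v := w) x
          (by rwa [hwx x hx]) hG, hwx x hx]
  obtain ⟨g, hgm, hg0, hgd, hg⟩ := exists_monic_small (w := w)
    (r := w (aeval a t - aeval b t)) (R := R') ψ hψinj
    (valuation_algebraMap_rat_le_one (k := k) w) hf'
    (by
      intro u hu v hv i
      obtain ⟨x, hx, rfl⟩ := Finset.mem_image.1 hu
      obtain ⟨y, hy, rfl⟩ := Finset.mem_image.1 hv
      rw [hcoeff x hx, hcoeff y hy])
    (by
      intro u hu v hv huv
      obtain ⟨x, hx, rfl⟩ := Finset.mem_image.1 hu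
      obtain ⟨y, hy, rfl⟩ := Finset.mem_image.1 hv
      exact hmin (x, y) ⟨⟨hx, hy⟩, fun h => huv (by simp only at h; rw [h])⟩)
    ⟨_, Finset.mem_image_of_mem _ ha, _, Finset.mem_image_of_mem _ hb,
      fun h => hab (htinj ha hb h), rfl⟩
    ⟨aeval s t, Finset.mem_image_of_mem _ hsR, by
      have h8 : R'.erase (aeval s t) = (R.erase s).image (fun x => aeval x t) := by
        ext u
        simp only [R', Finset.mem_erase, Finset.mem_image]
        constructor
        · rintro ⟨hu, x, hx, rfl⟩
          exact ⟨x, ⟨fun h => hu (by rw [h]), hx⟩, rfl⟩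
        · rintro ⟨x, ⟨hxs, hx⟩, rfl⟩
          exact ⟨fun h => hxs (htinj hx hsR h), x, hx, rfl⟩
      rw [h8, Finset.prod_image (htinj.mono (Finset.coe_subset.2 (Finset.erase_subset _ _))),
        prod_valuation_sub_eq hσ hz hzd hs hR hsR]
      exact hcon⟩
  set G : k[X] := (g.map (aeval z : k[X] →ₐ[k] k[X]).toRingHom).eval t with hG
  have hGd : G.natDegree = 0 := by
    refine natDegree_eq_zero_of_valuation_aeval_le_one (w := w) hs ?_
    rw [hG, ← hev s hsR]
    exact hg _ (Finset.mem_image_of_mem _ hsR)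
  have hgψ : (g.map ψ).natDegree = g.natDegree := hgm.natDegree_map _
  have hz' := eq_zero_of_natDegree_lt_card_of_eval_eq_zero'
    (g.map ψ - C (algebraMap k L (G.coeff 0))) R' (by
      intro u hu
      obtain ⟨x, hx, rfl⟩ := Finset.mem_image.1 hu
      rw [eval_sub, eval_C, hev x hx, ← hG, eq_C_of_natDegree_eq_zero hGd]
      simp) (by rwa [natDegree_sub_C, hgψ])
  have := congrArg natDegree hz'
  rw [natDegree_sub_C, hgψ, natDegree_zero] at this
  omega

end Val

theorem natDegree_dvd_or_dvd {k : Type*} [Field k] [CharZero k] {z t : k[X]} {σ : k[X][X]}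
    (hσ : (σ.map (aeval z : k[X] →ₐ[k] k[X]).toRingHom).eval t = X) (hz : z.Monic)
    (hzd : 0 < z.natDegree) (htd : 0 < t.natDegree) :
    z.natDegree ∣ t.natDegree ∨ t.natDegree ∣ z.natDegree := by
  classical
  let L := AlgebraicClosure (RatFunc k)
  let s : L := algebraMap (RatFunc k) L RatFunc.X
  have hsT : Transcendental k s := by
    refine (transcendental_algebraMap_iff (algebraMap (RatFunc k) L).injective).2 ?_
    exact RatFunc.transcendental_X
  obtain ⟨V, hV, hs⟩ := exists_valuationSubring_one_lt hsT
  obtain ⟨R, hmem, hcard, hR⟩ := exists_root_finset hz hzd hsT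
  set w := V.valuation with hw
  have hsR : s ∈ R := (hmem s).2 rfl
  set n := z.natDegree with hn
  set m := t.natDegree with hm
  have h0 : 0 < w s := zero_lt_one.trans hs
  have hs0 : s ≠ 0 := (w.pos_iff).1 h0
  have hwx : ∀ x ∈ R, w x = w s := fun x hx => valuation_eq_of_aeval_eq w hzd hs ((hmem x).1 hx)
  let D := R.filter fun x => w (aeval s t - aeval x t) < w s ^ m
  have hDR : D ⊆ R := Finset.filter_subset _ _
  have hsD : s ∈ D := Finset.mem_filter.2 ⟨hsR, by rw [sub_self, map_zero]; exact pow_pos h0 _⟩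
  have hdD : D.card ≤ n.gcd m := by
    rw [← Finset.card_image_of_injective D
      (fun x y hxy => (div_left_inj' hs0).1 hxy : Function.Injective (· / s))]
    refine card_le_gcd_of_valuation_pow_sub_one_lt V _ hzd ?_ ?_ ?_ ?_
    · intro u hu
      obtain ⟨x, hx, rfl⟩ := Finset.mem_image.1 hu
      rw [map_div₀]
      exact ((div_eq_one_iff_eq h0.ne').2 (hwx x (hDR hx))).le
    · intro u hu
      obtain ⟨x, hx, rfl⟩ := Finset.mem_image.1 hu
      refine valuation_div_pow_sub_one_lt (w := w) hzd hs (hwx x (hDR hx)) ?_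
      rw [(hmem x).1 (hDR hx), sub_self, map_zero]
      exact pow_pos h0 _
    · intro u hu
      obtain ⟨x, hx, rfl⟩ := Finset.mem_image.1 hu
      exact valuation_div_pow_sub_one_lt (w := w) htd hs (hwx x (hDR hx)) (Finset.mem_filter.1 hx).2
    · intro u hu v hv huv
      obtain ⟨x, hx, rfl⟩ := Finset.mem_image.1 hu
      obtain ⟨y, hy, rfl⟩ := Finset.mem_image.1 hv
      rw [← sub_div, map_div₀]
      refine (div_eq_one_iff_eq h0.ne').2 ?_
      exact valuation_sub_roots_eq (w := w) hzd hs hR hmem hcard (hDR hy) (hDR hx)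
        (fun h => huv (by rw [h]))
  have hD1 : 1 ≤ D.card := Finset.card_pos.2 ⟨s, hsD⟩
  have hDn : D.card ≤ n := hcard ▸ Finset.card_le_card hDR
  have hprod := prod_valuation_sub_eq (w := w) hσ hz hzd hs hR hsR
  have hsplit : (∏ x ∈ R \ D, w (aeval s t - aeval x t)) *
      ∏ x ∈ D.erase s, w (aeval s t - aeval x t) = w s ^ (n - 1) := by
    rw [← hprod, ← Finset.prod_union]
    · congr 1
      ext x
      simp only [Finset.mem_union, Finset.mem_sdiff, Finset.mem_erase]
      constructor
      · rintro (⟨h1, h2⟩ | ⟨h1, h2⟩)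
        · exact ⟨fun h => h2 (h ▸ hsD), h1⟩
        · exact ⟨h1, hDR h2⟩
      · rintro ⟨h1, h2⟩
        by_cases h3 : x ∈ D
        · exact Or.inr ⟨h1, h3⟩
        · exact Or.inl ⟨h2, h3⟩
    · exact Finset.disjoint_of_subset_right (Finset.erase_subset _ _) Finset.sdiff_disjoint
  have h1 : (w s ^ m) ^ (n - D.card) ≤ ∏ x ∈ R \ D, w (aeval s t - aeval x t) := by
    rw [← hcard, ← Finset.card_sdiff_of_subset hDR, ← Finset.prod_const]
    refine Finset.prod_le_prod' fun x hx => ?_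
    obtain ⟨h2, h3⟩ := Finset.mem_sdiff.1 hx
    by_contra h4
    exact h3 (Finset.mem_filter.2 ⟨h2, not_le.1 h4⟩)
  have h2 : 1 ≤ (∏ x ∈ D.erase s, w (aeval s t - aeval x t)) *
      (w s ^ (n - 1)) ^ (D.card - 1) := by
    rw [← Finset.card_erase_of_mem hsD, ← Finset.prod_const, ← Finset.prod_mul_distrib]
    refine Finset.one_le_prod' fun x hx => ?_
    obtain ⟨h2, h3⟩ := Finset.mem_erase.1 hx
    exact (one_lt_valuation_sub_mul_pow (w := w) hσ hz hzd hs hR hmem hcard hsR (hDR h3) h2.symm).le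
  have h3 : w s ^ (m * (n - D.card)) ≤ w s ^ ((n - 1) * D.card) := by
    calc w s ^ (m * (n - D.card)) = (w s ^ m) ^ (n - D.card) * 1 := by rw [mul_one, pow_mul]
      _ ≤ (∏ x ∈ R \ D, w (aeval s t - aeval x t)) *
          ((∏ x ∈ D.erase s, w (aeval s t - aeval x t)) * (w s ^ (n - 1)) ^ (D.card - 1)) :=
        mul_le_mul' h1 h2
      _ = w s ^ (n - 1) * (w s ^ (n - 1)) ^ (D.card - 1) := by rw [← mul_assoc, hsplit]
      _ = w s ^ ((n - 1) * D.card) := by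
        rw [← pow_succ', Nat.sub_add_cancel hD1, pow_mul]
  have h4 : m * (n - D.card) ≤ (n - 1) * D.card := (pow_le_pow_iff_right₀ hs).1 h3
  refine dvd_or_dvd_of_mul_sub_gcd_le hzd htd ?_
  calc m * (n - n.gcd m) ≤ m * (n - D.card) := Nat.mul_le_mul_left _ (by omega)
    _ ≤ (n - 1) * D.card := h4
    _ ≤ _ := Nat.mul_le_mul_left _ hdD

end

section

open Polynomial

section Line

variable {k : Type*} [Field k]

theorem exists_line_coordinates_of_surjective {p q p' q' : k[X]}
    (β : MvPolynomial (Fin 2) k →ₐ[k] MvPolynomial (Fin 2) k) (hβ : Function.Surjective β)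
    (h0 : MvPolynomial.aeval ![p, q] (β (MvPolynomial.X 0)) = p')
    (h1 : MvPolynomial.aeval ![p, q] (β (MvPolynomial.X 1)) = q')
    (h : ∃ u v : MvPolynomial (Fin 2) k, Algebra.adjoin k {u, v} = ⊤ ∧
      MvPolynomial.aeval ![p', q'] u = X ∧ MvPolynomial.aeval ![p', q'] v = 0) :
    ∃ u v : MvPolynomial (Fin 2) k, Algebra.adjoin k {u, v} = ⊤ ∧
      MvPolynomial.aeval ![p, q] u = X ∧ MvPolynomial.aeval ![p, q] v = 0 := by
  obtain ⟨u, v, huv, hu, hv⟩ := h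
  have hcomp : (MvPolynomial.aeval ![p, q]).comp β = MvPolynomial.aeval ![p', q'] := by
    ext i : 1
    fin_cases i
    · simpa using h0
    · simpa using h1
  refine ⟨β u, β v, ?_, ?_, ?_⟩
  · have h2 := congrArg (Subalgebra.map β) huv
    rw [AlgHom.map_adjoin, Set.image_pair, Algebra.map_top, (AlgHom.range_eq_top β).2 hβ] at h2
    exact h2
  · rw [← hu, ← hcomp]; rfl
  · rw [← hv, ← hcomp]; rfl

theorem MvPolynomial.adjoin_pair_eq_top {u v : MvPolynomial (Fin 2) k}
    (h0 : MvPolynomial.X 0 ∈ Algebra.adjoin k {u, v})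
    (h1 : MvPolynomial.X 1 ∈ Algebra.adjoin k {u, v}) : Algebra.adjoin k {u, v} = ⊤ := by
  rw [eq_top_iff, ← MvPolynomial.adjoin_range_X, Algebra.adjoin_le_iff]
  rintro _ ⟨i, rfl⟩
  fin_cases i
  · exact h0
  · exact h1

theorem surjective_aeval_of_adjoin_eq_top {A : Type*} [CommRing A] [Algebra k A] {u v : A}
    (h : Algebra.adjoin k {u, v} = ⊤) :
    Function.Surjective (MvPolynomial.aeval ![u, v] : MvPolynomial (Fin 2) k →ₐ[k] A) := by
  rw [← AlgHom.range_eq_top, ← Algebra.adjoin_range_eq_range_aeval, ← h]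
  congr 1
  simp [Set.pair_comm]

theorem exists_eval_map_aeval_eq {z t : k[X]} (h : Algebra.adjoin k {z, t} = ⊤) (a : k[X]) :
    ∃ σ : k[X][X], (σ.map (aeval z : k[X] →ₐ[k] k[X]).toRingHom).eval t = a := by
  have ha : a ∈ Algebra.adjoin k {z, t} := h ▸ Algebra.mem_top
  induction ha using Algebra.adjoin_induction with
  | mem x hx =>
    rcases hx with rfl | rfl
    · exact ⟨C X, by simp⟩
    · exact ⟨X, by simp⟩
  | algebraMap r => exact ⟨C (C r), by simp⟩
  | add x y _ _ hx hy =>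
    obtain ⟨σ, rfl⟩ := hx
    obtain ⟨τ, rfl⟩ := hy
    exact ⟨σ + τ, by rw [Polynomial.map_add, eval_add]⟩
  | mul x y _ _ hx hy =>
    obtain ⟨σ, rfl⟩ := hx
    obtain ⟨τ, rfl⟩ := hy
    exact ⟨σ * τ, by rw [Polynomial.map_mul, eval_mul]⟩

theorem natDegree_dvd_or_dvd_of_adjoin_eq_top [CharZero k] {p q : k[X]}
    (h : Algebra.adjoin k {p, q} = ⊤) (hp : 0 < p.natDegree) (hq : 0 < q.natDegree) :
    p.natDegree ∣ q.natDegree ∨ q.natDegree ∣ p.natDegree := by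
  have hp0 : p ≠ 0 := fun h => by simp [h] at hp
  have hlc : p.leadingCoeff ≠ 0 := leadingCoeff_ne_zero.2 hp0
  set z := p * C p.leadingCoeff⁻¹ with hz
  have hzm : z.Monic := monic_mul_leadingCoeff_inv hp0
  have hzd : z.natDegree = p.natDegree := natDegree_mul_leadingCoeff_inv _ hp0
  have hpz : p = p.leadingCoeff • z := by
    rw [hz, smul_eq_C_mul, mul_comm p, ← mul_assoc, ← C_mul, mul_inv_cancel₀ hlc, C_1, one_mul]
  have hadj : Algebra.adjoin k {z, q} = ⊤ := by
    rw [eq_top_iff, ← h, Algebra.adjoin_le_iff]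
    rintro x (rfl | rfl)
    · rw [hpz]
      exact Subalgebra.smul_mem _ (Algebra.subset_adjoin (by simp)) _
    · exact Algebra.subset_adjoin (by simp)
  obtain ⟨σ, hσ⟩ := exists_eval_map_aeval_eq hadj X
  rw [← hzd]
  exact natDegree_dvd_or_dvd hσ hzm (hzd ▸ hp) hq

theorem exists_line_coordinates_of_natDegree_eq_zero {p q : k[X]}
    (h : Algebra.adjoin k {p, q} = ⊤) (hq : q.natDegree = 0) :
    ∃ u v : MvPolynomial (Fin 2) k, Algebra.adjoin k {u, v} = ⊤ ∧
      MvPolynomial.aeval ![p, q] u = X ∧ MvPolynomial.aeval ![p, q] v = 0 := by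
  obtain ⟨c, rfl⟩ := natDegree_eq_zero.1 hq
  have hX : (X : k[X]) ∈ Algebra.adjoin k {p} := by
    have h1 : Algebra.adjoin k {p, C c} ≤ Algebra.adjoin k {p} := by
      rw [Algebra.adjoin_le_iff]
      rintro x (rfl | rfl)
      · exact Algebra.subset_adjoin rfl
      · exact Subalgebra.algebraMap_mem _ c
    exact h1 (h ▸ Algebra.mem_top)
  rw [Algebra.adjoin_singleton_eq_range_aeval] at hX
  obtain ⟨r, hr⟩ := hX
  have hr' : r.comp p = X := hr
  have hd : r.natDegree * p.natDegree = 1 := by rw [← natDegree_comp, hr', natDegree_X]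
  have hpd : p.natDegree ≤ 1 := (Nat.eq_one_of_mul_eq_one_left hd).le
  have ha : p.coeff 1 ≠ 0 := by
    have : p.natDegree = 1 := Nat.eq_one_of_mul_eq_one_left hd
    rw [← this]
    exact leadingCoeff_ne_zero.2 fun h0 => by simp [h0] at this
  have hp := eq_X_add_C_of_natDegree_le_one hpd
  set a := p.coeff 1
  set b := p.coeff 0
  set u : MvPolynomial (Fin 2) k := MvPolynomial.C a⁻¹ * (MvPolynomial.X 0 - MvPolynomial.C b)
    with hu
  refine ⟨u, MvPolynomial.X 1 - MvPolynomial.C c, ?_, ?_, ?_⟩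
  · have hmC : ∀ (S : Subalgebra k (MvPolynomial (Fin 2) k)) (r : k), MvPolynomial.C r ∈ S :=
      fun S r => S.algebraMap_mem r
    refine MvPolynomial.adjoin_pair_eq_top ?_ ?_
    · have h1 : (MvPolynomial.X 0 : MvPolynomial (Fin 2) k) =
          MvPolynomial.C a * u + MvPolynomial.C b := by
        rw [hu, ← mul_assoc, ← MvPolynomial.C_mul, mul_inv_cancel₀ ha, MvPolynomial.C_1, one_mul,
          sub_add_cancel]
      rw [h1]
      exact add_mem (mul_mem (hmC _ _) (Algebra.subset_adjoin (by simp))) (hmC _ _)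
    · have h1 : (MvPolynomial.X 1 : MvPolynomial (Fin 2) k) =
          MvPolynomial.X 1 - MvPolynomial.C c + MvPolynomial.C c := by rw [sub_add_cancel]
      rw [h1]
      exact add_mem (Algebra.subset_adjoin (by simp)) (hmC _ _)
  · rw [hu, map_mul, map_sub, MvPolynomial.aeval_X, MvPolynomial.algHom_C, MvPolynomial.algHom_C,
      Matrix.cons_val_zero, hp, algebraMap_eq, add_sub_cancel_right, ← mul_assoc, ← C_mul,
      inv_mul_cancel₀ ha, C_1, one_mul]
  · simp [MvPolynomial.algHom_C, algebraMap_eq]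

theorem exists_natDegree_sub_mul_pow_lt {p q : k[X]} (hp : 0 < p.natDegree)
    (h : q.natDegree ∣ p.natDegree) :
    ∃ (c : k) (j : ℕ), (p - C c * q ^ j).natDegree < p.natDegree := by
  obtain ⟨j, hj⟩ := h
  have hq : 0 < q.natDegree := Nat.pos_of_ne_zero fun h0 => by simp [h0] at hj; omega
  have hp0 : p ≠ 0 := fun h => by simp [h] at hp
  have hq0 : q.leadingCoeff ^ j ≠ 0 :=
    pow_ne_zero _ (leadingCoeff_ne_zero.2 fun h => by simp [h] at hq)
  have hc : p.leadingCoeff / q.leadingCoeff ^ j ≠ 0 :=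
    div_ne_zero (leadingCoeff_ne_zero.2 hp0) hq0
  refine ⟨p.leadingCoeff / q.leadingCoeff ^ j, j, ?_⟩
  set r := C (p.leadingCoeff / q.leadingCoeff ^ j) * q ^ j with hr
  have hrl : r.leadingCoeff = p.leadingCoeff := by
    rw [hr, leadingCoeff_mul, leadingCoeff_C, leadingCoeff_pow, div_mul_cancel₀ _ hq0]
  have hr0 : r ≠ 0 := leadingCoeff_ne_zero.1 (hrl ▸ leadingCoeff_ne_zero.2 hp0)
  have hrd : r.natDegree = p.natDegree := by
    rw [hr, natDegree_C_mul hc, natDegree_pow, hj, mul_comm]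
  have hlt : (p - r).degree < p.degree := by
    refine degree_sub_lt_left ?_ hp0 hrl.symm
    rw [degree_eq_natDegree hp0, degree_eq_natDegree hr0, hrd]
  rcases eq_or_ne (p - r) 0 with h0 | h0
  · rwa [h0, natDegree_zero]
  · exact (natDegree_lt_natDegree_iff h0).2 hlt

/-- The Abhyankar–Moh–Suzuki theorem: a generating pair of `k[X]` is the image of the pair
`(X, 0)` under a change of coordinates of the plane. -/
theorem exists_line_coordinates [CharZero k] {p q : k[X]} (h : Algebra.adjoin k {p, q} = ⊤) :
    ∃ u v : MvPolynomial (Fin 2) k, Algebra.adjoin k {u, v} = ⊤ ∧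
      MvPolynomial.aeval ![p, q] u = X ∧ MvPolynomial.aeval ![p, q] v = 0 := by
  induction hN : p.natDegree + q.natDegree using Nat.strong_induction_on generalizing p q with
  | _ N ih =>
  wlog hpq : q.natDegree ≤ p.natDegree generalizing p q
  · have h1 := this (p := q) (q := p) (by rwa [Set.pair_comm]) (by omega) (by omega)
    refine exists_line_coordinates_of_surjective
      (MvPolynomial.aeval ![MvPolynomial.X 1, MvPolynomial.X 0]) ?_ (by simp) (by simp) h1
    refine surjective_aeval_of_adjoin_eq_top (MvPolynomial.adjoin_pair_eq_top ?_ ?_) <;>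
      exact Algebra.subset_adjoin (by simp)
  rcases Nat.eq_zero_or_pos q.natDegree with hq | hq
  · exact exists_line_coordinates_of_natDegree_eq_zero h hq
  have hp : 0 < p.natDegree := hq.trans_le hpq
  have hdvd : q.natDegree ∣ p.natDegree := by
    rcases natDegree_dvd_or_dvd_of_adjoin_eq_top h hp hq with h1 | h1
    · exact (hpq.antisymm (Nat.le_of_dvd hq h1)).dvd
    · exact h1
  obtain ⟨c, j, hlt⟩ := exists_natDegree_sub_mul_pow_lt hp hdvd
  have hadj : Algebra.adjoin k {p - C c * q ^ j, q} = ⊤ := by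
    rw [eq_top_iff, ← h, Algebra.adjoin_le_iff]
    have hqm : q ∈ Algebra.adjoin k {p - C c * q ^ j, q} := Algebra.subset_adjoin (by simp)
    rintro x (rfl | rfl)
    · have h2 := add_mem (Algebra.subset_adjoin (R := k) (Set.mem_insert (x - C c * q ^ j) {q}))
        (mul_mem (Subalgebra.algebraMap_mem _ c) (pow_mem hqm j))
      rwa [algebraMap_eq, sub_add_cancel] at h2
    · exact hqm
  have h1 := ih _ (by omega) hadj rfl
  refine exists_line_coordinates_of_surjective
    (MvPolynomial.aeval ![MvPolynomial.X 0 - MvPolynomial.C c * MvPolynomial.X 1 ^ j,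
      MvPolynomial.X 1]) ?_ ?_ (by simp) h1
  · have hm1 : (MvPolynomial.X 1 : MvPolynomial (Fin 2) k) ∈ Algebra.adjoin k
      {MvPolynomial.X 0 - MvPolynomial.C c * MvPolynomial.X 1 ^ j, MvPolynomial.X 1} :=
      Algebra.subset_adjoin (by simp)
    refine surjective_aeval_of_adjoin_eq_top (MvPolynomial.adjoin_pair_eq_top ?_ hm1)
    have h3 := add_mem (Algebra.subset_adjoin (R := k) (Set.mem_insert
      (MvPolynomial.X 0 - MvPolynomial.C c * MvPolynomial.X 1 ^ j : MvPolynomial (Fin 2) k)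
      {MvPolynomial.X 1})) (mul_mem (Subalgebra.algebraMap_mem _ c) (pow_mem hm1 j))
    rwa [MvPolynomial.algebraMap_eq, sub_add_cancel] at h3
  · rw [MvPolynomial.aeval_X, Matrix.cons_val_zero, map_sub, map_mul, map_pow,
      MvPolynomial.aeval_X, MvPolynomial.aeval_X, MvPolynomial.aeval_C]
    rfl

theorem exists_adjoin_eq_top_of_surjective [CharZero k] {f : MvPolynomial (Fin 2) k}
    (π : MvPolynomial (Fin 2) k →ₐ[k] k[X]) (hπ : Function.Surjective π)
    (hker : RingHom.ker π = Ideal.span {f}) :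
    ∃ g : MvPolynomial (Fin 2) k, Algebra.adjoin k {f, g} = ⊤ := by
  have hπ' : π = MvPolynomial.aeval ![π (MvPolynomial.X 0), π (MvPolynomial.X 1)] := by
    ext i : 1
    fin_cases i <;> simp
  have hadj : Algebra.adjoin k {π (MvPolynomial.X 0), π (MvPolynomial.X 1)} = ⊤ := by
    rw [← (AlgHom.range_eq_top π).2 hπ]
    conv_rhs => rw [hπ', ← Algebra.adjoin_range_eq_range_aeval]
    simp [Set.pair_comm]
  obtain ⟨u, v, huv, hu, hv⟩ := exists_line_coordinates hadj
  rw [← hπ'] at hu hv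
  have hsurj := surjective_aeval_of_adjoin_eq_top huv
  have hfv : v ∣ f := by
    obtain ⟨F, hF⟩ := hsurj f
    have hf0 : π f = 0 := by
      rw [← RingHom.mem_ker, hker]; exact Ideal.mem_span_singleton_self f
    have h1 : MvPolynomial.aeval ![(X : k[X]), 0] F = 0 := by
      have h4 : π.comp (MvPolynomial.aeval ![u, v]) = MvPolynomial.aeval ![(X : k[X]), 0] := by
        ext i : 1
        fin_cases i <;> simp [hu, hv]
      rw [← h4, AlgHom.comp_apply, hF, hf0]
    have h2 : F - MvPolynomial.aeval ![MvPolynomial.X 0, 0] F ∈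
        Ideal.span {(MvPolynomial.X 1 : MvPolynomial (Fin 2) k)} := by
      rw [← Ideal.Quotient.mk_eq_mk_iff_sub_mem]
      have h4 : Ideal.Quotient.mkₐ k (Ideal.span {MvPolynomial.X 1}) =
          (Ideal.Quotient.mkₐ k (Ideal.span {MvPolynomial.X 1})).comp
            (MvPolynomial.aeval ![(MvPolynomial.X 0 : MvPolynomial (Fin 2) k), 0]) := by
        ext i : 1
        fin_cases i
        · simp
        · simp
      exact congrArg (fun φ => φ F) h4
    have h3 : MvPolynomial.aeval ![(MvPolynomial.X 0 : MvPolynomial (Fin 2) k), 0] F = 0 := by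
      have h4 : MvPolynomial.aeval ![(MvPolynomial.X 0 : MvPolynomial (Fin 2) k), 0] F =
          aeval (MvPolynomial.X 0 : MvPolynomial (Fin 2) k)
            (MvPolynomial.aeval ![(X : k[X]), 0] F) := by
        have h5 : MvPolynomial.aeval ![(MvPolynomial.X 0 : MvPolynomial (Fin 2) k), 0] =
            (aeval (R := k) (MvPolynomial.X 0 : MvPolynomial (Fin 2) k)).comp
              (MvPolynomial.aeval ![(X : k[X]), 0]) := by
          ext i : 1
          fin_cases i <;> simp
        exact congrArg (fun φ => φ F) h5
      rw [h4, h1, map_zero]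
    rw [h3, sub_zero] at h2
    obtain ⟨G, rfl⟩ := Ideal.mem_span_singleton.1 h2
    exact ⟨MvPolynomial.aeval ![u, v] G, by rw [← hF, map_mul]; simp⟩
  have hvf : f ∣ v := by
    rw [← Ideal.mem_span_singleton, ← hker]
    exact hv
  obtain ⟨c, hc⟩ := associated_of_dvd_dvd hvf hfv
  obtain ⟨a, ha, hac⟩ := MvPolynomial.isUnit_iff_eq_C_of_isReduced.1 c.isUnit
  refine ⟨u, ?_⟩
  rw [eq_top_iff, ← huv, Algebra.adjoin_le_iff]
  rintro x (rfl | rfl)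
  · exact Algebra.subset_adjoin (by simp)
  · rw [← hc, hac]
    exact mul_mem (Algebra.subset_adjoin (by simp)) (Subalgebra.algebraMap_mem _ a)

end Line

end

section

open Polynomial

section

variable {k F Γ : Type*} [Field k] [Field F] [Algebra k[X] F] [Algebra k F]
  [IsScalarTower k k[X] F] [LinearOrderedCommGroupWithZero Γ] (v : Valuation F Γ)
  [v.IsTrivialOn k]

theorem valuation_algebraMap_eq (hX : 1 < v (algebraMap k[X] F X)) {p : k[X]} (hp : p ≠ 0) :
    v (algebraMap k[X] F p) = v (algebraMap k[X] F X) ^ p.natDegree := by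
  have h : algebraMap k[X] F p = aeval (algebraMap k[X] F X) p := by
    rw [aeval_algebraMap_apply, aeval_X_left_apply]
  rw [h]
  exact valuation_aeval_eq_valuation_X_pow_natDegree_of_one_lt_valuation_X (v := v) _ hX hp

theorem one_le_valuation_algebraMap (hX : 1 < v (algebraMap k[X] F X)) {p : k[X]} (hp : p ≠ 0) :
    1 ≤ v (algebraMap k[X] F p) := by
  rw [valuation_algebraMap_eq v hX hp]
  exact one_le_pow₀ hX.le

theorem exists_valuation_sub_algebraMap_lt_one [IsFractionRing k[X] F]
    (hX : 1 < v (algebraMap k[X] F X)) (r : F) :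
    ∃ p : k[X], v (r - algebraMap k[X] F p) < 1 := by
  obtain ⟨a, b, hb, rfl⟩ := IsFractionRing.div_surjective (A := k[X]) r
  have hb0 : b ≠ 0 := nonZeroDivisors.ne_zero hb
  have hb' : algebraMap k[X] F b ≠ 0 := by
    simpa using hb0
  refine ⟨a / b, ?_⟩
  have h : algebraMap k[X] F a / algebraMap k[X] F b - algebraMap k[X] F (a / b) =
      algebraMap k[X] F (a % b) / algebraMap k[X] F b := by
    rw [eq_div_iff hb', sub_mul, div_mul_cancel₀ _ hb', ← map_mul, ← map_sub]
    congr 1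
    linear_combination -EuclideanDomain.div_add_mod a b
  rw [h, map_div₀]
  rcases eq_or_ne (a % b) 0 with h0 | h0
  · simp [h0]
  · rw [valuation_algebraMap_eq v hX hb0, valuation_algebraMap_eq v hX h0,
      div_lt_one₀ (pow_pos (zero_lt_one.trans hX) _)]
    refine pow_lt_pow_right₀ hX (natDegree_lt_natDegree h0 (EuclideanDomain.mod_lt a hb0))

/-- The residue at infinity, up to sign. -/
theorem exists_residue (hX : 1 < v (algebraMap k[X] F X)) : ∃ res : F →ₗ[k] k,
    (∀ p : k[X], res (algebraMap k[X] F p) = 0) ∧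
    (∀ r, v r < (v (algebraMap k[X] F X))⁻¹ → res r = 0) ∧ res (algebraMap k[X] F X)⁻¹ = 1 := by
  have h0 : 0 < (v (algebraMap k[X] F X))⁻¹ := inv_pos.mpr (zero_lt_one.trans hX)
  let S : Submodule k F :=
    { carrier := {r | v r < (v (algebraMap k[X] F X))⁻¹}
      add_mem' := fun ha hb => v.map_add_lt ha hb
      zero_mem' := by simpa using h0
      smul_mem' := fun c r hr => by
        rcases eq_or_ne c 0 with rfl | hc
        · simpa using h0
        · simpa [Algebra.smul_def, Valuation.IsTrivialOn.eq_one (v := v) c hc] using hr }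
  let T : Submodule k F := LinearMap.range (IsScalarTower.toAlgHom k k[X] F).toLinearMap
  have hmem : (algebraMap k[X] F X)⁻¹ ∉ T ⊔ S := by
    intro h
    obtain ⟨_, ⟨p, rfl⟩, r, hr, h⟩ := Submodule.mem_sup.mp h
    have h1 : algebraMap k[X] F p = (algebraMap k[X] F X)⁻¹ - r := eq_sub_of_add_eq h
    have h2 : v (algebraMap k[X] F p) = (v (algebraMap k[X] F X))⁻¹ := by
      rw [h1, v.map_sub_eq_of_lt_left (by rw [map_inv₀]; exact hr), map_inv₀]
    have hp : p ≠ 0 := by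
      rintro rfl
      rw [map_zero, map_zero] at h2
      exact h0.ne h2
    have h3 := one_le_valuation_algebraMap v hX hp
    rw [h2] at h3
    exact absurd h3 (not_le.mpr (inv_lt_one_of_one_lt₀ hX))
  obtain ⟨φ, h1, h2⟩ := Submodule.exists_le_ker_of_notMem hmem
  refine ⟨(φ (algebraMap k[X] F X)⁻¹)⁻¹ • φ, fun p => ?_, fun r hr => ?_, ?_⟩
  · have : φ (algebraMap k[X] F p) = 0 := h2 (Submodule.mem_sup_left ⟨p, rfl⟩)
    simp [this]
  · have : φ r = 0 := h2 (Submodule.mem_sup_right hr)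
    simp [this]
  · simp [h1]

theorem residue_logDeriv [CharZero k] [IsFractionRing k[X] F]
    (hX : 1 < v (algebraMap k[X] F X)) {res : F →ₗ[k] k}
    (h1 : ∀ r, v r < (v (algebraMap k[X] F X))⁻¹ → res r = 0)
    (h2 : res (algebraMap k[X] F X)⁻¹ = 1) {p : k[X]} (hp : p ≠ 0) :
    res (algebraMap k[X] F (derivative p) / algebraMap k[X] F p) = p.natDegree := by
  have hp' : algebraMap k[X] F p ≠ 0 := by simpa using hp
  have hX' : algebraMap k[X] F X ≠ 0 := by simp
  have hX0 : 0 < v (algebraMap k[X] F X) := zero_lt_one.trans hX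
  have key : algebraMap k[X] F (derivative p) / algebraMap k[X] F p =
      (p.natDegree : k) • (algebraMap k[X] F X)⁻¹ +
        algebraMap k[X] F (derivative p * X - (p.natDegree : k[X]) * p) /
          (algebraMap k[X] F p * algebraMap k[X] F X) := by
    rw [Algebra.smul_def, map_natCast, map_sub, map_mul, map_mul, map_natCast]
    field_simp
    ring
  have htail : res (algebraMap k[X] F (derivative p * X - (p.natDegree : k[X]) * p) /
          (algebraMap k[X] F p * algebraMap k[X] F X)) = 0 := by
    apply h1
    rcases eq_or_ne (derivative p * X - (p.natDegree : k[X]) * p) 0 with h0 | h0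
    · rw [h0, map_zero, zero_div, map_zero]
      exact inv_pos.mpr hX0
    · rw [map_div₀, map_mul, valuation_algebraMap_eq v hX h0, valuation_algebraMap_eq v hX hp,
        div_lt_iff₀ (mul_pos (pow_pos hX0 _) hX0), mul_comm (_ ^ _), inv_mul_cancel_left₀ hX0.ne']
      refine pow_lt_pow_right₀ hX ?_
      by_contra hlt
      apply h0
      have hdeg : (derivative p * X - (p.natDegree : k[X]) * p).natDegree ≤ p.natDegree := by
        refine (natDegree_sub_le _ _).trans (max_le ?_ ?_)
        · refine natDegree_mul_le.trans ?_
          rw [natDegree_X]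
          rcases Nat.eq_zero_or_pos p.natDegree with h | h
          · exfalso
            apply h0
            rw [natDegree_eq_zero] at h
            obtain ⟨c, rfl⟩ := h
            simp
          · have := natDegree_derivative_lt h.ne'
            lia
        · refine natDegree_mul_le.trans ?_
          simp
      rw [← leadingCoeff_eq_zero, leadingCoeff, le_antisymm hdeg (not_lt.mp hlt), coeff_sub]
      rcases Nat.eq_zero_or_pos p.natDegree with h | h
      · rw [h]; simp
      · obtain ⟨m, hm⟩ := Nat.exists_eq_succ_of_ne_zero h.ne'
        rw [hm, coeff_mul_X, coeff_derivative, ← C_eq_natCast, coeff_C_mul]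
        push_cast
        ring
  rw [key, map_add, htail, map_smul, h2, add_zero, smul_eq_mul, mul_one]

end

end

section

open Polynomial

section

variable {k F Γ : Type*} [Field k] [Field F] [Algebra k[X] F] [Algebra k F]
  [LinearOrderedCommGroupWithZero Γ] (v : Valuation F Γ)

theorem residue_zpow (hX : 1 < v (algebraMap k[X] F X)) {res : F →ₗ[k] k}
    (h0 : ∀ p : k[X], res (algebraMap k[X] F p) = 0)
    (h1 : ∀ r, v r < (v (algebraMap k[X] F X))⁻¹ → res r = 0)
    (h2 : res (algebraMap k[X] F X)⁻¹ = 1) (m : ℤ) :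
    res (algebraMap k[X] F X ^ m) = if m = -1 then 1 else 0 := by
  split_ifs with h
  · rw [h, zpow_neg_one, h2]
  · rcases le_or_gt 0 m with hm | hm
    · obtain ⟨n, rfl⟩ := Int.eq_ofNat_of_zero_le hm
      rw [zpow_natCast, ← map_pow, h0]
    · apply h1
      rw [map_zpow₀, ← zpow_neg_one]
      exact zpow_lt_zpow_right₀ hX (by lia)

/-- Continuous functionals vanishing on polynomials are represented by polynomials. -/
theorem exists_residue_mul_eq [IsScalarTower k k[X] F] [IsFractionRing k[X] F]
    [v.IsTrivialOn k] (hX : 1 < v (algebraMap k[X] F X))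
    {res : F →ₗ[k] k} (h0 : ∀ p : k[X], res (algebraMap k[X] F p) = 0)
    (h1 : ∀ r, v r < (v (algebraMap k[X] F X))⁻¹ → res r = 0)
    (h2 : res (algebraMap k[X] F X)⁻¹ = 1) (μ : F →ₗ[k] k)
    (hμ : ∀ p : k[X], μ (algebraMap k[X] F p) = 0) (c : ℕ)
    (hc : ∀ r, v r * v (algebraMap k[X] F X) ^ c < 1 → μ r = 0) :
    ∃ Y : k[X], ∀ r, μ r = res (r * algebraMap k[X] F Y) := by
  have hz : algebraMap k[X] F X ≠ 0 := by simp
  have hv : 0 < v (algebraMap k[X] F X) := zero_lt_one.trans hX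
  set z := algebraMap k[X] F X
  have rz : ∀ m : ℤ, res (z ^ m) = if m = -1 then 1 else 0 := residue_zpow v hX h0 h1 h2
  let Y : k[X] := ∑ i ∈ Finset.range c, C (μ (z ^ (-(i + 1 : ℤ)))) * X ^ i
  have hYF : algebraMap k[X] F Y = ∑ i ∈ Finset.range c, μ (z ^ (-(i + 1 : ℤ))) • z ^ (i : ℤ) := by
    rw [map_sum]
    refine Finset.sum_congr rfl fun i _ => ?_
    rw [map_mul, map_pow, Algebra.smul_def, zpow_natCast,
      IsScalarTower.algebraMap_apply k k[X] F, Polynomial.algebraMap_eq]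
  refine ⟨Y, fun r => ?_⟩
  have mono : ∀ j : ℕ, μ (z ^ ((j : ℤ) - c)) = res (z ^ ((j : ℤ) - c) * algebraMap k[X] F Y) := by
    intro j
    rw [hYF, Finset.mul_sum, map_sum]
    simp_rw [mul_smul_comm, ← zpow_add₀ hz, LinearMap.map_smul, rz, smul_eq_mul,
      mul_ite, mul_one, mul_zero]
    rcases le_or_gt c j with hj | hj
    · rw [Finset.sum_eq_zero]
      · obtain ⟨n, rfl⟩ := Nat.exists_eq_add_of_le hj
        rw [show ((c + n : ℕ) : ℤ) - c = (n : ℤ) by push_cast; ring, zpow_natCast]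
        have := hμ (X ^ n)
        rwa [map_pow] at this
      · intro i hi
        rw [if_neg (by lia)]
    · rw [Finset.sum_eq_single (c - j - 1)]
      · rw [if_pos (by lia)]
        congr 2
        lia
      · intro i _ hi
        rw [if_neg (by lia)]
      · intro h
        exact absurd (Finset.mem_range.mpr (by lia)) h
  have poly : ∀ M : k[X], μ (algebraMap k[X] F M * z ^ (-(c : ℤ))) =
      res (algebraMap k[X] F M * z ^ (-(c : ℤ)) * algebraMap k[X] F Y) := by
    intro M
    induction M using Polynomial.induction_on' with
    | add p q hp hq => rw [map_add, add_mul, add_mul, map_add, map_add, hp, hq]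
    | monomial n a =>
      have : algebraMap k[X] F (monomial n a) * z ^ (-(c : ℤ)) = a • z ^ ((n : ℤ) - c) := by
        rw [← C_mul_X_pow_eq_monomial, map_mul, map_pow, Algebra.smul_def, sub_eq_add_neg,
          zpow_add₀ hz, zpow_natCast, IsScalarTower.algebraMap_apply k k[X] F,
          Polynomial.algebraMap_eq, mul_assoc]
      rw [this, smul_mul_assoc, LinearMap.map_smul, LinearMap.map_smul, mono]
  obtain ⟨M, hM⟩ := exists_valuation_sub_algebraMap_lt_one v hX (z ^ c * r)
  set ρ := z ^ c * r - algebraMap k[X] F M with hρ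
  have hr : r = algebraMap k[X] F M * z ^ (-(c : ℤ)) + ρ * z ^ (-(c : ℤ)) := by
    rw [← add_mul, hρ, add_sub_cancel, zpow_neg, zpow_natCast]
    field_simp
  have htail : v (ρ * z ^ (-(c : ℤ))) * v z ^ c < 1 := by
    rw [map_mul, map_zpow₀, zpow_neg, zpow_natCast, mul_assoc,
      inv_mul_cancel₀ (pow_pos hv c).ne', mul_one]
    exact hM
  have htail' : res (ρ * z ^ (-(c : ℤ)) * algebraMap k[X] F Y) = 0 := by
    rcases eq_or_ne Y 0 with hY | hY
    · rw [hY, map_zero, mul_zero, map_zero]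
    · apply h1
      have hdeg : Y.natDegree + 1 ≤ c := by
        rcases Nat.eq_zero_or_pos c with hc0 | hc0
        · exact absurd (by subst hc0; simp [Y]) hY
        · have : Y.natDegree ≤ c - 1 := natDegree_sum_le_of_forall_le _ _ fun i hi =>
            (natDegree_C_mul_X_pow_le _ _).trans (by have := Finset.mem_range.mp hi; lia)
          lia
      rw [map_mul, valuation_algebraMap_eq v hX hY, ← one_div, lt_div_iff₀ hv, mul_assoc,
        ← pow_succ]
      exact (mul_le_mul_right (pow_le_pow_right₀ hX.le hdeg) _).trans_lt htail
  rw [hr, map_add, hc _ htail, add_zero, add_mul, map_add, htail', add_zero]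
  exact poly M

end

end

section

open Polynomial

section

theorem Valuation.isTrivialOn_comap_algebraMap {k F L Γ : Type*} [Field k] [Field F] [Field L]
    [LinearOrderedCommGroupWithZero Γ] [Algebra k F] [Algebra F L] [Algebra k L]
    [IsScalarTower k F L] (w : Valuation L Γ) [w.IsTrivialOn k] :
    (w.comap (algebraMap F L)).IsTrivialOn k :=
  ⟨fun a ha => by
    rw [Valuation.comap_apply, ← IsScalarTower.algebraMap_apply k F L]
    exact Valuation.IsTrivialOn.eq_one a ha⟩

variable {k F L Γ : Type*} [Field k] [Field F] [Algebra k[X] F] [Algebra k F]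
  [IsScalarTower k k[X] F] [LinearOrderedCommGroupWithZero Γ]

theorem exists_valuation_le_pow [IsFractionRing k[X] F] (v : Valuation F Γ) [v.IsTrivialOn k]
    (hX : 1 < v (algebraMap k[X] F X)) (r : F) : ∃ c : ℕ, v r ≤ v (algebraMap k[X] F X) ^ c := by
  obtain ⟨p, hp⟩ := exists_valuation_sub_algebraMap_lt_one v hX r
  refine ⟨p.natDegree, ?_⟩
  rw [← sub_add_cancel r (algebraMap k[X] F p)]
  refine v.map_add_le (hp.le.trans (one_le_pow₀ hX.le)) ?_
  rcases eq_or_ne p 0 with rfl | h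
  · simp
  · exact (valuation_algebraMap_eq v hX h).le

theorem exists_valuation_le_pow_of_isAlgebraic [IsFractionRing k[X] F] [Field L] [Algebra F L]
    [Algebra k L] [IsScalarTower k F L] (w : Valuation L Γ) [w.IsTrivialOn k]
    (hX : 1 < w (algebraMap F L (algebraMap k[X] F X))) {x : L} (hx : IsIntegral F x) :
    ∃ c : ℕ, w x ≤ w (algebraMap F L (algebraMap k[X] F X)) ^ c := by
  have := Valuation.isTrivialOn_comap_algebraMap (k := k) (F := F) w
  choose c hc using exists_valuation_le_pow (w.comap (algebraMap F L)) hX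
  obtain ⟨p, hp, h0⟩ := hx
  refine ⟨∑ i ∈ Finset.range p.natDegree, c (p.coeff i), ?_⟩
  by_contra! hlt
  have hx1 : 1 < w x := (one_le_pow₀ hX.le).trans_lt hlt
  have hn : p.natDegree ≠ 0 := by
    intro h
    rw [hp.natDegree_eq_zero.mp h] at h0
    simp at h0
  rw [eval₂_eq_sum_range, Finset.sum_range_succ, hp.coeff_natDegree, map_one, one_mul] at h0
  have h1 : w (∑ i ∈ Finset.range p.natDegree, algebraMap F L (p.coeff i) * x ^ i) <
      w x ^ p.natDegree := by
    refine w.map_sum_lt (pow_pos (zero_lt_one.trans hx1) _).ne' fun i hi => ?_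
    rw [map_mul, map_pow]
    have h2 : w (algebraMap F L (p.coeff i)) < w x :=
      ((hc (p.coeff i)).trans (pow_le_pow_right₀ hX.le
        (Finset.single_le_sum (f := fun i => c (p.coeff i)) (fun _ _ => Nat.zero_le _)
          hi))).trans_lt
        hlt
    refine (mul_lt_mul_of_pos_right h2 (pow_pos (zero_lt_one.trans hx1) i)).trans_le ?_
    rw [← pow_succ']
    exact pow_le_pow_right₀ hx1.le (by have := Finset.mem_range.mp hi; lia)
  rw [eq_neg_of_add_eq_zero_left h0, Valuation.map_neg, map_pow] at h1
  exact lt_irrefl _ h1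

theorem exists_trace_representative {K ι : Type*} [Field K] [Algebra F K] [Algebra k K]
    [IsScalarTower k F K] [FiniteDimensional F K] [CharZero F] [IsFractionRing k[X] F] [Field L]
    [Algebra F L] [Algebra k L] [IsScalarTower k F L] (w : Valuation L Γ) [w.IsTrivialOn k]
    (hX : 1 < w (algebraMap F L (algebraMap k[X] F X)))
    {res : F →ₗ[k] k} (h0 : ∀ p : k[X], res (algebraMap k[X] F p) = 0)
    (h1 : ∀ r, w (algebraMap F L r) < (w (algebraMap F L (algebraMap k[X] F X)))⁻¹ → res r = 0)
    (h2 : res (algebraMap k[X] F X)⁻¹ = 1) [Fintype ι] [DecidableEq ι]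
    (b : Module.Basis ι F K) (l : K →ₗ[k] k)
    (hb : ∀ (p : k[X]) i, l (algebraMap k[X] F p • b i) = 0)
    (hl : ∀ x, (∀ φ : K →ₐ[F] L, w (φ x) < 1) → l x = 0) :
    ∃ y : ι → k[X], ∀ x, l x = res (Algebra.trace F K (x * ∑ i, algebraMap k[X] F (y i) •
      (Algebra.traceForm F K).dualBasis (traceForm_nondegenerate F K) b i)) := by
  have := Valuation.isTrivialOn_comap_algebraMap (k := k) (F := F) w
  have key : ∀ i, ∃ Y : k[X], ∀ r, l (r • b i) = res (r * algebraMap k[X] F Y) := by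
    intro i
    have hφ : ∀ φ : K →ₐ[F] L, ∃ c : ℕ,
        w (φ (b i)) ≤ w (algebraMap F L (algebraMap k[X] F X)) ^ c := fun φ =>
      exists_valuation_le_pow_of_isAlgebraic w hX
        ((Algebra.IsIntegral.isIntegral (b i)).map φ)
    choose c hc using hφ
    refine exists_residue_mul_eq (w.comap (algebraMap F L)) hX h0 h1 h2
      (l ∘ₗ (LinearMap.toSpanSingleton F K (b i)).restrictScalars k) (fun p => hb p i)
      (∑ φ, c φ) fun r hr => hl _ fun φ => ?_
    change w (φ (r • b i)) < 1
    rw [map_smul, Algebra.smul_def, map_mul]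
    refine (mul_le_mul_right ((hc φ).trans (pow_le_pow_right₀ hX.le
      (Finset.single_le_sum (fun _ _ => Nat.zero_le _) (Finset.mem_univ φ)))) _).trans_lt hr
  choose y hy using key
  refine ⟨y, fun x => ?_⟩
  have htr : Algebra.trace F K (x * ∑ i, algebraMap k[X] F (y i) •
      (Algebra.traceForm F K).dualBasis (traceForm_nondegenerate F K) b i) =
      ∑ i, b.repr x i * algebraMap k[X] F (y i) := by
    rw [Finset.mul_sum, map_sum]
    refine Finset.sum_congr rfl fun i _ => ?_
    rw [mul_smul_comm, map_smul, smul_eq_mul, mul_comm]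
    congr 1
    have h3 := LinearMap.BilinForm.apply_dualBasis_right (traceForm_nondegenerate F K)
      (Algebra.traceForm_isSymm F) b
    conv_lhs => rw [← b.sum_repr x]
    rw [← Algebra.traceForm_apply, map_sum, LinearMap.sum_apply]
    simp_rw [map_smul, LinearMap.smul_apply, h3]
    simp
  rw [htr, map_sum]
  conv_lhs => rw [← b.sum_repr x]
  rw [map_sum]
  exact Finset.sum_congr rfl fun i _ => hy i _

end

end

section

open Polynomial

section

theorem exists_basis_adjoin {A F K : Type*} [CommRing A] [IsDomain A] [IsIntegrallyClosed A]
    [Field F] [Field K] [Algebra A F] [IsFractionRing A F] [Algebra F K] [Algebra A K]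
    [IsScalarTower A F K] [FiniteDimensional F K] [Algebra.IsSeparable F K] {t : K}
    (hadj : Algebra.adjoin F {t} = ⊤) (ht : IsIntegral A t) :
    ∃ (n : ℕ) (b : Module.Basis (Fin n) F K), (∀ i, b i ∈ Algebra.adjoin A {t}) ∧
      ∀ c : Fin n → A, aeval t (derivative (minpoly F t)) * (∑ i, algebraMap A F (c i) •
        (Algebra.traceForm F K).dualBasis (traceForm_nondegenerate F K) b i) ∈
          Algebra.adjoin A {t} := by
  have hFt : IsIntegral F t := Algebra.IsIntegral.isIntegral t
  let pb := PowerBasis.ofAdjoinEqTop hFt hadj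
  have pbgen : pb.gen = t := by simp [pb]
  have hspan : (Subalgebra.toSubmodule (Algebra.adjoin A {t})) =
      Submodule.span A (Set.range pb.basis) := by
    rw [← Submodule.span_range_natDegree_eq_adjoin (minpoly.monic ht) (minpoly.aeval _ _)]
    congr; ext y
    have : natDegree (minpoly A t) = natDegree (minpoly F t) := by
      rw [minpoly.isIntegrallyClosed_eq_field_fractions' F ht, (minpoly.monic ht).natDegree_map]
    have hd : pb.dim = natDegree (minpoly A t) := by
      rw [this, ← pbgen, pb.natDegree_minpoly]
    simp only [Finset.coe_image, Finset.coe_range, Set.mem_image, Set.mem_Iio, Set.mem_range,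
      pb.basis_eq_pow, pbgen]
    simp only [← hd]
    exact ⟨fun ⟨a, b, c⟩ ↦ ⟨⟨a, b⟩, c⟩, fun ⟨⟨a, b⟩, c⟩ ↦ ⟨a, b, c⟩⟩
  refine ⟨pb.dim, pb.basis, fun i => ?_, fun c => ?_⟩
  · rw [← Subalgebra.mem_toSubmodule, hspan]
    exact Submodule.subset_span ⟨i, rfl⟩
  · have h1 := traceForm_dualSubmodule_adjoin A F hadj ht
    have hmem : (∑ i, algebraMap A F (c i) •
        (Algebra.traceForm F K).dualBasis (traceForm_nondegenerate F K) pb.basis i) ∈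
        (Algebra.traceForm F K).dualSubmodule (Subalgebra.toSubmodule (Algebra.adjoin A {t})) := by
      rw [hspan, LinearMap.BilinForm.dualSubmodule_span_of_basis _ (traceForm_nondegenerate F K)]
      refine Submodule.sum_mem _ fun i _ => ?_
      rw [algebraMap_smul]
      exact Submodule.smul_mem _ _ (Submodule.subset_span ⟨i, rfl⟩)
    rw [h1] at hmem
    obtain ⟨d, hd, hd'⟩ := Submodule.mem_smul_pointwise_iff_exists _ _ _ |>.mp hmem
    have h0 : aeval t (derivative (minpoly F t)) ≠ 0 :=
      (Algebra.IsSeparable.isSeparable F t).aeval_derivative_ne_zero (minpoly.aeval F t)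
    rw [← hd', smul_eq_mul, mul_inv_cancel_left₀ h0]
    exact hd

theorem exists_derivation_extending_derivative {k L : Type*} (F : Type*) [Field k] [Field F]
    [Field L] [Algebra k[X] F] [IsFractionRing k[X] F] [Algebra F L] [Algebra k[X] L]
    [IsScalarTower k[X] F L] [Algebra k L] [IsScalarTower k k[X] L] [Algebra.IsSeparable F L] :
    ∃ d : Derivation k L L, ∀ p : k[X], d (algebraMap k[X] L p) =
      algebraMap k[X] L (derivative p) := by
  have := Algebra.FormallyEtale.of_isSeparable F L
  have := Algebra.FormallyEtale.of_isLocalization (Rₘ := F) (nonZeroDivisors k[X])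
  have := Algebra.FormallyEtale.comp k[X] F L
  let d0 : Derivation k k[X] L := (Algebra.linearMap k[X] L).compDer derivative'
  let e := (KaehlerDifferential.tensorKaehlerEquivOfFormallyEtale k k[X] L).symm
  let g : TensorProduct k[X] L Ω[k[X]⁄k] →ₗ[L] L := 
    TensorProduct.AlgebraTensorModule.lift
      ((LinearMap.toSpanSingleton L _ d0.liftKaehlerDifferential))
  refine ⟨(g ∘ₗ e.toLinearMap).compDer (KaehlerDifferential.D k L), fun p => ?_⟩
  change g (e (KaehlerDifferential.D k L (algebraMap k[X] L p))) = _
  rw [KaehlerDifferential.tensorKaehlerEquivOfFormallyEtale_symm_D_algebraMap]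
  simp [g, d0, derivative']

theorem Derivation.map_prod_eq_mul_sum {R A ι : Type*} [CommRing R] [Field A] [Algebra R A]
    (d : Derivation R A A) (s : Finset ι) (u : ι → A) (hu : ∀ i ∈ s, u i ≠ 0) :
    d (∏ i ∈ s, u i) = (∏ i ∈ s, u i) * ∑ i ∈ s, d (u i) / u i := by
  classical
  induction s using Finset.induction_on with
  | empty => simp
  | insert i s hi ih =>
    have h0 : u i ≠ 0 := hu i (Finset.mem_insert_self i s)
    rw [Finset.prod_insert hi, Finset.sum_insert hi, Derivation.leibniz,
      ih fun j hj => hu j (Finset.mem_insert_of_mem hj)]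
    simp only [smul_eq_mul]
    field_simp
    ring

variable {k L Γ : Type*} [Field k] [Field L] [Algebra k L] [LinearOrderedCommGroupWithZero Γ]

theorem valuation_aeval_leadingCoeff_lt_one (w : Valuation L Γ) [w.IsTrivialOn k] {H : k[X][X]}
    {z x : L} (hz : 1 < w z) (hx : w x ≤ 1)
    (h : eval₂ (aeval x : k[X] →ₐ[k] L).toRingHom z H = 0) :
    w (aeval x H.leadingCoeff) < 1 := by
  rw [eval₂_eq_sum_range, Finset.sum_range_succ] at h
  by_contra! hge
  have hz0 : 0 < w z := zero_lt_one.trans hz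
  have h1 : w (∑ i ∈ Finset.range H.natDegree,
      (aeval x : k[X] →ₐ[k] L).toRingHom (H.coeff i) * z ^ i) <
      w z ^ H.natDegree := by
    refine w.map_sum_lt (pow_pos hz0 _).ne' fun i hi => ?_
    rw [map_mul, map_pow]
    have h2 : w ((aeval x : k[X] →ₐ[k] L).toRingHom (H.coeff i)) ≤ 1 :=
      valuation_aeval_le_one w hx _
    refine (mul_le_of_le_one_left' h2).trans_lt ?_
    exact pow_lt_pow_right₀ hz (Finset.mem_range.mp hi)
  rw [eq_neg_of_add_eq_zero_left h, Valuation.map_neg, map_mul, map_pow] at h1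
  refine h1.not_ge (le_mul_of_one_le_left' hge)

end

end

section

open Polynomial

section

theorem Polynomial.eval₂_aeval_swap {k L : Type*} [CommRing k] [CommRing L] [Algebra k L]
    (x z : L) (G : k[X][X]) :
    eval₂ (aeval x : k[X] →ₐ[k] L).toRingHom z (Bivariate.swap G) =
      eval₂ (aeval z : k[X] →ₐ[k] L).toRingHom x G := by
  induction G using Polynomial.induction_on' with
  | add p q hp hq => rw [map_add, eval₂_add, eval₂_add, hp, hq]
  | monomial n a =>
    induction a using Polynomial.induction_on' with
    | add p q hp hq => rw [map_add, map_add, eval₂_add, eval₂_add, hp, hq]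
    | monomial m a =>
      rw [Bivariate.swap_monomial_monomial, eval₂_monomial, eval₂_monomial]
      simp only [AlgHom.toRingHom_eq_coe, RingHom.coe_coe, aeval_monomial]
      ring

theorem Polynomial.exists_derivative_eq {k : Type*} [Field k] [CharZero k] (p : k[X]) :
    ∃ q : k[X], derivative q = p := by
  induction p using Polynomial.induction_on' with
  | add p q hp hq =>
    obtain ⟨a, rfl⟩ := hp
    obtain ⟨b, rfl⟩ := hq
    exact ⟨a + b, derivative_add⟩
  | monomial n a =>
    refine ⟨monomial (n + 1) (a / (n + 1)), ?_⟩
    rw [derivative_monomial]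
    congr 1
    push_cast
    field_simp

variable {k F K L Γ : Type*} [Field k] [Field L] [Algebra k L] [LinearOrderedCommGroupWithZero Γ]

theorem exists_forall_one_le_valuation_add_algebraMap [CharZero k] {ι : Type*} [Finite ι]
    (w : Valuation L Γ) [w.IsTrivialOn k] (u : ι → L) :
    ∃ c : k, ∀ i, 1 ≤ w (u i + algebraMap k L c) := by
  by_contra! h
  choose i hi using h
  obtain ⟨a, b, hab, h⟩ := Finite.exists_ne_map_eq_of_infinite i
  have h1 := w.map_sub_lt (hi a) (h ▸ hi b)
  rw [add_sub_add_left_eq_sub, ← map_sub,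
    Valuation.IsTrivialOn.eq_one (A := k) _ (sub_ne_zero.mpr hab)] at h1
  exact lt_irrefl _ h1

theorem exists_algebraMap_eq_norm {A F K : Type*} [CommRing A] [IsIntegrallyClosed A] [Field F]
    [Field K] [Algebra A F] [IsFractionRing A F] [Algebra F K] [Algebra A K] [IsScalarTower A F K]
    {a : K} (ha : IsIntegral A a) : ∃ q : A, algebraMap A F q = Algebra.norm F a :=
  IsIntegrallyClosed.isIntegral_iff.mp (Algebra.isIntegral_norm F ha)

theorem algebraMap_norm_eq_prod {A F K L : Type*} [CommRing A] [Field F] [CharZero F] [Field K]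
    [Field L] [IsAlgClosed L] [Algebra A F] [Algebra F K] [FiniteDimensional F K] [Algebra A L]
    [Algebra F L] [IsScalarTower A F L] {a : K} {q : A}
    (h : algebraMap A F q = Algebra.norm F a) : algebraMap A L q = ∏ φ : K →ₐ[F] L, φ a := by
  rw [IsScalarTower.algebraMap_apply A F L, h, Algebra.norm_eq_prod_embeddings]

theorem AlgHom.map_aeval_of_isScalarTower {k F K L : Type*} [Field k] [Field F] [Field K] [Field L]
    [Algebra k F] [Algebra k K] [Algebra k L] [Algebra F K] [Algebra F L] [IsScalarTower k F K]
    [IsScalarTower k F L] (φ : K →ₐ[F] L) (a : K) (p : k[X]) :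
    φ (aeval a p) = aeval (φ a) p :=
  (aeval_algHom_apply (φ.restrictScalars k) a p).symm

variable [Field F] [Field K] [Algebra k[X] F] [Algebra F K] [Algebra k[X] K]
  [IsScalarTower k[X] F K] [Algebra k[X] L] [IsScalarTower k k[X] L] [Algebra F L]
  [IsScalarTower k[X] F L]

theorem exists_forall_valuation_aeval_lt_one (w : Valuation L Γ) [w.IsTrivialOn k]
    (hX : 1 < w (algebraMap k[X] L X)) {a : K} (ha : IsIntegral k[X] a) :
    ∃ p : k[X], p ≠ 0 ∧ ∀ φ : K →ₐ[F] L, w (φ a) ≤ 1 → w (aeval (φ a) p) < 1 := by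
  obtain ⟨G, hG, h0⟩ := ha
  refine ⟨(Bivariate.swap G).leadingCoeff, ?_, fun φ hφ => ?_⟩
  · simpa using hG.ne_zero
  · refine valuation_aeval_leadingCoeff_lt_one w hX hφ ?_
    rw [eval₂_aeval_swap]
    have h1 := congrArg φ h0
    rw [map_zero, ← AlgHom.coe_toRingHom, hom_eval₂] at h1
    have h2 : φ.toRingHom.comp (algebraMap k[X] K) =
        (aeval (algebraMap k[X] L X) : k[X] →ₐ[k] L).toRingHom := by
      refine RingHom.ext fun p => ?_
      change φ (algebraMap k[X] K p) = aeval (algebraMap k[X] L X) p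
      rw [IsScalarTower.algebraMap_apply k[X] F K, φ.commutes, aeval_algebraMap_apply,
        aeval_X_left_apply, ← IsScalarTower.algebraMap_apply]
    rw [← h2]
    exact h1

variable [Algebra k F] [IsScalarTower k k[X] F] [IsFractionRing k[X] F] [Algebra k K]
  [IsScalarTower k F K] [FiniteDimensional F K] [IsScalarTower k F L]

theorem exists_algebraMap_eq_of_forall_valuation_le_one [CharZero F] [IsAlgClosed L]
    (w : Valuation L Γ) [w.IsTrivialOn k]
    (hX : 1 < w (algebraMap k[X] L X)) {a : K} (ha : IsIntegral k[X] a)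
    (halg : IsAlgebraic k a → ∃ c : k, algebraMap k K c = a)
    (h : ∀ φ : K →ₐ[F] L, w (φ a) ≤ 1) : ∃ c : k, algebraMap k K c = a := by
  obtain ⟨p, hp, hφ⟩ := exists_forall_valuation_aeval_lt_one (F := F) w hX ha
  have ha' : IsIntegral k[X] (aeval a p) := by
    have h1 : IsIntegral k[X] (algebraMap k K 1) := by simpa using isIntegral_one
    rw [aeval_eq_sum_range]
    refine IsIntegral.sum _ fun i _ => ?_
    rw [Algebra.smul_def, IsScalarTower.algebraMap_apply k F K,
      IsScalarTower.algebraMap_apply k k[X] F, ← IsScalarTower.algebraMap_apply k[X] F K]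
    exact isIntegral_algebraMap.mul (ha.pow i)
  obtain ⟨q, hq⟩ := exists_algebraMap_eq_norm (F := F) ha'
  have hqp := algebraMap_norm_eq_prod (L := L) hq
  have hq0 : q = 0 := by
    by_contra h0
    have := Valuation.isTrivialOn_comap_algebraMap (k := k) (F := F) w
    have hX' : 1 < w (algebraMap F L (algebraMap k[X] F X)) := by
      rwa [← IsScalarTower.algebraMap_apply]
    have h1 := one_le_valuation_algebraMap (w.comap (algebraMap F L)) hX' h0
    rw [Valuation.comap_apply, ← IsScalarTower.algebraMap_apply, hqp, map_prod] at h1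
    classical
    have hlt : ∀ φ : K →ₐ[F] L, w (φ (aeval a p)) < 1 := fun φ => by
      rw [AlgHom.map_aeval_of_isScalarTower]
      exact hφ φ (h φ)
    rw [← Finset.mul_prod_erase Finset.univ _ (Finset.mem_univ (IsAlgClosed.lift : K →ₐ[F] L))]
      at h1
    exact h1.not_gt ((mul_le_of_le_one_right' (Finset.prod_le_one' fun φ _ => (hlt φ).le)).trans_lt
      (hlt _))
  rw [hq0, map_zero, eq_comm, Algebra.norm_eq_zero_iff] at hq
  exact halg ⟨p, hp, hq⟩

end

end

section

open Polynomial

section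

variable {k F K L Γ : Type*} [Field k] [Field L] [Algebra k L] [LinearOrderedCommGroupWithZero Γ]
  [Field F] [Field K] [Algebra k[X] F] [Algebra F K] [Algebra k[X] L] [Algebra F L]
  [IsScalarTower k[X] F L] [Algebra k F] [Algebra k K] [IsScalarTower k F K] [FiniteDimensional F K]
  [IsScalarTower k F L]

theorem trace_aeval_derivative_div_aeval_mul [CharZero F] [IsAlgClosed L]
    (d : Derivation k L L) (hd : ∀ p : k[X], d (algebraMap k[X] L p) =
      algebraMap k[X] L (derivative p)) {a y : K} (hy : ∀ φ : K →ₐ[F] L, d (φ a) = φ y) {Q q : k[X]}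
    (hQ : aeval a Q ≠ 0) (hq : algebraMap k[X] F q = Algebra.norm F (aeval a Q)) :
    Algebra.trace F K (aeval a (derivative Q) / aeval a Q * y) =
      algebraMap k[X] F (derivative q) / algebraMap k[X] F q := by
  apply (algebraMap F L).injective
  have h1 := d.map_prod_eq_mul_sum Finset.univ (fun φ : K →ₐ[F] L => φ (aeval a Q))
    fun φ _ => by simpa using hQ
  have hqL := algebraMap_norm_eq_prod (L := L) hq
  have hq0 : algebraMap k[X] L q ≠ 0 := by
    rw [hqL]
    exact Finset.prod_ne_zero_iff.mpr fun φ _ => by simpa using hQ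
  rw [← hqL, hd] at h1
  rw [trace_eq_sum_embeddings L, map_div₀, ← IsScalarTower.algebraMap_apply,
    ← IsScalarTower.algebraMap_apply, h1, mul_div_cancel_left₀ _ hq0]
  refine Finset.sum_congr rfl fun φ _ => ?_
  rw [map_mul, map_div₀, AlgHom.map_aeval_of_isScalarTower, AlgHom.map_aeval_of_isScalarTower,
    ← hy φ, Derivation.map_aeval, smul_eq_mul, div_mul_eq_mul_div]

variable [Algebra k[X] K] [IsScalarTower k[X] F K] [IsScalarTower k k[X] L]
  [IsScalarTower k k[X] F] [IsFractionRing k[X] F]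

theorem exists_mem_adjoin_forall_valuation_sub_lt_one [CharZero k] [CharZero F] [IsAlgClosed L]
    (w : Valuation L Γ) [w.IsTrivialOn k] (hX : 1 < w (algebraMap k[X] L X))
    (d : Derivation k L L) (hd : ∀ p : k[X], d (algebraMap k[X] L p) =
      algebraMap k[X] L (derivative p)) {t : K}
    (hadj : Algebra.adjoin F {t} = ⊤) (ht : IsIntegral k[X] t)
    (hder : ∀ b ∈ Algebra.adjoin k[X] {t}, ∃ a ∈ Algebra.adjoin k[X] {t}, ∀ φ : K →ₐ[F] L,
      d (φ a) * φ (aeval t (derivative (minpoly F t))) = φ b)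
    (halg : ∀ a ∈ Algebra.adjoin k[X] {t}, IsAlgebraic k a → ∃ c : k, algebraMap k K c = a)
    (x : K) :
    ∃ q ∈ Algebra.adjoin k[X] {t}, ∀ φ : K →ₐ[F] L, w (φ (x - q)) < 1 := by
  have := Valuation.isTrivialOn_comap_algebraMap (k := k) (F := F) w
  have : IsScalarTower k k[X] K := by
    refine IsScalarTower.of_algebraMap_eq fun c => ?_
    rw [IsScalarTower.algebraMap_apply k F K, IsScalarTower.algebraMap_apply k k[X] F,
      ← IsScalarTower.algebraMap_apply k[X] F K]
  let φ₀ : K →ₐ[F] L := IsAlgClosed.lift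
  let J : Submodule k K :=
    { carrier := {x | ∀ φ : K →ₐ[F] L, w (φ x) < 1}
      add_mem' := fun ha hb φ => by
        rw [map_add]
        exact w.map_add_lt (ha φ) (hb φ)
      zero_mem' := fun φ => by simp
      smul_mem' := fun c x hx φ => by
        rw [Algebra.smul_def, IsScalarTower.algebraMap_apply k F K, map_mul, φ.commutes, map_mul,
          ← IsScalarTower.algebraMap_apply k F L]
        rcases eq_or_ne c 0 with rfl | hc
        · simp
        · rw [Valuation.IsTrivialOn.eq_one (A := k) c hc, one_mul]
          exact hx φ }
  let S : Submodule k K :=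
    (Subalgebra.toSubmodule (Algebra.adjoin k[X] {t})).restrictScalars k ⊔ J
  by_contra hcon
  have hS : S < ⊤ := by
    refine lt_top_iff_ne_top.mpr fun h => hcon ?_
    have hx : x ∈ S := h ▸ Submodule.mem_top
    obtain ⟨q, hq, j, hj, rfl⟩ := Submodule.mem_sup.mp hx
    exact ⟨q, hq, fun φ => by rw [add_sub_cancel_left]; exact hj φ⟩
  obtain ⟨l, hl0, hl⟩ := Submodule.exists_le_ker_of_lt_top S hS
  have hlD : ∀ a ∈ Algebra.adjoin k[X] {t}, l a = 0 := fun a ha =>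
    hl (Submodule.mem_sup_left ha)
  have hlJ : ∀ a, (∀ φ : K →ₐ[F] L, w (φ a) < 1) → l a = 0 := fun a ha =>
    hl (Submodule.mem_sup_right ha)
  have hX' : 1 < w (algebraMap F L (algebraMap k[X] F X)) := by
    rwa [← IsScalarTower.algebraMap_apply]
  obtain ⟨res, h0, h1, h2⟩ := exists_residue (w.comap (algebraMap F L)) hX'
  obtain ⟨n, b, hb, hdual⟩ := exists_basis_adjoin hadj ht
  obtain ⟨c, hc⟩ := exists_trace_representative w hX' h0 h1 h2 b l (fun p i => by
    rw [algebraMap_smul]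
    exact hlD _ (Subalgebra.smul_mem _ (hb i) p)) hlJ
  have hB := hdual c
  set y : K := ∑ i, algebraMap k[X] F (c i) •
    (Algebra.traceForm F K).dualBasis (traceForm_nondegenerate F K) b i with hy
  have hm0 : aeval t (derivative (minpoly F t)) ≠ 0 :=
    (Algebra.IsSeparable.isSeparable F t).aeval_derivative_ne_zero (minpoly.aeval F t)
  obtain ⟨a, haD, ha⟩ := hder _ hB
  have hda : ∀ φ : K →ₐ[F] L, d (φ a) = φ y := fun φ => by
    have h3 := ha φ
    rw [map_mul, mul_comm] at h3
    exact mul_left_cancel₀ (by simpa using hm0) h3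
  have hy0 : y ≠ 0 := by
    rintro h
    refine hl0 (LinearMap.ext fun x => ?_)
    rw [hc, h]
    simp
  have hak : ¬ ∃ c : k, algebraMap k K c = a := by
    rintro ⟨c, rfl⟩
    have h3 := hda φ₀
    rw [IsScalarTower.algebraMap_apply k F K, φ₀.commutes, ← IsScalarTower.algebraMap_apply k F L,
      d.map_algebraMap, eq_comm, map_eq_zero] at h3
    exact hy0 h3
  have hintegral : ∀ a ∈ Algebra.adjoin k[X] {t}, IsIntegral k[X] a := fun a ha =>
    IsIntegral.of_mem_of_fg _ ht.fg_adjoin_singleton a ha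
  obtain ⟨φ₁, hφ₁⟩ : ∃ φ₁ : K →ₐ[F] L, 1 < w (φ₁ a) := by
    by_contra! h
    exact hak (exists_algebraMap_eq_of_forall_valuation_le_one w hX (hintegral a haD)
      (halg a haD) h)
  obtain ⟨P, hP0, hP⟩ := exists_forall_valuation_aeval_lt_one (F := F) w hX (hintegral a haD)
  obtain ⟨Q₀, hQ₀⟩ := Polynomial.exists_derivative_eq P
  obtain ⟨e, he⟩ := exists_forall_one_le_valuation_add_algebraMap (k := k) w
    fun φ : K →ₐ[F] L => aeval (φ a) Q₀
  obtain ⟨Q, hQ, hQw⟩ : ∃ Q : k[X], derivative Q = P ∧ ∀ φ : K →ₐ[F] L, 1 ≤ w (aeval (φ a) Q) :=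
    ⟨Q₀ + C e, by simp [hQ₀], fun φ => by simpa using he φ⟩
  have hQn : Q.natDegree ≠ 0 := fun h => hP0 (by
    rw [← hQ, eq_C_of_natDegree_eq_zero h, derivative_C])
  have hQ0 : Q ≠ 0 := fun h => hQn (by simp [h])
  have hQa : aeval a Q ≠ 0 := fun h => by
    have h3 := hQw φ₀
    rw [← AlgHom.map_aeval_of_isScalarTower, h] at h3
    simp at h3
  have hgt : ∀ (p : k[X]) (φ : K →ₐ[F] L), p ≠ 0 → 1 < w (φ a) →
      w (aeval (φ a) p) = w (φ a) ^ p.natDegree := fun p φ hp h =>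
    valuation_aeval_eq_valuation_X_pow_natDegree_of_one_lt_valuation_X (v := w) _ h hp
  have hQD : aeval a Q ∈ Algebra.adjoin k[X] {t} := by
    have h3 : Algebra.adjoin k {a} ≤ (Algebra.adjoin k[X] {t}).restrictScalars k :=
      Algebra.adjoin_le (Set.singleton_subset_iff.mpr haD)
    exact h3 (aeval_mem_adjoin_singleton k a)
  obtain ⟨q, hq⟩ := exists_algebraMap_eq_norm (F := F) (hintegral _ hQD)
  have hqL := algebraMap_norm_eq_prod (L := L) hq
  have hlx : l (aeval a P / aeval a Q) = 0 := by
    refine hlJ _ fun φ => ?_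
    rw [map_div₀, AlgHom.map_aeval_of_isScalarTower, AlgHom.map_aeval_of_isScalarTower, map_div₀]
    have hpos : 0 < w (aeval (φ a) Q) := zero_lt_one.trans_le (hQw φ)
    rw [div_lt_one₀ hpos]
    rcases le_or_gt (w (φ a)) 1 with h | h
    · exact (hP φ h).trans_le (hQw φ)
    · rw [hgt P φ hP0 h, hgt Q φ hQ0 h]
      refine pow_lt_pow_right₀ h ?_
      rw [← hQ]
      exact natDegree_derivative_lt hQn
  have hq0 : q ≠ 0 := by
    rintro rfl
    rw [map_zero, eq_comm, Algebra.norm_eq_zero_iff] at hq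
    exact hQa hq
  have htr := trace_aeval_derivative_div_aeval_mul d hd hda hQa hq
  rw [hQ] at htr
  rw [hc, htr, residue_logDeriv (w.comap (algebraMap F L)) hX' h1 h2 hq0, Nat.cast_eq_zero] at hlx
  have hw1 : w (algebraMap k[X] L q) = 1 := by
    rw [IsScalarTower.algebraMap_apply k[X] F L, ← Valuation.comap_apply,
      valuation_algebraMap_eq (w.comap (algebraMap F L)) hX' hq0, hlx, pow_zero]
  classical
  rw [hqL, map_prod, ← Finset.mul_prod_erase Finset.univ _ (Finset.mem_univ φ₁)] at hw1
  have hle : 1 ≤ ∏ φ ∈ Finset.univ.erase φ₁, w (φ (aeval a Q)) :=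
    Finset.one_le_prod' fun φ _ => by
      rw [AlgHom.map_aeval_of_isScalarTower]
      exact hQw φ
  have hlt : 1 < w (φ₁ (aeval a Q)) := by
    rw [AlgHom.map_aeval_of_isScalarTower, hgt Q φ₁ hQ0 hφ₁]
    exact one_lt_pow₀ hφ₁ hQn
  exact hw1.not_gt (hlt.trans_le (le_mul_of_one_le_right' hle))

end

end

section

open Polynomial

section

variable {k F K L Γ : Type*} [Field k] [Field L] [Algebra k L] [LinearOrderedCommGroupWithZero Γ]
  [Field F] [Field K] [Algebra F K] [Algebra F L]

theorem valuation_norm_lt_one [CharZero F] [FiniteDimensional F K] [IsAlgClosed L]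
    (w : Valuation L Γ) {x : K} (hx : ∀ φ : K →ₐ[F] L, w (φ x) < 1) :
    w (algebraMap F L (Algebra.norm F x)) < 1 := by
  classical
  rw [Algebra.norm_eq_prod_embeddings, map_prod,
    ← Finset.mul_prod_erase Finset.univ _ (Finset.mem_univ (IsAlgClosed.lift : K →ₐ[F] L))]
  exact (mul_le_of_le_one_right' (Finset.prod_le_one' fun φ _ => (hx φ).le)).trans_lt (hx _)

variable [Algebra k[X] F] [Algebra k[X] K] [Algebra k[X] L] [IsScalarTower k[X] F L] [Algebra k F]
  [Algebra k K] [IsScalarTower k F K] [FiniteDimensional F K] [IsScalarTower k F L]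
  [IsScalarTower k[X] F K] [IsScalarTower k k[X] L] [IsScalarTower k k[X] F]
  [IsFractionRing k[X] F]

theorem exists_adjoin_le_adjoin_singleton [CharZero k] [CharZero F] [IsAlgClosed L]
    (w : Valuation L Γ) [w.IsTrivialOn k] (hX : 1 < w (algebraMap k[X] L X))
    (d : Derivation k L L) (hd : ∀ p : k[X], d (algebraMap k[X] L p) =
      algebraMap k[X] L (derivative p)) {t : K}
    (hadj : Algebra.adjoin F {t} = ⊤) (ht : IsIntegral k[X] t)
    (hder : ∀ b ∈ Algebra.adjoin k[X] {t}, ∃ a ∈ Algebra.adjoin k[X] {t}, ∀ φ : K →ₐ[F] L,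
      d (φ a) * φ (aeval t (derivative (minpoly F t))) = φ b)
    (halg : ∀ a ∈ Algebra.adjoin k[X] {t}, IsAlgebraic k a → ∃ c : k, algebraMap k K c = a) :
    ∃ s ∈ Algebra.adjoin k[X] {t}, ∀ a ∈ Algebra.adjoin k[X] {t}, a ∈ Algebra.adjoin k {s} := by
  have := Valuation.isTrivialOn_comap_algebraMap (k := k) (F := F) w
  have hX' : 1 < w (algebraMap F L (algebraMap k[X] F X)) := by
    rwa [← IsScalarTower.algebraMap_apply]
  have htower : IsScalarTower k k[X] K := by
    refine IsScalarTower.of_algebraMap_eq fun c => ?_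
    rw [IsScalarTower.algebraMap_apply k F K, IsScalarTower.algebraMap_apply k k[X] F,
      ← IsScalarTower.algebraMap_apply k[X] F K]
  set D := Algebra.adjoin k[X] {t} with hD
  have hφk : ∀ (φ : K →ₐ[F] L) (c : k), φ (algebraMap k K c) = algebraMap k L c := fun φ c => by
    rw [IsScalarTower.algebraMap_apply k F K, φ.commutes, ← IsScalarTower.algebraMap_apply k F L]
  have hwk : ∀ c : k, w (algebraMap k L c) ≤ 1 := fun c => by
    rcases eq_or_ne c 0 with rfl | hc
    · simp
    · exact (Valuation.IsTrivialOn.eq_one (A := k) c hc).le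
  let φ₀ : K →ₐ[F] L := IsAlgClosed.lift
  have hintegral : ∀ a ∈ D, IsIntegral k[X] a := fun a ha =>
    IsIntegral.of_mem_of_fg _ ht.fg_adjoin_singleton a ha
  have hconst : ∀ a ∈ D, (∀ φ : K →ₐ[F] L, w (φ a) ≤ 1) → ∃ c : k, algebraMap k K c = a :=
    fun a ha => exists_algebraMap_eq_of_forall_valuation_le_one w hX (hintegral a ha) (halg a ha)
  have happrox := exists_mem_adjoin_forall_valuation_sub_lt_one w hX d hd hadj ht hder halg
  have hres : ∀ x : K, (∀ φ : K →ₐ[F] L, w (φ x) ≤ 1) →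
      ∃ c : k, ∀ φ : K →ₐ[F] L, w (φ x - algebraMap k L c) < 1 := by
    intro x hx
    obtain ⟨q, hq, hxq⟩ := happrox x
    obtain ⟨c, rfl⟩ := hconst q hq fun φ => by
      have h := w.map_sub_le (hx φ) (hxq φ).le
      rwa [← map_sub φ, sub_sub_cancel] at h
    exact ⟨c, fun φ => by rw [← hφk φ, ← map_sub]; exact hxq φ⟩
  have hbig : ∀ a ∈ D, (¬ ∃ c : k, algebraMap k K c = a) → ∀ φ : K →ₐ[F] L, 1 < w (φ a) := by
    intro a ha hak
    obtain ⟨φ₁, hφ₁⟩ : ∃ φ₁ : K →ₐ[F] L, 1 < w (φ₁ a) := by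
      by_contra! h
      exact hak (hconst a ha h)
    obtain ⟨c, hc⟩ := exists_forall_one_le_valuation_add_algebraMap (k := k) w
      fun φ : K →ₐ[F] L => φ a
    obtain ⟨c', hc'⟩ := hres (a + algebraMap k K c)⁻¹ fun φ => by
      rw [map_inv₀, map_inv₀, map_add, hφk]
      exact inv_le_one_of_one_le₀ (hc φ)
    have hφ₁' : w (φ₁ a + algebraMap k L c) = w (φ₁ a) :=
      w.map_add_eq_of_lt_left ((hwk c).trans_lt hφ₁)
    have h0 : c' = 0 := by
      by_contra hc0
      have h1 := hc' φ₁
      have h2 : w (φ₁ (a + algebraMap k K c)⁻¹) < 1 := by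
        rw [map_inv₀, map_inv₀, map_add, hφk, hφ₁']
        exact inv_lt_one_of_one_lt₀ hφ₁
      have h3 := w.map_sub_lt h2 h1
      rw [sub_sub_cancel, Valuation.IsTrivialOn.eq_one (A := k) c' hc0] at h3
      exact lt_irrefl _ h3
    intro φ
    have h1 := hc' φ
    rw [h0, map_zero, sub_zero, map_inv₀, map_inv₀, map_add, hφk] at h1
    by_contra! h
    have h2 := w.map_add_le h (hwk c)
    rw [le_antisymm h2 (hc φ), inv_one] at h1
    exact lt_irrefl _ h1
  choose q hq using fun a : D => exists_algebraMap_eq_norm (F := F) (hintegral a.1 a.2)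
  have hq0 : ∀ a : D, (a : K) ≠ 0 → q a ≠ 0 := fun a ha h => ha (by
    have h1 := hq a
    rwa [h, map_zero, eq_comm, Algebra.norm_eq_zero_iff] at h1)
  have hlt : ∀ a b : D, (a : K) ≠ 0 → (b : K) ≠ 0 →
      (∀ φ : K →ₐ[F] L, w (φ a) < w (φ b)) → (q a).natDegree < (q b).natDegree := by
    intro a b ha hb h
    have h1 : w (algebraMap F L (Algebra.norm F ((a : K) / b))) < 1 :=
      valuation_norm_lt_one w fun φ => by
        rw [map_div₀, map_div₀, div_lt_one₀ (zero_le.trans_lt (h φ))]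
        exact h φ
    have hw : ∀ c : D, (c : K) ≠ 0 → w (algebraMap F L (Algebra.norm F (c : K))) =
        w (algebraMap F L (algebraMap k[X] F X)) ^ (q c).natDegree := fun c hc => by
      rw [← hq]
      exact valuation_algebraMap_eq (w.comap (algebraMap F L)) hX' (hq0 c hc)
    have h2 : w (algebraMap F L (Algebra.norm F ((a : K) / b))) *
        w (algebraMap F L (Algebra.norm F (b : K))) =
          w (algebraMap F L (Algebra.norm F (a : K))) := by
      rw [← map_mul, ← map_mul, ← map_mul, div_mul_cancel₀ _ hb]
    have hpos := pow_pos (zero_lt_one.trans hX') (q b).natDegree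
    rw [hw a ha, hw b hb] at h2
    rw [← pow_lt_pow_iff_right₀ hX', ← h2]
    exact mul_lt_of_lt_one_left hpos h1
  have hz : ¬ ∃ c : k, algebraMap k K c = algebraMap k[X] K X := by
    rintro ⟨c, hc⟩
    have h1 := hφk φ₀ c
    rw [hc, IsScalarTower.algebraMap_apply k[X] F K, φ₀.commutes] at h1
    rw [h1] at hX'
    exact hX'.not_ge (hwk c)
  obtain ⟨s, hs, hmin⟩ := WellFounded.has_min (measure fun a : D => (q a).natDegree).wf
    {a : D | ¬ ∃ c : k, algebraMap k K c = a} ⟨⟨_, D.algebraMap_mem X⟩, hz⟩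
  have hs1 := hbig s s.2 hs
  have hs0 : (s : K) ≠ 0 := fun h => hs ⟨0, by rw [map_zero, h]⟩
  have hmain : ∀ (n : ℕ) (a : D), (q a).natDegree = n → (a : K) ∈ Algebra.adjoin k {(s : K)} := by
    intro n
    induction n using Nat.strong_induction_on with
    | _ n ih =>
    intro a ha
    by_cases hak : ∃ c : k, algebraMap k K c = a
    · obtain ⟨c, hc⟩ := hak
      rw [← hc]
      exact Subalgebra.algebraMap_mem _ _
    have ha1 := hbig a a.2 hak
    have ha0 : (a : K) ≠ 0 := fun h => hak ⟨0, by rw [map_zero, h]⟩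
    obtain ⟨r, hr, hr'⟩ := happrox (a / s)
    have hjs : ∀ φ : K →ₐ[F] L, w (φ (a - r * s)) < w (φ s) := fun φ => by
      have h1 : (a - r * s : K) = (a / s - r) * s := by field_simp
      rw [h1, map_mul, map_mul]
      exact mul_lt_of_lt_one_left (zero_lt_one.trans (hs1 φ)) (hr' φ)
    have hjD : (a - r * s : K) ∈ D := D.sub_mem a.2 (D.mul_mem hr s.2)
    obtain ⟨c, hc⟩ : ∃ c : k, algebraMap k K c = a - r * s := by
      by_contra hcon
      have h0 : (a - r * s : K) ≠ 0 := fun h => hcon ⟨0, by rw [map_zero, h]⟩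
      exact hmin ⟨_, hjD⟩ hcon (hlt ⟨_, hjD⟩ s h0 hs0 hjs)
    have hars : (a : K) = r * s + algebraMap k K c := by rw [hc]; ring
    have hrmem : r ∈ Algebra.adjoin k {(s : K)} := by
      rcases eq_or_ne r 0 with rfl | hr0
      · exact Subalgebra.zero_mem _
      refine ih _ ?_ ⟨r, hr⟩ rfl
      rw [← ha]
      refine hlt ⟨r, hr⟩ a hr0 ha0 fun φ => ?_
      have h1 : w (φ r) * w (φ s) = w (φ a) := by
        rw [← map_mul, ← map_mul, eq_sub_of_add_eq hars.symm, map_sub, hφk]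
        exact w.map_sub_eq_of_lt_left ((hwk c).trans_lt (ha1 φ))
      rw [← h1]
      have hpos : 0 < w (φ r) := by
        rw [zero_lt_iff]
        simpa using hr0
      exact lt_mul_of_one_lt_right hpos (hs1 φ)
    rw [hars]
    exact Subalgebra.add_mem _ (Subalgebra.mul_mem _ hrmem (Algebra.self_mem_adjoin_singleton k _))
      (Subalgebra.algebraMap_mem _ _)
  exact ⟨s, s.2, fun a ha => hmain _ ⟨a, ha⟩ rfl⟩

end

end

section

open Polynomial

section

theorem MvPolynomial.derivation_aeval_fin_two {k L : Type*} [Field k] [Field L] [Algebra k L]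
    (d : Derivation k L L) (θ : MvPolynomial (Fin 2) k →ₐ[k] L) (H : MvPolynomial (Fin 2) k) :
    d (θ H) = θ (pderiv 0 H) * d (θ (X 0)) + θ (pderiv 1 H) * d (θ (X 1)) := by
  induction H using MvPolynomial.induction_on with
  | C a => simp [MvPolynomial.algHom_C]
  | add p q hp hq => simp only [map_add, hp, hq]; ring
  | mul_X p i hp =>
    simp only [map_mul, Derivation.leibniz, hp, map_add, smul_eq_mul, pderiv_X]
    fin_cases i <;> simp <;> ring

theorem Polynomial.Bivariate.equivMvPolynomial_symm_pderiv_one {k : Type*} [CommRing k]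
    (H : MvPolynomial (Fin 2) k) :
    (equivMvPolynomial k).symm (MvPolynomial.pderiv 1 H) =
      derivative ((equivMvPolynomial k).symm H) := by
  induction H using MvPolynomial.induction_on with
  | C a =>
    have h : (equivMvPolynomial k).symm (MvPolynomial.C a) = C (C a) := by
      rw [← equivMvPolynomial_C_C, AlgEquiv.symm_apply_apply]
    simp [h]
  | add p q hp hq => simp only [map_add, hp, hq]
  | mul_X p i hp =>
    simp only [Derivation.leibniz, map_mul, hp, map_add, smul_eq_mul, MvPolynomial.pderiv_X,
      derivative_mul]
    fin_cases i <;> simp <;> ring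

variable {k F K L Γ : Type*} [Field k] [Field L] [Algebra k L] [LinearOrderedCommGroupWithZero Γ]
  [Field F] [Field K] [Algebra F K] [Algebra F L]
  [Algebra k[X] F] [Algebra k[X] K] [Algebra k[X] L] [IsScalarTower k[X] F L] [Algebra k F]
  [Algebra k K] [IsScalarTower k F K] [FiniteDimensional F K] [IsScalarTower k F L]
  [IsScalarTower k[X] F K] [IsScalarTower k k[X] L] [IsScalarTower k k[X] F]
  [IsFractionRing k[X] F]

theorem exists_surjective_ker_eq_span [CharZero k] [CharZero F] [IsAlgClosed L]
    (w : Valuation L Γ) [w.IsTrivialOn k] (hX : 1 < w (algebraMap k[X] L X))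
    (d : Derivation k L L) (hd : ∀ p : k[X], d (algebraMap k[X] L p) =
      algebraMap k[X] L (derivative p)) {t : K}
    (hadj : Algebra.adjoin F {t} = ⊤) (ht : IsIntegral k[X] t) {f : MvPolynomial (Fin 2) k}
    (hf : (Bivariate.equivMvPolynomial k).symm f = minpoly k[X] t)
    (hder : ∀ b : MvPolynomial (Fin 2) k, ∃ G, f ∣ b - (MvPolynomial.pderiv 0 f *
      MvPolynomial.pderiv 1 G - MvPolynomial.pderiv 1 f * MvPolynomial.pderiv 0 G))
    (halg : ∀ (a : MvPolynomial (Fin 2) k) (μ : k[X]), μ ≠ 0 → f ∣ aeval a μ →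
      ∃ c : k, f ∣ a - MvPolynomial.C c) :
    ∃ π : MvPolynomial (Fin 2) k →ₐ[k] k[X], Function.Surjective π ∧
      RingHom.ker π = Ideal.span {f} := by
  have htower : IsScalarTower k k[X] K := by
    refine IsScalarTower.of_algebraMap_eq fun c => ?_
    rw [IsScalarTower.algebraMap_apply k F K, IsScalarTower.algebraMap_apply k k[X] F,
      ← IsScalarTower.algebraMap_apply k[X] F K]
  have htf : Module.IsTorsionFree k[X] K := by
    have : Function.Injective (algebraMap k[X] K) := by
      rw [IsScalarTower.algebraMap_eq k[X] F K]
      exact (algebraMap F K).injective.comp (IsFractionRing.injective k[X] F)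
    exact Module.isTorsionFree_iff_algebraMap_injective.mpr this
  let e := Bivariate.equivMvPolynomial k
  let ρ : MvPolynomial (Fin 2) k →ₐ[k] K :=
    ((aeval t : k[X][X] →ₐ[k[X]] K).restrictScalars k).comp e.symm.toAlgHom
  have hρ : ∀ H, ρ H = aeval t (e.symm H) := fun _ => rfl
  have hρ0 : ρ (MvPolynomial.X 0) = algebraMap k[X] K X := by simp [hρ, e]
  have hρ1 : ρ (MvPolynomial.X 1) = t := by simp [hρ, e]
  have hker : ∀ H, ρ H = 0 ↔ f ∣ H := fun H => by
    rw [hρ, minpoly.isIntegrallyClosed_dvd_iff ht, ← hf]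
    exact map_dvd_iff e.symm
  have hρf : ρ f = 0 := (hker f).mpr dvd_rfl
  have hmem : ∀ H, ρ H ∈ Algebra.adjoin k[X] {t} := fun H =>
    aeval_mem_adjoin_singleton k[X] t
  have hsurj : ∀ a ∈ Algebra.adjoin k[X] {t}, ∃ H, ρ H = a := fun a ha => by
    rw [Algebra.adjoin_singleton_eq_range_aeval] at ha
    obtain ⟨p, rfl⟩ := ha
    exact ⟨e p, by rw [hρ, AlgEquiv.symm_apply_apply]; rfl⟩
  have hmin : aeval t (derivative (minpoly F t)) = ρ (MvPolynomial.pderiv 1 f) := by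
    rw [minpoly.isIntegrallyClosed_eq_field_fractions' F ht, derivative_map,
      aeval_map_algebraMap, hρ, Bivariate.equivMvPolynomial_symm_pderiv_one, hf]
  obtain ⟨s, hs, hsD⟩ := exists_adjoin_le_adjoin_singleton w hX d hd hadj ht (by
    intro b hb
    obtain ⟨b, rfl⟩ := hsurj b hb
    obtain ⟨G, hG⟩ := hder (-b)
    refine ⟨ρ G, hmem G, fun φ => ?_⟩
    rw [← hker, map_sub, map_sub, map_neg, sub_eq_zero] at hG
    have hb : ρ b = ρ (MvPolynomial.pderiv 1 f * MvPolynomial.pderiv 0 G) -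
        ρ (MvPolynomial.pderiv 0 f * MvPolynomial.pderiv 1 G) := by
      rw [← neg_sub, ← hG, neg_neg]
    let θ := (φ.restrictScalars k).comp ρ
    have hθ : ∀ H, φ (ρ H) = θ H := fun _ => rfl
    have hθ0 : d (θ (MvPolynomial.X 0)) = 1 := by
      rw [← hθ, hρ0, IsScalarTower.algebraMap_apply k[X] F K, φ.commutes,
        ← IsScalarTower.algebraMap_apply, hd, derivative_X, map_one]
    have h1 := MvPolynomial.derivation_aeval_fin_two d θ f
    have h2 := MvPolynomial.derivation_aeval_fin_two d θ G
    rw [← hθ f, hρf, map_zero, map_zero, hθ0] at h1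
    rw [hθ0] at h2
    rw [hmin, hb, hθ, hθ, map_sub, hθ, hθ, map_mul, map_mul, h2]
    linear_combination -θ (MvPolynomial.pderiv 1 G) * h1) (by
    intro a ha halga
    obtain ⟨a, rfl⟩ := hsurj a ha
    obtain ⟨μ, hμ, h0⟩ := halga
    rw [aeval_algHom_apply, hker] at h0
    obtain ⟨c, hc⟩ := halg a μ hμ h0
    refine ⟨c, ?_⟩
    rw [← hker, map_sub, sub_eq_zero, MvPolynomial.algHom_C] at hc
    exact hc.symm)
  have hle : ∀ a ∈ Algebra.adjoin k {s}, a ∈ Algebra.adjoin k[X] {t} := by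
    have h : Algebra.adjoin k {s} ≤ (Algebra.adjoin k[X] {t}).restrictScalars k :=
      Algebra.adjoin_le (Set.singleton_subset_iff.mpr hs)
    exact fun a ha => h ha
  have hstr : Transcendental k s := by
    intro hsalg
    have h1 : IsAlgebraic k (algebraMap k[X] K X) :=
      Algebra.isAlgebraic_adjoin_singleton_iff.mpr hsalg _ (hsD _ (Subalgebra.algebraMap_mem _ _))
    rw [isAlgebraic_algebraMap_iff (FaithfulSMul.algebraMap_injective _ _)] at h1
    exact transcendental_X k h1
  let i := AlgEquiv.ofInjective (aeval s : k[X] →ₐ[k] K) (transcendental_iff_injective.mp hstr)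
  let r := ρ.codRestrict (aeval s : k[X] →ₐ[k] K).range fun H => by
    rw [← Algebra.adjoin_singleton_eq_range_aeval]
    exact hsD _ (hmem H)
  refine ⟨i.symm.toAlgHom.comp r, ?_, ?_⟩
  · refine i.symm.surjective.comp fun ⟨a, ha⟩ => ?_
    rw [← Algebra.adjoin_singleton_eq_range_aeval] at ha
    obtain ⟨H, hH⟩ := hsurj a (hle a ha)
    exact ⟨H, Subtype.ext hH⟩
  · ext H
    rw [RingHom.mem_ker, Ideal.mem_span_singleton, ← hker]
    change i.symm (r H) = 0 ↔ _
    rw [map_eq_zero_iff _ i.symm.injective]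
    exact Subtype.ext_iff

end

end

section

open Polynomial

theorem exists_surjective_ker_eq_span_of_monic {k : Type*} [Field k] [CharZero k]
    {f : MvPolynomial (Fin 2) k} (hmon : ((Bivariate.equivMvPolynomial k).symm f).Monic)
    (hirr : Irreducible f)
    (hder : ∀ b : MvPolynomial (Fin 2) k, ∃ G, f ∣ b - (MvPolynomial.pderiv 0 f *
      MvPolynomial.pderiv 1 G - MvPolynomial.pderiv 1 f * MvPolynomial.pderiv 0 G))
    (halg : ∀ (a : MvPolynomial (Fin 2) k) (μ : k[X]), μ ≠ 0 → f ∣ aeval a μ →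
      ∃ c : k, f ∣ a - MvPolynomial.C c) :
    ∃ π : MvPolynomial (Fin 2) k →ₐ[k] k[X], Function.Surjective π ∧
      RingHom.ker π = Ideal.span {f} := by
  set p := (Bivariate.equivMvPolynomial k).symm f with hp
  have hpirr : Irreducible p := (MulEquiv.irreducible_iff _).mpr hirr
  let g : (FractionRing k[X])[X] := p.map (algebraMap k[X] (FractionRing k[X]))
  have hg : Irreducible g := hmon.irreducible_iff_irreducible_map_fraction_map.mp hpirr
  have hgm : g.Monic := hmon.map _
  have : Fact (Irreducible g) := ⟨hg⟩
  have : CharZero (FractionRing k[X]) := charZero_of_injective_algebraMap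
    (algebraMap k (FractionRing k[X])).injective
  have hroot : aeval (AdjoinRoot.root g) p = 0 := by
    have h := AdjoinRoot.eval₂_root g
    rw [eval₂_map] at h
    exact h
  have ht : IsIntegral k[X] (AdjoinRoot.root g) := ⟨p, hmon, hroot⟩
  have hmin : minpoly k[X] (AdjoinRoot.root g) = p := by
    have h := minpoly.isIntegrallyClosed_eq_field_fractions' (FractionRing k[X]) ht
    rw [AdjoinRoot.minpoly_root hgm.ne_zero, hgm.leadingCoeff, inv_one, C_1, mul_one] at h
    exact (map_injective _ (IsFractionRing.injective k[X] (FractionRing k[X])) h).symm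
  have : FiniteDimensional (FractionRing k[X]) (AdjoinRoot g) := hgm.finite_adjoinRoot
  have hz : Transcendental k (algebraMap k[X] (AlgebraicClosure (FractionRing k[X])) X) := by
    rw [Transcendental, isAlgebraic_algebraMap_iff (by
      rw [IsScalarTower.algebraMap_eq k[X] (FractionRing k[X])]
      exact (algebraMap (FractionRing k[X]) (AlgebraicClosure (FractionRing k[X]))).injective.comp
        (IsFractionRing.injective k[X] (FractionRing k[X])))]
    exact transcendental_X k
  obtain ⟨V, hV, hX⟩ := exists_valuationSubring_one_lt hz
  obtain ⟨d, hd⟩ := exists_derivation_extending_derivative (k := k)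
    (L := AlgebraicClosure (FractionRing k[X])) (FractionRing k[X])
  exact exists_surjective_ker_eq_span V.valuation hX d hd
    (AdjoinRoot.adjoinRoot_eq_top (f := g)) ht (hp.symm.trans hmin.symm) hder halg

end

section

open MvPolynomial

namespace LaurentPolynomial

theorem coeff_C_mul_T {R : Type*} [Semiring R] (r : R) (n j : ℤ) :
    (C r * T n : LaurentPolynomial R).coeff j = if n = j then r else 0 := by
  rw [show (C r * T n : LaurentPolynomial R) = .single n r from (single_eq_C_mul_T r n).symm,
    AddMonoidAlgebra.coeff_single, Finsupp.single_apply]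

theorem coeff_C_mul_T_mul {R : Type*} [CommSemiring R] (r : R) (n j : ℤ)
    (g : LaurentPolynomial R) : (C r * T n * g).coeff j = r * g.coeff (j - n) := by
  induction g using LaurentPolynomial.induction_on' with
  | add p q hp hq => simp only [mul_add, AddMonoidAlgebra.coeff_add, Finsupp.add_apply, hp, hq]
  | C_mul_T m a =>
    rw [show C r * T n * (C a * T m) = C (r * a) * T (n + m) by rw [map_mul, T_add]; ring,
      coeff_C_mul_T, coeff_C_mul_T]
    by_cases h : n + m = j
    · rw [if_pos h, if_pos (by lia)]
    · rw [if_neg h, if_neg (by lia), mul_zero]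

/-- Factors of a power of the variable are monomials. -/
theorem exists_eq_C_mul_T_of_mul_eq_T {R : Type*} [CommRing R] [IsDomain R]
    {p q : LaurentPolynomial R} {n : ℤ} (h : p * q = T n) :
    ∃ (r : R) (m : ℤ), IsUnit r ∧ p = C r * T m := by
  obtain ⟨a, p', hp'⟩ := exists_T_pow p
  obtain ⟨b, q', hq'⟩ := exists_T_pow q
  have key : ∃ N : ℕ, p' ∣ Polynomial.X ^ N := by
    refine ⟨(n + a + b).toNat + 0, Polynomial.X ^ (-(n + a + b)).toNat * q', ?_⟩
    apply Polynomial.toLaurent_injective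
    rw [map_mul, map_mul, hp', hq', Polynomial.toLaurent_X_pow, Polynomial.toLaurent_X_pow,
      show p * T (a : ℤ) * (T ((-(n + a + b)).toNat : ℤ) * (q * T (b : ℤ)))
        = (p * q) * (T (a : ℤ) * T ((-(n + a + b)).toNat : ℤ) * T (b : ℤ)) by ring, h,
      ← T_add, ← T_add, ← T_add]
    congr 1
    lia
  obtain ⟨N, hN⟩ := key
  obtain ⟨i, -, hi⟩ := (dvd_prime_pow Polynomial.prime_X N).mp hN
  obtain ⟨u, hu⟩ := hi.symm
  obtain ⟨r, hr, hru⟩ := Polynomial.isUnit_iff.mp u.isUnit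
  refine ⟨r, i - a, hr, ?_⟩
  rw [← hru] at hu
  have : p * T (a : ℤ) = C r * T (i : ℤ) := by
    rw [← hp', ← hu, map_mul, Polynomial.toLaurent_X_pow, Polynomial.toLaurent_C, mul_comm]
  calc p = p * T (a : ℤ) * T (-(a : ℤ)) := by rw [mul_assoc, ← T_add]; simp
    _ = _ := by rw [this, mul_assoc, ← T_add, sub_eq_add_neg]

end LaurentPolynomial

open LaurentPolynomial (T coeff_C_mul_T)

/-- A presentation of the polynomial ring in three variables as the algebra generated by `x`, `y`,
`z`, `t` subject to the relation `x y = f(z, t)`, together with the embedding into the Laurent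
polynomials in `x` over `k[z, t]`. -/
structure HypersurfaceData {k : Type*} [Field k] (f : MvPolynomial (Fin 2) k) where
  x : MvPolynomial (Fin 3) k
  y : MvPolynomial (Fin 3) k
  z : MvPolynomial (Fin 3) k
  t : MvPolynomial (Fin 3) k
  ne_zero : f ≠ 0
  adjoin_eq_top : Algebra.adjoin k {x, y, z, t} = ⊤
  mul_eq : x * y = aeval ![z, t] f
  ι : MvPolynomial (Fin 3) k →ₐ[k] LaurentPolynomial (MvPolynomial (Fin 2) k)
  ι_x : ι x = T 1
  ι_y : ι y = LaurentPolynomial.C f * T (-1)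
  ι_z : ι z = LaurentPolynomial.C (X 0)
  ι_t : ι t = LaurentPolynomial.C (X 1)

namespace HypersurfaceData

variable {k : Type*} [Field k] {f : MvPolynomial (Fin 2) k} (D : HypersurfaceData f)

/-- The inclusion of `k[z, t]`. -/
noncomputable def ev : MvPolynomial (Fin 2) k →ₐ[k] MvPolynomial (Fin 3) k := aeval ![D.z, D.t]

theorem mul_eq' : D.x * D.y = D.ev f := D.mul_eq

theorem ι_ev (p : MvPolynomial (Fin 2) k) : D.ι (D.ev p) = LaurentPolynomial.C p := by
  have : D.ι.comp D.ev = (Algebra.ofId (MvPolynomial (Fin 2) k)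
      (LaurentPolynomial (MvPolynomial (Fin 2) k))).restrictScalars k := by
    ext i : 1
    fin_cases i <;> simp [ev, D.ι_z, D.ι_t, Algebra.ofId_apply]
  exact congrArg (fun φ => φ p) this

theorem ι_ev_mul_x_pow (p : MvPolynomial (Fin 2) k) (i : ℕ) :
    D.ι (D.ev p * D.x ^ i) = LaurentPolynomial.C p * T (i : ℤ) := by
  rw [map_mul, map_pow, ι_ev, ι_x, LaurentPolynomial.T_pow, mul_one]

theorem ι_ev_mul_y_pow (p : MvPolynomial (Fin 2) k) (i : ℕ) :
    D.ι (D.ev p * D.y ^ i) = LaurentPolynomial.C (p * f ^ i) * T (-(i : ℤ)) := by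
  rw [map_mul, map_pow, ι_ev, ι_y, mul_pow, LaurentPolynomial.T_pow, map_mul, map_pow,
    mul_neg_one, mul_assoc]

theorem aeval_surjective : Function.Surjective (aeval ![D.x, D.y, D.z, D.t] :
    MvPolynomial (Fin 4) k →ₐ[k] MvPolynomial (Fin 3) k) := by
  intro b
  have hb : b ∈ Algebra.adjoin k (Set.range ![D.x, D.y, D.z, D.t]) := by
    have : Set.range ![D.x, D.y, D.z, D.t] = {D.x, D.y, D.z, D.t} := by
      ext u; simp; tauto
    rw [this, D.adjoin_eq_top]; trivial
  rw [Algebra.adjoin_range_eq_range_aeval] at hb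
  exact hb

@[elab_as_elim]
theorem generator_induction {M : MvPolynomial (Fin 3) k → Prop} (b : MvPolynomial (Fin 3) k)
    (C : ∀ c, M (C c)) (add : ∀ b c, M b → M c → M (b + c)) (mul : ∀ b c, M b → M c → M (b * c))
    (x : M D.x) (y : M D.y) (z : M D.z) (t : M D.t) : M b := by
  obtain ⟨q, rfl⟩ := D.aeval_surjective b
  induction q using MvPolynomial.induction_on with
  | C a => rw [algHom_C]; exact C a
  | add p q hp hq => rw [map_add]; exact add _ _ hp hq
  | mul_X p i hp =>
    rw [map_mul, aeval_X]
    refine mul _ _ hp ?_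
    fin_cases i <;> assumption

@[elab_as_elim]
theorem induction_on {M : MvPolynomial (Fin 3) k → Prop} (b : MvPolynomial (Fin 3) k)
    (add : ∀ b c, M b → M c → M (b + c)) (x_pow : ∀ p i, M (D.ev p * D.x ^ i))
    (y_pow : ∀ p i, M (D.ev p * D.y ^ i)) : M b := by
  obtain ⟨q, rfl⟩ := D.aeval_surjective b
  induction q using MvPolynomial.induction_on' with
  | add p q hp hq => rw [map_add]; exact add _ _ hp hq
  | monomial s a =>
    have h1 : aeval ![D.x, D.y, D.z, D.t] (monomial s a) =
        D.ev (C a * X 0 ^ s 2 * X 1 ^ s 3) * D.x ^ s 0 * D.y ^ s 1 := by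
      rw [aeval_monomial, Finsupp.prod_fintype _ _ (by simp), Fin.prod_univ_four]
      simp only [ev, map_mul, map_pow, aeval_X, algHom_C]
      simp
      ring
    change M (aeval ![D.x, D.y, D.z, D.t] (monomial s a))
    rw [h1]
    rcases le_total (s 0) (s 1) with h | h
    · obtain ⟨m, hm⟩ := Nat.exists_eq_add_of_le h
      rw [hm, pow_add, show ∀ P : MvPolynomial (Fin 3) k, P * D.x ^ s 0 * (D.y ^ s 0 * D.y ^ m)
        = P * (D.x * D.y) ^ s 0 * D.y ^ m from fun P => by ring, D.mul_eq', ← map_pow, ← map_mul]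
      exact y_pow _ _
    · obtain ⟨m, hm⟩ := Nat.exists_eq_add_of_le h
      rw [hm, pow_add, show ∀ P : MvPolynomial (Fin 3) k, P * (D.x ^ s 1 * D.x ^ m) * D.y ^ s 1
        = P * (D.x * D.y) ^ s 1 * D.x ^ m from fun P => by ring, D.mul_eq', ← map_pow, ← map_mul]
      exact x_pow _ _

/-- The coefficient of `x ^ j` in the Laurent expansion. -/
noncomputable def π (j : ℤ) : MvPolynomial (Fin 3) k →+ MvPolynomial (Fin 2) k where
  toFun b := (D.ι b).coeff j
  map_zero' := by simp
  map_add' b c := by simp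

theorem π_apply (j : ℤ) (b : MvPolynomial (Fin 3) k) : D.π j b = (D.ι b).coeff j := rfl

theorem π_ev_mul_x_pow (p : MvPolynomial (Fin 2) k) (i : ℕ) (j : ℤ) :
    D.π j (D.ev p * D.x ^ i) = if (i : ℤ) = j then p else 0 := by
  rw [π_apply, ι_ev_mul_x_pow, coeff_C_mul_T]

theorem π_ev_mul_y_pow (p : MvPolynomial (Fin 2) k) (i : ℕ) (j : ℤ) :
    D.π j (D.ev p * D.y ^ i) = if -(i : ℤ) = j then p * f ^ i else 0 := by
  rw [π_apply, ι_ev_mul_y_pow, coeff_C_mul_T]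

theorem π_ev (p : MvPolynomial (Fin 2) k) : D.π 0 (D.ev p) = p := by
  simpa using D.π_ev_mul_x_pow p 0 0

theorem π_ev_mul (p : MvPolynomial (Fin 2) k) (b : MvPolynomial (Fin 3) k) (j : ℤ) :
    D.π j (D.ev p * b) = p * D.π j b := by
  have := LaurentPolynomial.coeff_C_mul_T_mul p 0 j (D.ι b)
  rw [LaurentPolynomial.T_zero, mul_one, sub_zero] at this
  rw [π_apply, map_mul, ι_ev, this, π_apply]

theorem π_x_mul (b : MvPolynomial (Fin 3) k) (j : ℤ) : D.π j (D.x * b) = D.π (j - 1) b := by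
  have := LaurentPolynomial.coeff_C_mul_T_mul 1 1 j (D.ι b)
  rw [map_one, one_mul, one_mul] at this
  rw [π_apply, map_mul, ι_x, this, π_apply]

theorem π_y_mul (b : MvPolynomial (Fin 3) k) (j : ℤ) : D.π j (D.y * b) = f * D.π (j + 1) b := by
  have := LaurentPolynomial.coeff_C_mul_T_mul f (-1) j (D.ι b)
  rw [π_apply, map_mul, ι_y, this, π_apply, sub_neg_eq_add]

theorem pow_dvd_π (i : ℕ) (b : MvPolynomial (Fin 3) k) : f ^ i ∣ D.π (-(i : ℤ)) b := by
  induction b using D.induction_on with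
  | add b c hb hc => rw [map_add]; exact dvd_add hb hc
  | x_pow p j =>
    rw [π_ev_mul_x_pow]
    split_ifs with h
    · obtain rfl : i = 0 := by lia
      simp
    · exact dvd_zero _
  | y_pow p j =>
    rw [π_ev_mul_y_pow]
    split_ifs with h
    · obtain rfl : j = i := by lia
      exact dvd_mul_left _ _
    · exact dvd_zero _

theorem x_ne_zero : D.x ≠ 0 := by
  intro h
  have := D.ι_x
  rw [h, map_zero] at this
  have h2 := LaurentPolynomial.T_apply (R := MvPolynomial (Fin 2) k) 1 1
  rw [← this] at h2
  simp at h2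

/-- The coefficients detect zero. -/
theorem eq_zero_of_ι {b : MvPolynomial (Fin 3) k} (h : D.ι b = 0) : b = 0 := by
  have key : ∀ b : MvPolynomial (Fin 3) k, ∃ (n : ℕ) (p : Polynomial (MvPolynomial (Fin 2) k)),
      D.x ^ n * b = Polynomial.eval₂ D.ev.toRingHom D.x p ∧
      D.ι (D.x ^ n * b) = Polynomial.toLaurent p := by
    intro b
    have aux : ∀ p : Polynomial (MvPolynomial (Fin 2) k),
        D.ι (Polynomial.eval₂ D.ev.toRingHom D.x p) = Polynomial.toLaurent p := by
      intro p
      induction p using Polynomial.induction_on' with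
      | add p q hp hq => rw [Polynomial.eval₂_add, map_add, map_add, hp, hq]
      | monomial n a =>
        rw [Polynomial.eval₂_monomial, ← Polynomial.C_mul_X_pow_eq_monomial,
          Polynomial.toLaurent_C_mul_X_pow]
        exact D.ι_ev_mul_x_pow a n
    suffices ∃ (n : ℕ) (p : Polynomial (MvPolynomial (Fin 2) k)),
        D.x ^ n * b = Polynomial.eval₂ D.ev.toRingHom D.x p by
      obtain ⟨n, p, hp⟩ := this
      exact ⟨n, p, hp, by rw [hp, aux]⟩
    induction b using D.induction_on with
    | add b c hb hc =>
      obtain ⟨n, p, hp⟩ := hb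
      obtain ⟨m, q, hq⟩ := hc
      refine ⟨n + m, Polynomial.X ^ m * p + Polynomial.X ^ n * q, ?_⟩
      rw [Polynomial.eval₂_add, Polynomial.eval₂_mul, Polynomial.eval₂_mul, ← hp, ← hq,
        Polynomial.eval₂_pow, Polynomial.eval₂_pow, Polynomial.eval₂_X]
      ring
    | x_pow p i => exact ⟨0, Polynomial.C p * Polynomial.X ^ i, by simp⟩
    | y_pow p i =>
      refine ⟨i, Polynomial.C (p * f ^ i), ?_⟩
      rw [Polynomial.eval₂_C, show D.x ^ i * (D.ev p * D.y ^ i) = D.ev p * (D.x * D.y) ^ i by ring,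
        D.mul_eq', ← map_pow, ← map_mul]
      rfl
  obtain ⟨n, p, h1, h2⟩ := key b
  rw [map_mul, h, mul_zero, eq_comm, Polynomial.toLaurent_eq_zero] at h2
  rw [h2, Polynomial.eval₂_zero] at h1
  exact (mul_eq_zero.mp h1).resolve_left (pow_ne_zero _ D.x_ne_zero)

theorem eq_of_ι {b c : MvPolynomial (Fin 3) k} (h : D.ι b = D.ι c) : b = c :=
  sub_eq_zero.mp (D.eq_zero_of_ι (by rw [map_sub, h, sub_self]))

theorem not_isUnit_x : ¬IsUnit D.x := by
  intro h
  obtain ⟨r, hr, h⟩ := MvPolynomial.isUnit_iff_eq_C_of_isReduced.mp h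
  have h1 := D.ι_x
  rw [h, show (C r : MvPolynomial (Fin 3) k) = algebraMap k _ r from rfl, AlgHom.commutes] at h1
  have h2 := LaurentPolynomial.T_apply (R := MvPolynomial (Fin 2) k) 1 1
  rw [← h1, IsScalarTower.algebraMap_apply k (MvPolynomial (Fin 2) k),
    ← LaurentPolynomial.C_eq_algebraMap, LaurentPolynomial.C_apply] at h2
  simp at h2

theorem not_isUnit {f : MvPolynomial (Fin 2) k} (D : HypersurfaceData f) : ¬IsUnit f := by
  intro h
  apply D.not_isUnit_x
  have := h.map D.ev
  rw [← D.mul_eq'] at this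
  exact isUnit_of_mul_isUnit_left this

theorem ι_C (c : k) : D.ι (C c) = LaurentPolynomial.C (C c) := by
  have := D.ι_ev (C c)
  rwa [algHom_C] at this

theorem irreducible_x : Irreducible D.x := by
  refine ⟨D.not_isUnit_x, fun q q' h => ?_⟩
  have hι : D.ι q * D.ι q' = T 1 := by rw [← map_mul, ← h, D.ι_x]
  obtain ⟨r, m, hr, h1⟩ := LaurentPolynomial.exists_eq_C_mul_T_of_mul_eq_T hι
  obtain ⟨r', m', hr', h1'⟩ := LaurentPolynomial.exists_eq_C_mul_T_of_mul_eq_T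
    ((mul_comm _ _).trans hι)
  have hm : m + m' = 1 := by
    rw [h1, h1', show LaurentPolynomial.C r * T m * (LaurentPolynomial.C r' * T m') =
      LaurentPolynomial.C (r * r') * T (m + m') by
        rw [map_mul, LaurentPolynomial.T_add]; ring] at hι
    have := congrArg (fun g => g.coeff (m + m')) hι
    simp only [coeff_C_mul_T, if_true, LaurentPolynomial.T_apply] at this
    by_contra hne
    rw [if_neg (Ne.symm hne)] at this
    exact (hr.mul hr').ne_zero this
  have key : ∀ (a : MvPolynomial (Fin 3) k) (r : MvPolynomial (Fin 2) k) (m : ℤ), IsUnit r →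
      D.ι a = LaurentPolynomial.C r * T m → m ≤ 0 → IsUnit a := by
    intro a r m hr ha hm
    obtain ⟨i, rfl⟩ : ∃ i : ℕ, m = -(i : ℤ) := ⟨(-m).toNat, by lia⟩
    have h2 := D.pow_dvd_π i a
    rw [π_apply, ha, coeff_C_mul_T, if_pos rfl] at h2
    have h3 := isUnit_of_dvd_unit h2 hr
    have hi : i = 0 := by
      by_contra hi
      exact D.not_isUnit ((isUnit_pow_iff hi).mp h3)
    subst hi
    obtain ⟨c, hc, rfl⟩ := MvPolynomial.isUnit_iff_eq_C_of_isReduced.mp hr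
    have : a = C c := D.eq_of_ι (by rw [ha, D.ι_C]; simp)
    rw [this]
    exact hc.map _
  rcases le_or_gt m 0 with h0 | h0
  · exact Or.inl (key q r m hr h1 h0)
  · exact Or.inr (key q' r' m' hr' h1' (by lia))

theorem prime_x : Prime D.x := D.irreducible_x.prime

theorem x_dvd_ev_iff {p : MvPolynomial (Fin 2) k} : D.x ∣ D.ev p ↔ f ∣ p := by
  constructor
  · rintro ⟨b, hb⟩
    have h1 := D.π_ev p
    rw [hb, π_x_mul] at h1
    have := D.pow_dvd_π 1 b
    simp only [Nat.cast_one, pow_one] at this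
    rw [zero_sub] at h1
    rwa [h1] at this
  · rintro ⟨q, rfl⟩
    rw [map_mul, ← D.mul_eq', mul_assoc]
    exact dvd_mul_right _ _

theorem prime {f : MvPolynomial (Fin 2) k} (D : HypersurfaceData f) : Prime f := by
  refine ⟨D.ne_zero, D.not_isUnit, fun g h hgh => ?_⟩
  rw [← D.x_dvd_ev_iff, map_mul] at hgh
  rw [← D.x_dvd_ev_iff, ← D.x_dvd_ev_iff]
  exact D.prime_x.dvd_or_dvd hgh

end HypersurfaceData

end

section

open MvPolynomial

open LaurentPolynomial (T coeff_C_mul_T)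

namespace MvPolynomial

/-- Divisibility by a polynomial with coefficients in a subfield can be tested over the subfield,
after changing a constant. -/
theorem exists_dvd_sub_C_of_map_dvd {σ k k' : Type*} [Field k] [Field k'] [Algebra k k']
    {f a : MvPolynomial σ k} {θ : k'}
    (h : map (algebraMap k k') f ∣ map (algebraMap k k') a - C θ) : ∃ c : k, f ∣ a - C c := by
  classical
  obtain ⟨g, hg⟩ := h
  obtain ⟨ρ, hρ⟩ := LinearMap.exists_leftInverse_of_injective (Algebra.linearMap k k')
    (LinearMap.ker_eq_bot.mpr (algebraMap k k').injective)
  have hρ' : ∀ (c : k) (d : k'), ρ (algebraMap k k' c * d) = c * ρ d := fun c d => by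
    rw [← Algebra.smul_def, map_smul, smul_eq_mul]
  have hρ1 : ∀ c : k, ρ (algebraMap k k' c) = c := fun c => LinearMap.congr_fun hρ c
  let g' : MvPolynomial σ k := ∑ m ∈ g.support, monomial m (ρ (coeff m g))
  have hg' : ∀ m, coeff m g' = ρ (coeff m g) := by
    intro m
    simp only [g', coeff_sum, coeff_monomial]
    rw [Finset.sum_ite_eq' g.support m]
    split_ifs with h
    · rfl
    · rw [notMem_support_iff.mp h, map_zero]
  refine ⟨ρ θ, g', ?_⟩
  ext m
  have := congrArg (fun p => ρ (coeff m p)) hg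
  simp only [coeff_sub, coeff_map, coeff_mul, map_sub, map_sum, hρ', hρ1, coeff_C] at this
  rw [coeff_sub, coeff_mul, coeff_C, Finset.sum_congr rfl fun x _ => by rw [hg'], ← this]
  split_ifs <;> simp

end MvPolynomial

namespace HypersurfaceData

variable {k : Type*} [Field k] {f : MvPolynomial (Fin 2) k}

theorem map_ev (D : HypersurfaceData f) {k' : Type*} [Field k'] [Algebra k k']
    (p : MvPolynomial (Fin 2) k) : map (algebraMap k k') (D.ev p) =
      aeval ![map (algebraMap k k') D.z, map (algebraMap k k') D.t] (map (algebraMap k k') p) := by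
  induction p using MvPolynomial.induction_on with
  | C a => rw [algHom_C, algebraMap_eq, map_C, map_C, algHom_C]; rfl
  | add p q hp hq => simp only [map_add, hp, hq]
  | mul_X p i hp =>
    simp only [map_mul, hp, map_X, aeval_X]
    congr 1
    fin_cases i <;> simp [ev]

/-- Extension of the base field. -/
noncomputable def baseChange (D : HypersurfaceData f) (k' : Type*) [Field k'] [Algebra k k'] :
    HypersurfaceData (map (algebraMap k k') f) where
  x := map (algebraMap k k') D.x
  y := map (algebraMap k k') D.y
  z := map (algebraMap k k') D.z
  t := map (algebraMap k k') D.t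
  ne_zero := by
    rw [← map_zero (map (algebraMap k k'))]
    exact fun h => D.ne_zero (map_injective _ (algebraMap k k').injective h)
  adjoin_eq_top := by
    set S := Algebra.adjoin k' {map (algebraMap k k') D.x, map (algebraMap k k') D.y,
      map (algebraMap k k') D.z, map (algebraMap k k') D.t} with hS
    have hx : map (algebraMap k k') D.x ∈ S := Algebra.subset_adjoin (by simp)
    have hy : map (algebraMap k k') D.y ∈ S := Algebra.subset_adjoin (by simp)
    have hz : map (algebraMap k k') D.z ∈ S := Algebra.subset_adjoin (by simp)
    have ht : map (algebraMap k k') D.t ∈ S := Algebra.subset_adjoin (by simp)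
    have hev : ∀ p, map (algebraMap k k') (D.ev p) ∈ S := by
      intro p
      rw [map_ev]
      generalize map (algebraMap k k') p = q
      induction q using MvPolynomial.induction_on with
      | C a => rw [algHom_C]; exact S.algebraMap_mem a
      | add p q hp hq => rw [map_add]; exact S.add_mem hp hq
      | mul_X p i hp =>
        rw [map_mul, aeval_X]
        refine S.mul_mem hp ?_
        fin_cases i
        · exact hz
        · exact ht
    have key : ∀ b, map (algebraMap k k') b ∈ S := by
      intro b
      induction b using D.induction_on with
      | add b c hb hc => rw [map_add]; exact S.add_mem hb hc
      | x_pow p i => rw [map_mul, map_pow]; exact S.mul_mem (hev p) (S.pow_mem hx i)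
      | y_pow p i => rw [map_mul, map_pow]; exact S.mul_mem (hev p) (S.pow_mem hy i)
    rw [eq_top_iff, ← MvPolynomial.adjoin_range_X, Algebra.adjoin_le_iff]
    rintro _ ⟨i, rfl⟩
    have := key (X i)
    rwa [map_X] at this
  mul_eq := by rw [← map_mul, D.mul_eq', map_ev]
  ι := aeval fun i => AddMonoidAlgebra.mapRingHom ℤ (map (algebraMap k k')) (D.ι (X i))
  ι_x := by
    rw [← baseChange_aux D k', ι_x]
    exact (AddMonoidAlgebra.mapRingHom_single _ _ _).trans (by rw [map_one]; rfl)
  ι_y := by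
    rw [← baseChange_aux D k', ι_y, ← LaurentPolynomial.single_eq_C_mul_T,
      ← LaurentPolynomial.single_eq_C_mul_T]
    exact AddMonoidAlgebra.mapRingHom_single _ _ _
  ι_z := by
    rw [← baseChange_aux D k', ι_z]
    exact (AddMonoidAlgebra.mapRingHom_single _ _ _).trans (by rw [map_X]; rfl)
  ι_t := by
    rw [← baseChange_aux D k', ι_t]
    exact (AddMonoidAlgebra.mapRingHom_single _ _ _).trans (by rw [map_X]; rfl)
where
  baseChange_aux (D : HypersurfaceData f) (k' : Type _) [Field k'] [Algebra k k']
      (b : MvPolynomial (Fin 3) k) :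
      AddMonoidAlgebra.mapRingHom ℤ (map (algebraMap k k')) (D.ι b) =
        aeval (fun i => AddMonoidAlgebra.mapRingHom ℤ (map (algebraMap k k')) (D.ι (X i)))
          (map (algebraMap k k') b) := by
    induction b using MvPolynomial.induction_on with
    | C a =>
      rw [D.ι_C, map_C, algHom_C]
      exact (AddMonoidAlgebra.mapRingHom_single _ _ _).trans (by rw [map_C]; rfl)
    | add p q hp hq => simp only [map_add, hp, hq]
    | mul_X p i hp => simp only [map_mul, hp, map_X, aeval_X]

/-- The constants are algebraically closed in `k[z, t] / (f)`. -/
theorem exists_dvd_sub_C (D : HypersurfaceData f) {a : MvPolynomial (Fin 2) k}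
    {μ : Polynomial k} (hμ : μ ≠ 0) (h : f ∣ Polynomial.aeval a μ) : ∃ c : k, f ∣ a - C c := by
  have hp := (D.baseChange (AlgebraicClosure k)).prime
  set φ := algebraMap k (AlgebraicClosure k) with hφ
  suffices ∃ θ, map φ f ∣ map φ a - C θ by
    obtain ⟨θ, hθ⟩ := this
    exact exists_dvd_sub_C_of_map_dvd hθ
  have h1 : map φ f ∣ Polynomial.aeval (map φ a) (μ.map φ) := by
    obtain ⟨g, hg⟩ := h
    refine ⟨map φ g, ?_⟩
    rw [← map_mul, ← hg, Polynomial.aeval_def, Polynomial.aeval_def, Polynomial.eval₂_map,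
      Polynomial.hom_eval₂]
    congr 1
    ext c
    simp [algebraMap_eq]
  have hs : (μ.map φ).Splits := IsAlgClosed.splits _
  rw [hs.eq_prod_roots, map_mul, Polynomial.aeval_C, map_multiset_prod, Multiset.map_map] at h1
  rcases hp.dvd_or_dvd h1 with h2 | h2
  · refine absurd (isUnit_of_dvd_unit h2 (IsUnit.map _ (Ne.isUnit ?_))) hp.not_isUnit
    rw [Polynomial.leadingCoeff_map]
    simpa using hμ
  · replace h2 := hp.exists_mem_multiset_dvd h2
    obtain ⟨q, hq, hq2⟩ := h2
    obtain ⟨θ, -, rfl⟩ := Multiset.mem_map.mp hq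
    exact ⟨θ, by simpa [algebraMap_eq] using hq2⟩

end HypersurfaceData

end

section

open MvPolynomial

namespace MvPolynomial

theorem pderiv_comm {σ R : Type*} [CommRing R] (i j : σ) (p : MvPolynomial σ R) :
    pderiv i (pderiv j p) = pderiv j (pderiv i p) := by
  ext m
  classical
  by_cases h : i = j
  · subst h; rfl
  · simp only [coeff_pderiv, Finsupp.add_apply, Finsupp.single_apply, if_neg h,
      if_neg (Ne.symm h), add_right_comm m (Finsupp.single i 1)]
    ring_nf

variable {σ k : Type*} [Field k] [CharZero k]

/-- An antiderivative with respect to one of the variables. -/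
theorem exists_pderiv_eq (i : σ) (p : MvPolynomial σ k) :
    ∃ q, pderiv i q = p ∧ ∀ j, j ≠ i → pderiv j p = 0 → pderiv j q = 0 := by
  classical
  refine ⟨∑ s ∈ p.support, monomial (s + Finsupp.single i 1) (coeff s p / (s i + 1)), ?_, ?_⟩
  · rw [map_sum]
    conv_rhs => rw [← p.support_sum_monomial_coeff]
    refine Finset.sum_congr rfl fun s _ => ?_
    rw [pderiv_monomial, add_tsub_cancel_right]
    congr 1
    have : ((s i : k) + 1) ≠ 0 := by exact_mod_cast Nat.succ_ne_zero (s i)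
    simp
    field_simp
  · intro j hj hp
    rw [map_sum]
    refine Finset.sum_eq_zero fun s hs => ?_
    have hsj : s j = 0 := by
      by_contra h
      have h1 := congrArg (coeff (s - Finsupp.single j 1)) hp
      rw [coeff_pderiv, coeff_zero, tsub_add_cancel_of_le
        (by rw [Finsupp.single_le_iff]; lia)] at h1
      rcases mul_eq_zero.mp h1 with h2 | h2
      · exact mem_support_iff.mp hs h2
      · exact absurd h2 (Nat.cast_add_one_ne_zero _)
    rw [pderiv_monomial]
    simp [hsj, Ne.symm hj]

/-- The Poincaré lemma in two variables. -/
theorem exists_pderiv_eq_of_closed {a b : MvPolynomial (Fin 2) k}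
    (h : pderiv 0 a + pderiv 1 b = 0) : ∃ g, a = -pderiv 1 g ∧ b = pderiv 0 g := by
  obtain ⟨g1, hg1, -⟩ := exists_pderiv_eq 0 b
  obtain ⟨g2, hg2, h0⟩ := exists_pderiv_eq 1 (a + pderiv 1 g1)
  have := h0 0 (by decide) (by rw [map_add, pderiv_comm, hg1, h])
  refine ⟨g1 - g2, ?_, ?_⟩
  · rw [map_sub, hg2]; ring
  · rw [map_sub, hg1, this, sub_zero]

theorem pderiv_eq_zero_of_dvd {σ k : Type*} [Field k] {i : σ} {f : MvPolynomial σ k}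
    (h : f ∣ pderiv i f) :
    pderiv i f = 0 := by
  by_contra h0
  obtain ⟨g, hg⟩ := h
  have hf : f ≠ 0 := by rintro rfl; simp at h0
  have hg0 : g ≠ 0 := by rintro rfl; simp at hg; exact h0 hg
  have h1 := congrArg totalDegree hg
  rw [totalDegree_mul_of_isDomain hf hg0] at h1
  have hlt : (pderiv i f).totalDegree < f.totalDegree := by
    obtain ⟨m, hm, hm'⟩ := Finset.exists_mem_eq_sup (pderiv i f).support
      (support_nonempty.mpr h0) fun s => s.sum fun _ e => e
    have h2 : m + Finsupp.single i 1 ∈ f.support := by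
      rw [mem_support_iff] at hm ⊢
      rw [coeff_pderiv] at hm
      exact left_ne_zero_of_mul hm
    have h3 := le_totalDegree h2
    rw [Finsupp.sum_add_index' (fun _ => rfl) (fun _ _ _ => rfl),
      Finsupp.sum_single_index rfl] at h3
    rw [totalDegree, hm']
    exact h3
  lia

theorem exists_eq_C_of_pderiv_eq_zero {f : MvPolynomial σ k} (h : ∀ i, pderiv i f = 0) :
    ∃ c, f = C c := by
  classical
  refine ⟨coeff 0 f, ?_⟩
  ext m
  rw [coeff_C]
  split_ifs with hm
  · rw [hm]
  · obtain ⟨j, hj⟩ := Finsupp.ne_iff.mp (Ne.symm hm)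
    have h1 := congrArg (coeff (m - Finsupp.single j 1)) (h j)
    rw [coeff_pderiv, coeff_zero, tsub_add_cancel_of_le
      (by rw [Finsupp.single_le_iff]; simp at hj; lia)] at h1
    exact (mul_eq_zero.mp h1).resolve_right (Nat.cast_add_one_ne_zero _)

/-- The derivation `a ↦ {a, b, c}` given by the Jacobian determinant in three variables. -/
noncomputable def jac {R : Type*} [CommRing R] (b c : MvPolynomial (Fin 3) R) :
    Derivation R (MvPolynomial (Fin 3) R) (MvPolynomial (Fin 3) R) :=
  (pderiv 1 b * pderiv 2 c - pderiv 2 b * pderiv 1 c) • pderiv 0 +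
  (pderiv 2 b * pderiv 0 c - pderiv 0 b * pderiv 2 c) • pderiv 1 +
  (pderiv 0 b * pderiv 1 c - pderiv 1 b * pderiv 0 c) • pderiv 2

section

variable {R : Type*} [CommRing R]

theorem jac_apply (a b c : MvPolynomial (Fin 3) R) : jac b c a =
    (pderiv 1 b * pderiv 2 c - pderiv 2 b * pderiv 1 c) * pderiv 0 a +
    (pderiv 2 b * pderiv 0 c - pderiv 0 b * pderiv 2 c) * pderiv 1 a +
    (pderiv 0 b * pderiv 1 c - pderiv 1 b * pderiv 0 c) * pderiv 2 a := by
  simp [jac]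

theorem jac_rotate (a b c : MvPolynomial (Fin 3) R) : jac b c a = jac c a b := by
  simp only [jac_apply]; ring

theorem jac_swap (a b c : MvPolynomial (Fin 3) R) : jac b c a = -jac c b a := by
  simp only [jac_apply]; ring

@[simp]
theorem jac_left (b c : MvPolynomial (Fin 3) R) : jac b c b = 0 := by
  simp only [jac_apply]; ring

@[simp]
theorem jac_right (b c : MvPolynomial (Fin 3) R) : jac b c c = 0 := by
  simp only [jac_apply]; ring

theorem jac_X : jac (X 1) (X 2) (X 0 : MvPolynomial (Fin 3) R) = 1 := by
  simp [jac_apply, pderiv_X]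

/-- The Lie derivative of the Jacobian bracket along a vector field. -/
theorem smul_pderiv_jac (h a b c : MvPolynomial (Fin 3) R) :
    h * pderiv 0 (jac b c a) = jac b c (h * pderiv 0 a) + jac c a (h * pderiv 0 b) +
      jac a b (h * pderiv 0 c) - pderiv 0 h * jac b c a := by
  simp only [jac_apply, map_add, map_sub, Derivation.leibniz, smul_eq_mul]
  rw [pderiv_comm 0 1 a, pderiv_comm 0 2 a, pderiv_comm 0 1 b, pderiv_comm 0 2 b,
    pderiv_comm 0 1 c, pderiv_comm 0 2 c]
  ring

theorem derivation_aeval {S : Type*} [CommRing S] [Algebra R S] (d : Derivation R S S)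
    (u v : S) (p : MvPolynomial (Fin 2) R) : d (aeval ![u, v] p) =
      aeval ![u, v] (pderiv 0 p) * d u + aeval ![u, v] (pderiv 1 p) * d v := by
  induction p using MvPolynomial.induction_on with
  | C a => simp
  | add p q hp hq => simp only [map_add, hp, hq]; ring
  | mul_X p i hp =>
    simp only [map_mul, Derivation.leibniz, hp, smul_eq_mul, map_add, aeval_X, pderiv_X]
    fin_cases i
    · simp
      ring
    · simp
      ring

end

end MvPolynomial

end

section

open MvPolynomial

namespace HypersurfaceData

variable {k : Type*} [Field k] {f : MvPolynomial (Fin 2) k}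

theorem derivation_ev (D : HypersurfaceData f)
    (d : Derivation k (MvPolynomial (Fin 3) k) (MvPolynomial (Fin 3) k))
    (p : MvPolynomial (Fin 2) k) :
    d (D.ev p) = D.ev (pderiv 0 p) * d D.z + D.ev (pderiv 1 p) * d D.t :=
  derivation_aeval d D.z D.t p

theorem derivation_mul_eq (D : HypersurfaceData f)
    (d : Derivation k (MvPolynomial (Fin 3) k) (MvPolynomial (Fin 3) k)) :
    D.x * d D.y + D.y * d D.x = D.ev (pderiv 0 f) * d D.z + D.ev (pderiv 1 f) * d D.t := by
  rw [← derivation_ev, ← D.mul_eq', Derivation.leibniz, smul_eq_mul, smul_eq_mul]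

/-- An alternating relation in three variables that extends from four generators holds
universally if it holds on the generators. -/
theorem _root_.forall_of_alternating {β : Type*} {M : β → β → β → Prop}
    (swap : ∀ a b d, M a b d → M a d b) (rot : ∀ a b d, M a b d → M b d a)
    (refl : ∀ a b, M a b b) {x y z t : β}
    (lift : ∀ b d, M x b d → M y b d → M z b d → M t b d → ∀ a, M a b d)
    (h1 : M x z t) (h2 : M y z t) (h3 : M y x z) (h4 : M y t x) (a b d : β) : M a b d := by
  have refl₁ : ∀ a b, M a a b := fun a b => rot _ _ _ (refl b a)
  have refl₂ : ∀ a b, M b a b := fun a b => rot _ _ _ (refl₁ b a)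
  have zt := lift z t h1 h2 (refl₁ z t) (refl₂ z t)
  have xz := lift x z (refl₁ x z) h3 (refl₂ x z) (rot _ _ _ (rot _ _ _ h1))
  have tx := lift t x (refl₂ t x) h4 (rot _ _ _ h1) (refl₁ t x)
  have xy := lift x y (refl₁ x y) (refl₂ x y) (swap _ _ _ (rot _ _ _ (rot _ _ _ h3)))
    (rot _ _ _ h4)
  have yz := lift y z (swap _ _ _ (rot _ _ _ h3)) (refl₁ y z) (refl₂ y z)
    (rot _ _ _ (rot _ _ _ h2))
  have yt := lift y t (rot _ _ _ (rot _ _ _ h4)) (refl₁ y t) (swap _ _ _ (rot _ _ _ h2))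
    (refl₂ y t)
  have hx : ∀ d a, M a x d := fun d => lift x d (refl₁ x d) (rot _ _ _ (swap _ _ _ (xy d)))
    (rot _ _ _ (swap _ _ _ (xz d))) (rot _ _ _ (tx d))
  have hy : ∀ d a, M a y d := fun d => lift y d (rot _ _ _ (xy d)) (refl₁ y d)
    (rot _ _ _ (swap _ _ _ (yz d))) (rot _ _ _ (swap _ _ _ (yt d)))
  have hz : ∀ d a, M a z d := fun d => lift z d (rot _ _ _ (xz d)) (rot _ _ _ (yz d))
    (refl₁ z d) (rot _ _ _ (swap _ _ _ (zt d)))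
  have ht : ∀ d a, M a t d := fun d => lift t d (rot _ _ _ (swap _ _ _ (tx d)))
    (rot _ _ _ (yt d)) (rot _ _ _ (zt d)) (refl₁ t d)
  exact lift b d (rot _ _ _ (hx b d)) (rot _ _ _ (hy b d)) (rot _ _ _ (hz b d))
    (rot _ _ _ (ht b d)) a

theorem one_mem_of_jac_mem (D : HypersurfaceData f) {J : Ideal (MvPolynomial (Fin 3) k)}
    (ztx : jac D.z D.t D.x ∈ J) (zty : jac D.z D.t D.y ∈ J) (xzy : jac D.x D.z D.y ∈ J)
    (txy : jac D.t D.x D.y ∈ J) : 1 ∈ J := by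
  have key := forall_of_alternating (M := fun a b d => jac b d a ∈ J)
    (fun a b d h => by rw [jac_swap]; exact J.neg_mem h)
    (fun a b d h => by rwa [jac_rotate] at h)
    (fun a b => by rw [jac_apply]; convert J.zero_mem; ring)
    (x := D.x) (y := D.y) (z := D.z) (t := D.t)
    ?_ ztx zty xzy txy (X 0) (X 1) (X 2)
  · rwa [jac_X] at key
  · intro b d gx gy gz gt a
    induction a using D.generator_induction with
    | C r =>
      rw [show (C r : MvPolynomial (Fin 3) k) = algebraMap k _ r from rfl,
        Derivation.map_algebraMap]
      exact J.zero_mem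
    | add u v hu hv => rw [map_add]; exact J.add_mem hu hv
    | mul u v hu hv =>
      rw [Derivation.leibniz]
      exact J.add_mem (J.mul_mem_left _ hv) (J.mul_mem_left _ hu)
    | x => exact gx
    | y => exact gy
    | z => exact gz
    | t => exact gt

variable [CharZero k]

theorem not_dvd_pderiv (D : HypersurfaceData f) : ¬(f ∣ pderiv 0 f ∧ f ∣ pderiv 1 f) := by
  rintro ⟨h0, h1⟩
  obtain ⟨c, hc⟩ := exists_eq_C_of_pderiv_eq_zero (f := f) fun i => by
    fin_cases i
    · exact pderiv_eq_zero_of_dvd h0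
    · exact pderiv_eq_zero_of_dvd h1
  refine D.not_isUnit ?_
  rw [hc]
  refine (Ne.isUnit ?_).map C
  rintro rfl
  exact D.ne_zero (by rw [hc, C_0])

/-- The Jacobian brackets of the generators. -/
theorem exists_jac (D : HypersurfaceData f) : ∃ c, jac D.z D.t D.x = D.x * c ∧
    jac D.z D.t D.y = -(D.y * c) ∧ jac D.x D.z D.y = D.ev (pderiv 1 f) * c ∧
    jac D.t D.x D.y = D.ev (pderiv 0 f) * c := by
  have h1 := D.derivation_mul_eq (jac D.z D.t)
  have h2 := D.derivation_mul_eq (jac D.x D.z)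
  have h3 := D.derivation_mul_eq (jac D.t D.x)
  rw [jac_left, jac_right, mul_zero, mul_zero, add_zero] at h1
  rw [jac_left, jac_right, mul_zero, mul_zero, add_zero, zero_add, jac_rotate D.t D.x D.z] at h2
  rw [jac_left, jac_right, mul_zero, mul_zero, add_zero, add_zero, jac_rotate D.z D.t D.x,
    jac_rotate D.t D.x D.z] at h3
  have hdvd : D.x ∣ jac D.z D.t D.x := by
    by_contra h
    refine D.not_dvd_pderiv ⟨?_, ?_⟩ <;> rw [← D.x_dvd_ev_iff]
    · exact (D.prime_x.dvd_or_dvd (Dvd.intro _ h3)).resolve_right h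
    · exact (D.prime_x.dvd_or_dvd (Dvd.intro _ h2)).resolve_right h
  obtain ⟨c, hc⟩ := hdvd
  rw [hc] at h1 h2 h3
  refine ⟨c, hc, ?_, ?_, ?_⟩ <;> apply mul_left_cancel₀ D.x_ne_zero
  · linear_combination h1
  · linear_combination h2
  · linear_combination h3

/-- The Jacobian brackets of the generators, up to a scalar. -/
theorem exists_jac_C (D : HypersurfaceData f) : ∃ c : k, c ≠ 0 ∧ jac D.z D.t D.x = C c * D.x ∧
    jac D.z D.t D.y = -(C c * D.y) ∧ jac D.x D.z D.y = C c * D.ev (pderiv 1 f) ∧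
    jac D.t D.x D.y = C c * D.ev (pderiv 0 f) ∧
    (1 : MvPolynomial (Fin 3) k) ∈ Ideal.span {D.x, D.y, D.ev (pderiv 0 f), D.ev (pderiv 1 f)} := by
  obtain ⟨c, h1, h2, h3, h4⟩ := D.exists_jac
  have hJ : ∀ J : Ideal (MvPolynomial (Fin 3) k), D.x * c ∈ J → D.y * c ∈ J →
      D.ev (pderiv 1 f) * c ∈ J → D.ev (pderiv 0 f) * c ∈ J → 1 ∈ J := by
    intro J m1 m2 m3 m4
    refine D.one_mem_of_jac_mem ?_ ?_ ?_ ?_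
    · rw [h1]; exact m1
    · rw [h2]; exact J.neg_mem m2
    · rw [h3]; exact m3
    · rw [h4]; exact m4
  have hc : IsUnit c := isUnit_iff_dvd_one.mpr (Ideal.mem_span_singleton.mp
    (hJ (Ideal.span {c}) (Ideal.mem_span_singleton.mpr (dvd_mul_left _ _))
      (Ideal.mem_span_singleton.mpr (dvd_mul_left _ _))
      (Ideal.mem_span_singleton.mpr (dvd_mul_left _ _))
      (Ideal.mem_span_singleton.mpr (dvd_mul_left _ _))))
  obtain ⟨r, hr, rfl⟩ := MvPolynomial.isUnit_iff_eq_C_of_isReduced.mp hc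
  exact ⟨r, hr.ne_zero, by rw [h1, mul_comm], by rw [h2, mul_comm], by rw [h3, mul_comm],
    by rw [h4, mul_comm], hJ _ (Ideal.mul_mem_right _ _ (Ideal.subset_span (by simp)))
    (Ideal.mul_mem_right _ _ (Ideal.subset_span (by simp)))
    (Ideal.mul_mem_right _ _ (Ideal.subset_span (by simp)))
    (Ideal.mul_mem_right _ _ (Ideal.subset_span (by simp)))⟩

end HypersurfaceData

end

section

open MvPolynomial

namespace HypersurfaceData

variable {k : Type*} [Field k] {f : MvPolynomial (Fin 2) k}

theorem ev_C (D : HypersurfaceData f) (a : k) : D.ev (C a) = C a := algHom_C _ a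

theorem π_C_mul (D : HypersurfaceData f) (a : k) (b : MvPolynomial (Fin 3) k) (j : ℤ) :
    D.π j (C a * b) = C a * D.π j b := by
  rw [← D.ev_C, D.π_ev_mul]

theorem jac_z_t_ev (D : HypersurfaceData f) (p : MvPolynomial (Fin 2) k) :
    jac D.z D.t (D.ev p) = 0 := by
  rw [derivation_ev, jac_left, jac_right, mul_zero, mul_zero, add_zero]

theorem jac_t_x_ev (D : HypersurfaceData f) {c : k} (h : jac D.z D.t D.x = C c * D.x)
    (p : MvPolynomial (Fin 2) k) :
    jac D.t D.x (D.ev p) = D.ev (C c * pderiv 0 p) * D.x := by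
  rw [derivation_ev, jac_left, mul_zero, add_zero, jac_rotate D.z D.t D.x,
    jac_rotate D.t D.x D.z, h, map_mul, D.ev_C]
  ring

theorem jac_x_z_ev (D : HypersurfaceData f) {c : k} (h : jac D.z D.t D.x = C c * D.x)
    (p : MvPolynomial (Fin 2) k) :
    jac D.x D.z (D.ev p) = D.ev (C c * pderiv 1 p) * D.x := by
  rw [derivation_ev, jac_right, mul_zero, zero_add, jac_rotate, h, map_mul, D.ev_C]
  ring

theorem π_jac_z_t (D : HypersurfaceData f) {c : k} (hx : jac D.z D.t D.x = C c * D.x)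
    (hy : jac D.z D.t D.y = -(C c * D.y)) (b : MvPolynomial (Fin 3) k) (j : ℤ) :
    D.π j (jac D.z D.t b) = C (c * (j : k)) * D.π j b := by
  induction b using D.induction_on with
  | add a b ha hb => rw [map_add, map_add, ha, hb, map_add, mul_add]
  | x_pow p i =>
    have : jac D.z D.t (D.ev p * D.x ^ i) = D.ev (C (c * (i : k)) * p) * D.x ^ i := by
      rw [Derivation.leibniz, jac_z_t_ev, Derivation.leibniz_pow, hx, map_mul, D.ev_C]
      rcases i with _ | i
      · simp
      · simp only [smul_eq_mul, nsmul_eq_mul, Nat.add_sub_cancel, map_mul, map_natCast]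
        ring
    rw [this, π_ev_mul_x_pow, π_ev_mul_x_pow]
    split_ifs with h
    · rw [← h, Int.cast_natCast]
    · rw [mul_zero]
  | y_pow p i =>
    have : jac D.z D.t (D.ev p * D.y ^ i) = D.ev (C (-(c * (i : k))) * p) * D.y ^ i := by
      rw [Derivation.leibniz, jac_z_t_ev, Derivation.leibniz_pow, hy, map_mul, D.ev_C]
      rcases i with _ | i
      · simp
      · simp only [smul_eq_mul, nsmul_eq_mul, Nat.add_sub_cancel, map_mul, map_neg, map_natCast]
        ring
    rw [this, π_ev_mul_y_pow, π_ev_mul_y_pow]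
    split_ifs with h
    · rw [← h, Int.cast_neg, Int.cast_natCast, mul_neg]
      ring
    · rw [mul_zero]

/-- A derivation that scales `x`-degrees by one acts on the degree zero part of the Laurent
expansion through its action on `k[z, t]`. -/
theorem π_derivation (D : HypersurfaceData f)
    (d : Derivation k (MvPolynomial (Fin 3) k) (MvPolynomial (Fin 3) k))
    (δ : MvPolynomial (Fin 2) k → MvPolynomial (Fin 2) k) (hδ : ∀ p q, δ (p + q) = δ p + δ q)
    (hev : ∀ p, d (D.ev p) = D.ev (δ p) * D.x) (hx : d D.x = 0) {r : MvPolynomial (Fin 2) k}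
    (hy : d D.y = D.ev r) (b : MvPolynomial (Fin 3) k) : D.π 1 (d b) = δ (D.π 0 b) := by
  have h0 : δ 0 = 0 := by simpa using hδ 0 0
  induction b using D.induction_on with
  | add a b ha hb => rw [map_add, map_add, ha, hb, map_add, hδ]
  | x_pow p i =>
    have : d (D.ev p * D.x ^ i) = D.ev (δ p) * D.x ^ (i + 1) := by
      rw [Derivation.leibniz, hev, Derivation.leibniz_pow, hx]
      rw [smul_zero, smul_zero, smul_zero, zero_add, smul_eq_mul]
      ring
    rw [this, π_ev_mul_x_pow, π_ev_mul_x_pow]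
    by_cases h : i = 0
    · rw [if_pos (by lia), if_pos (by lia)]
    · rw [if_neg (by lia), if_neg (by lia), h0]
  | y_pow p i =>
    rcases i with _ | i
    · have h1 := D.π_ev_mul_x_pow (δ p) 1 1
      rw [pow_zero, mul_one, hev, D.π_ev]
      simpa using h1
    · have : d (D.ev p * D.y ^ (i + 1)) =
          D.ev (p * ((i + 1 : ℕ) : MvPolynomial (Fin 2) k) * r + δ p * f) * D.y ^ i := by
        rw [Derivation.leibniz, hev, Derivation.leibniz_pow, hy]
        simp only [smul_eq_mul, nsmul_eq_mul, Nat.add_sub_cancel, map_mul, map_add, map_natCast]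
        rw [← D.mul_eq']
        ring
      rw [this, π_ev_mul_y_pow, π_ev_mul_y_pow, if_neg (by lia), if_neg (by lia), h0]

theorem exists_one_eq [CharZero k] (D : HypersurfaceData f) :
    ∃ g h u, 1 = f * u + pderiv 0 f * g + pderiv 1 f * h := by
  obtain ⟨c, -, -, -, -, -, h⟩ := D.exists_jac_C
  obtain ⟨α, b1, hb1, h⟩ := Ideal.mem_span_insert.mp h
  obtain ⟨β, b2, hb2, rfl⟩ := Ideal.mem_span_insert.mp hb1
  obtain ⟨γ, b3, hb3, rfl⟩ := Ideal.mem_span_insert.mp hb2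
  obtain ⟨δ, rfl⟩ := Ideal.mem_span_singleton.mp hb3
  have h1 := congrArg (D.π 0) h
  rw [map_add, map_add, map_add, mul_comm α, mul_comm β, mul_comm γ, D.π_x_mul, D.π_y_mul,
    D.π_ev_mul, D.π_ev_mul] at h1
  obtain ⟨v, hv⟩ := D.pow_dvd_π 1 α
  have h2 : D.π 0 1 = 1 := by
    have := D.π_ev 1
    rwa [map_one] at this
  rw [h2] at h1
  refine ⟨D.π 0 γ, D.π 0 δ, v + D.π 1 β, ?_⟩
  rw [h1, show (0 : ℤ) - 1 = -((1 : ℕ) : ℤ) by simp, hv, zero_add]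
  ring

theorem exists_divergence_eq [CharZero k] (D : HypersurfaceData f) (R : MvPolynomial (Fin 2) k) :
    ∃ a b, pderiv 0 a + pderiv 1 b = R ∧ f ∣ pderiv 0 f * a + pderiv 1 f * b := by
  obtain ⟨c, hc, hx, hy, hxz, htx, -⟩ := D.exists_jac_C
  obtain ⟨H, hH, -⟩ := exists_pderiv_eq 0 (D.ev R)
  refine ⟨D.π 0 (H * pderiv 0 D.z), D.π 0 (H * pderiv 0 D.t), ?_, ?_⟩
  · have key := smul_pderiv_jac H D.x D.z D.t
    rw [hx, hH, pderiv_C_mul] at key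
    have k1 := D.π_jac_z_t hx hy (H * pderiv 0 D.x) 1
    have k2 := D.π_derivation (jac D.t D.x) (fun p => C c * pderiv 0 p)
      (fun p q => by rw [map_add, mul_add]) (D.jac_t_x_ev hx) (jac_right _ _)
      (r := C c * pderiv 0 f) (by rw [htx, map_mul, D.ev_C]) (H * pderiv 0 D.z)
    have k3 := D.π_derivation (jac D.x D.z) (fun p => C c * pderiv 1 p)
      (fun p q => by rw [map_add, mul_add]) (D.jac_x_z_ev hx) (jac_left _ _)
      (r := C c * pderiv 1 f) (by rw [hxz, map_mul, D.ev_C]) (H * pderiv 0 D.t)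
    have k4 : D.π 1 (D.ev R * (C c * D.x)) = C c * R := by
      have := D.π_ev_mul_x_pow (R * C c) 1 1
      rw [map_mul D.ev, D.ev_C, pow_one] at this
      rw [← mul_assoc, this]
      simp [mul_comm]
    have k5 := congrArg (D.π 1) key
    rw [map_sub, map_add, map_add, k1, k2, k3, k4, show H * (C c * pderiv 0 D.x) =
      C c * (H * pderiv 0 D.x) by ring, D.π_C_mul, Int.cast_one, mul_one] at k5
    have hC : (C c : MvPolynomial (Fin 2) k) ≠ 0 := by simpa using hc
    apply mul_left_cancel₀ hC
    linear_combination -k5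
  · have key := D.derivation_mul_eq (H • pderiv 0)
    simp only [Derivation.smul_apply, smul_eq_mul] at key
    have k5 := congrArg (D.π 0) key
    rw [map_add, map_add, D.π_x_mul, D.π_y_mul, D.π_ev_mul, D.π_ev_mul] at k5
    rw [← k5]
    refine dvd_add ?_ (dvd_mul_right _ _)
    have := D.pow_dvd_π 1 (H * pderiv 0 D.y)
    simpa using this

/-- Every function on the curve `f = 0` is the derivative of a function along the Hamiltonian
vector field of `f`. -/
theorem exists_dvd_sub_bracket [CharZero k] (D : HypersurfaceData f) (b : MvPolynomial (Fin 2) k) :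
    ∃ G, f ∣ b - (pderiv 0 f * pderiv 1 G - pderiv 1 f * pderiv 0 G) := by
  obtain ⟨g, h, u, h1⟩ := D.exists_one_eq
  obtain ⟨e2, e3, hR, hf⟩ := D.exists_divergence_eq (-pderiv 0 (g * b) - pderiv 1 (h * b))
  obtain ⟨G, ha, hb⟩ := exists_pderiv_eq_of_closed (a := e2 + g * b) (b := e3 + h * b) (by
    rw [map_add, map_add]; linear_combination hR)
  refine ⟨-G, ?_⟩
  have : b - (pderiv 0 f * pderiv 1 (-G) - pderiv 1 f * pderiv 0 (-G)) =
      f * (u * b) - (pderiv 0 f * e2 + pderiv 1 f * e3)  := by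
    rw [map_neg, map_neg]
    linear_combination b * h1 + pderiv 0 f * ha + pderiv 1 f * hb
  rw [this]
  exact dvd_sub (dvd_mul_right _ _) hf

end HypersurfaceData

end

section

open MvPolynomial
open LaurentPolynomial (T)

theorem HypersurfaceData.exists_adjoin_eq_top_of_monic {k : Type*} [Field k] [CharZero k]
    {f : MvPolynomial (Fin 2) k} (D : HypersurfaceData f)
    (hmon : ((Polynomial.Bivariate.equivMvPolynomial k).symm f).Monic) :
    ∃ g, Algebra.adjoin k {f, g} = ⊤ := by
  obtain ⟨π, hπ, hker⟩ := exists_surjective_ker_eq_span_of_monic hmon D.prime.irreducible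
    D.exists_dvd_sub_bracket fun a μ hμ h => D.exists_dvd_sub_C hμ h
  exact exists_adjoin_eq_top_of_surjective π hπ hker

/-- The triangular automorphism `z ↦ z + t ^ N` of `k[z, t]`. -/
noncomputable def shear (k : Type*) [Field k] (N : ℕ) :
    MvPolynomial (Fin 2) k ≃ₐ[k] MvPolynomial (Fin 2) k :=
  AlgEquiv.ofAlgHom (aeval ![X 0 + X 1 ^ N, X 1]) (aeval ![X 0 - X 1 ^ N, X 1])
    (by ext i : 1; fin_cases i <;> simp) (by ext i : 1; fin_cases i <;> simp)

theorem shear_X_zero (k : Type*) [Field k] (N : ℕ) : shear k N (X 0) = X 0 + X 1 ^ N := by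
  simp [shear]

theorem shear_X_one (k : Type*) [Field k] (N : ℕ) : shear k N (X 1) = X 1 := by
  simp [shear]

theorem mapAlgHom_C_mul_T {k R : Type*} [CommSemiring k] [CommSemiring R] [Algebra k R]
    (ψ : R →ₐ[k] R) (r : R) (n : ℤ) :
    AddMonoidAlgebra.mapAlgHom ℤ ψ (LaurentPolynomial.C r * T n) =
      LaurentPolynomial.C (ψ r) * T n := by
  rw [← LaurentPolynomial.single_eq_C_mul_T, ← LaurentPolynomial.single_eq_C_mul_T]
  exact AddMonoidAlgebra.mapAlgHom_single _ _ _

theorem mapAlgHom_C {k R : Type*} [CommSemiring k] [CommSemiring R] [Algebra k R]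
    (ψ : R →ₐ[k] R) (r : R) :
    AddMonoidAlgebra.mapAlgHom ℤ ψ (LaurentPolynomial.C r) = LaurentPolynomial.C (ψ r) := by
  have h := mapAlgHom_C_mul_T ψ r 0
  rwa [LaurentPolynomial.T_zero, mul_one, mul_one] at h

/-- Transport along a triangular automorphism of `k[z, t]` and a rescaling. -/
noncomputable def HypersurfaceData.shear {k : Type*} [Field k] {f : MvPolynomial (Fin 2) k}
    (D : HypersurfaceData f) (N : ℕ) {u : k} (hu : u ≠ 0) :
    HypersurfaceData (C u * _root_.shear k N f) where
  x := D.x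
  y := C u * D.y
  z := D.z - D.t ^ N
  t := D.t
  ne_zero := mul_ne_zero (by simpa using hu) (by simpa using D.ne_zero)
  adjoin_eq_top := by
    refine top_le_iff.mp (D.adjoin_eq_top.ge.trans (Algebra.adjoin_le ?_))
    set S := Algebra.adjoin k {D.x, C u * D.y, D.z - D.t ^ N, D.t}
    have hx : D.x ∈ S := Algebra.subset_adjoin (by simp)
    have hy : C u * D.y ∈ S := Algebra.subset_adjoin (by simp)
    have hz : D.z - D.t ^ N ∈ S := Algebra.subset_adjoin (by simp)
    have ht : D.t ∈ S := Algebra.subset_adjoin (by simp)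
    rintro a (rfl | rfl | rfl | rfl)
    · exact hx
    · have h := S.mul_mem (S.algebraMap_mem u⁻¹) hy
      rw [algebraMap_eq, ← mul_assoc, ← C_mul, inv_mul_cancel₀ hu, C_1, one_mul] at h
      exact h
    · have h := S.add_mem hz (S.pow_mem ht N)
      rw [sub_add_cancel] at h
      exact h
    · exact ht
  mul_eq := by
    have h : (aeval ![D.z - D.t ^ N, D.t] : MvPolynomial (Fin 2) k →ₐ[k] _).comp
        (_root_.shear k N).toAlgHom = aeval ![D.z, D.t] := by
      ext i : 1
      fin_cases i <;> simp [shear_X_zero, shear_X_one]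
    have h1 := congrArg (fun φ => φ f) h
    simp only [AlgHom.comp_apply] at h1
    rw [map_mul, algHom_C, mul_left_comm, D.mul_eq, ← h1]
    rfl
  ι := (AddMonoidAlgebra.mapAlgHom ℤ (_root_.shear k N).toAlgHom).comp D.ι
  ι_x := by
    have h := mapAlgHom_C_mul_T (_root_.shear k N).toAlgHom 1 1
    rw [map_one, map_one, one_mul] at h
    rw [AlgHom.comp_apply, D.ι_x, h, map_one, one_mul]
  ι_y := by
    have h := mapAlgHom_C_mul_T (_root_.shear k N).toAlgHom f (-1)
    rw [AlgHom.comp_apply, map_mul, D.ι_y, map_mul, h, algHom_C, AlgHom.commutes, map_mul,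
      mul_assoc]
    rfl
  ι_z := by
    have h (n) := mapAlgHom_C (_root_.shear k N).toAlgHom n
    rw [AlgHom.comp_apply, map_sub, map_pow, D.ι_z, D.ι_t, map_sub, map_pow, h, h, ← map_pow,
      ← map_sub]
    congr 1
    simp [shear_X_zero, shear_X_one]
  ι_t := by
    rw [AlgHom.comp_apply, D.ι_t, mapAlgHom_C]
    congr 1
    simp [shear_X_one]

end

section

open Polynomial

theorem exists_eval₂_shear_leadingCoeff {k : Type*} [Field k] {H : k[X][X]} (hH : H ≠ 0) :
    ∃ (N : ℕ) (u : k), u ≠ 0 ∧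
      (C (C u) * eval₂ (mapRingHom C) (C X + X ^ N) H).Monic := by
  obtain ⟨N, hN0, hN⟩ : ∃ N : ℕ, 0 < N ∧ ∀ i, (H.coeff i).natDegree < N := by
    refine ⟨H.support.sup (fun i => (H.coeff i).natDegree) + 1, Nat.succ_pos _, fun i => ?_⟩
    rw [Nat.lt_succ_iff]
    by_cases hi : i ∈ H.support
    · exact Finset.le_sup (f := fun i => (H.coeff i).natDegree) hi
    · rw [notMem_support_iff.mp hi, natDegree_zero]
      exact Nat.zero_le _
  have hm : (C X + X ^ N : k[X][X]).Monic := by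
    rw [add_comm]
    exact monic_X_pow_add_C _ hN0.ne'
  have hd : (C X + X ^ N : k[X][X]).natDegree = N := by
    rw [add_comm]
    exact natDegree_X_pow_add_C
  have hu : H.leadingCoeff.leadingCoeff ≠ 0 := by simpa using hH
  refine ⟨N, H.leadingCoeff.leadingCoeff⁻¹, inv_ne_zero hu, ?_⟩
  have hlead : (eval₂ (mapRingHom C) (C X + X ^ N) H).leadingCoeff =
      C H.leadingCoeff.leadingCoeff := by
    rw [eval₂_eq_sum_range, Finset.sum_range_succ, leadingCoeff_add_of_degree_lt]
    · rw [leadingCoeff_mul_monic (hm.pow _), coe_mapRingHom, leadingCoeff_map]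
      rfl
    · have hpow (i : ℕ) : ((C X + X ^ N : k[X][X]) ^ i).degree = ((i * N : ℕ) : WithBot ℕ) := by
        rw [degree_eq_natDegree (hm.pow _).ne_zero, hm.natDegree_pow, hd]
      have hH' : (mapRingHom C (H.coeff H.natDegree) : k[X][X]) ≠ 0 :=
        (Polynomial.map_ne_zero_iff C_injective).mpr (leadingCoeff_ne_zero.mpr hH)
      have hdeg := degree_le_mul_left ((C X + X ^ N : k[X][X]) ^ H.natDegree) hH'
      rw [hpow, mul_comm ((C X + X ^ N) ^ _)] at hdeg
      refine lt_of_lt_of_le ?_ hdeg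
      rw [← mem_degreeLT]
      refine Submodule.sum_mem _ fun i hi => ?_
      rw [mem_degreeLT]
      refine (degree_mul_le _ _).trans_lt ?_
      have h1 : ((mapRingHom C) (H.coeff i) : k[X][X]).degree ≤ ((H.coeff i).natDegree : ℕ) := by
        rw [coe_mapRingHom]
        exact degree_map_le.trans degree_le_natDegree
      rw [hpow]
      have h4 : ((mapRingHom C) (H.coeff i) : k[X][X]).degree + ((i * N : ℕ) : WithBot ℕ) ≤
          (((H.coeff i).natDegree + i * N : ℕ) : WithBot ℕ) := by
        rw [Nat.cast_add]
        exact add_le_add h1 le_rfl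
      refine h4.trans_lt ?_
      have h3 : (H.coeff i).natDegree + i * N < H.natDegree * N := by
        have := Nat.mul_le_mul_right N (Nat.succ_le_of_lt (Finset.mem_range.mp hi))
        have := hN i
        nlinarith
      exact WithBot.coe_lt_coe.mpr h3
  rw [Monic, leadingCoeff_mul, leadingCoeff_C, hlead, ← C_mul, inv_mul_cancel₀ hu, C_1]

end

section

open MvPolynomial
open LaurentPolynomial (T)

theorem equivMvPolynomial_symm_shear {k : Type*} [Field k] (N : ℕ) (f : MvPolynomial (Fin 2) k) :
    (Polynomial.Bivariate.equivMvPolynomial k).symm (shear k N f) =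
      Polynomial.eval₂ (Polynomial.mapRingHom Polynomial.C)
        (Polynomial.C Polynomial.X + Polynomial.X ^ N)
        (aeval (![Polynomial.X, Polynomial.C Polynomial.X] :
          Fin 2 → Polynomial (Polynomial k)) f) := by
  have h : ((Polynomial.Bivariate.equivMvPolynomial k).symm.toAlgHom.comp
      (shear k N).toAlgHom).toRingHom =
      (Polynomial.eval₂RingHom (Polynomial.mapRingHom Polynomial.C)
        (Polynomial.C Polynomial.X + Polynomial.X ^ N)).comp
        (aeval (![Polynomial.X, Polynomial.C Polynomial.X] :
          Fin 2 → Polynomial (Polynomial k))).toRingHom := by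
    refine MvPolynomial.ringHom_ext (fun r => ?_) fun i => ?_
    · simp [algHom_C, Polynomial.algebraMap_apply]
    · fin_cases i
      · simp [shear_X_zero]
      · simp [shear_X_one]
  exact congrArg (fun φ => φ f) h

theorem HypersurfaceData.exists_adjoin_eq_top {k : Type*} [Field k] [CharZero k]
    {f : MvPolynomial (Fin 2) k} (D : HypersurfaceData f) :
    ∃ g, Algebra.adjoin k {f, g} = ⊤ := by
  set H := aeval (![Polynomial.X, Polynomial.C Polynomial.X] :
    Fin 2 → Polynomial (Polynomial k)) f with hHdef
  have hH : H ≠ 0 := fun h0 => by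
    have h := equivMvPolynomial_symm_shear 0 f
    rw [← hHdef, h0, Polynomial.eval₂_zero, map_eq_zero_iff _ (AlgEquiv.injective _),
      map_eq_zero_iff _ (AlgEquiv.injective _)] at h
    exact D.ne_zero h
  obtain ⟨N, u, hu, hmon⟩ := exists_eval₂_shear_leadingCoeff hH
  rw [hHdef, ← equivMvPolynomial_symm_shear] at hmon
  obtain ⟨g, hg⟩ := (D.shear N hu).exists_adjoin_eq_top_of_monic (by
    have hC : (Polynomial.Bivariate.equivMvPolynomial k).symm (C u) =
        Polynomial.C (Polynomial.C u) :=
      (AlgEquiv.commutes _ u)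
    rwa [map_mul, hC])
  refine ⟨(_root_.shear k N).symm g, ?_⟩
  have h := congrArg (Subalgebra.map (_root_.shear k N).symm.toAlgHom) hg
  rw [AlgHom.map_adjoin, Set.image_pair, Algebra.map_top,
    (AlgHom.range_eq_top (_root_.shear k N).symm.toAlgHom).2
      (_root_.shear k N).symm.surjective] at h
  rw [eq_top_iff, ← h, Algebra.adjoin_le_iff]
  have h1 : (_root_.shear k N).symm.toAlgHom (C u * _root_.shear k N f) = C u * f := by
    change (_root_.shear k N).symm (C u * _root_.shear k N f) = C u * f
    rw [map_mul, AlgEquiv.symm_apply_apply]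
    congr 1
    exact AlgEquiv.commutes _ u
  rintro x (rfl | rfl)
  · rw [h1]
    exact mul_mem (Subalgebra.algebraMap_mem _ u) (Algebra.subset_adjoin (by simp))
  · exact Algebra.subset_adjoin (by simp)

end

section

open MvPolynomial
open LaurentPolynomial (T)

theorem exists_eq_aeval_add_X_mul {k : Type*} [Field k] (F : MvPolynomial (Fin 3) k) :
    ∃ F₁, F = aeval (![X 1, X 2] : Fin 2 → MvPolynomial (Fin 3) k)
      (aeval (![0, X 0, X 1] : Fin 3 → MvPolynomial (Fin 2) k) F) + X 0 * F₁ := by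
  have h : Ideal.Quotient.mkₐ k (Ideal.span {(X 0 : MvPolynomial (Fin 3) k)}) =
      (Ideal.Quotient.mkₐ k (Ideal.span {X 0})).comp
        ((aeval (![X 1, X 2] : Fin 2 → MvPolynomial (Fin 3) k)).comp
          (aeval (![0, X 0, X 1] : Fin 3 → MvPolynomial (Fin 2) k))) := by
    ext i : 1
    fin_cases i <;> simp
  have h1 := congrArg (fun φ => φ F) h
  obtain ⟨F₁, h2⟩ := Ideal.mem_span_singleton.1 ((Ideal.Quotient.mk_eq_mk_iff_sub_mem _ _).1 h1)
  exact ⟨F₁, by rw [← h2]; simp⟩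

section
variable {k : Type*} [Field k] (F : MvPolynomial (Fin 3) k)

/-- The coordinate ring of the hypersurface `x y = F(x, z, t)`. -/
abbrev HypersurfaceRing : Type _ :=
  MvPolynomial (Fin 4) k ⧸ Ideal.span
    {X 0 * X 1 - aeval (![X 0, X 2, X 3] : Fin 3 → MvPolynomial (Fin 4) k) F}

namespace HypersurfaceRing

/-- The class of a variable. -/
noncomputable def var (i : Fin 4) : HypersurfaceRing F := Ideal.Quotient.mkₐ k _ (X i)

theorem var_mul_var : var F 0 * var F 1 = aeval ![var F 0, var F 2, var F 3] F := by
  have h : (Ideal.Quotient.mkₐ k (Ideal.span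
      {X 0 * X 1 - aeval (![X 0, X 2, X 3] : Fin 3 → MvPolynomial (Fin 4) k) F})).comp
      (aeval (![X 0, X 2, X 3] : Fin 3 → MvPolynomial (Fin 4) k)) =
      aeval ![var F 0, var F 2, var F 3] := by
    refine MvPolynomial.algHom_ext fun i => ?_
    rw [AlgHom.comp_apply, aeval_X, aeval_X]
    fin_cases i <;> rfl
  rw [← h, AlgHom.comp_apply, var, var, ← map_mul]
  exact (Ideal.Quotient.mk_eq_mk_iff_sub_mem _ _).2 (Ideal.mem_span_singleton_self _)

variable {F} {R : Type*} [CommRing R] [Algebra k R]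

/-- The algebra homomorphism attached to a solution of `x y = F(x, z, t)`. -/
noncomputable def lift (x y z t : R) (h : x * y = aeval ![x, z, t] F) :
    HypersurfaceRing F →ₐ[k] R :=
  Ideal.Quotient.liftₐ _ (aeval ![x, y, z, t]) fun a ha => by
    obtain ⟨b, rfl⟩ := Ideal.mem_span_singleton.1 ha
    have h1 : (aeval ![x, y, z, t]).comp
        (aeval (![X 0, X 2, X 3] : Fin 3 → MvPolynomial (Fin 4) k)) = aeval ![x, z, t] := by
      ext i : 1
      fin_cases i <;> simp
    rw [map_mul, map_sub, ← AlgHom.comp_apply, h1, ← h]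
    simp

theorem lift_var {x y z t : R} (h : x * y = aeval ![x, z, t] F) (i : Fin 4) :
    lift x y z t h (var F i) = ![x, y, z, t] i := by
  change aeval ![x, y, z, t] (X i) = _
  rw [aeval_X]

theorem adjoin_var : Algebra.adjoin k (Set.range (var F)) = ⊤ := by
  have h := congrArg (Subalgebra.map (Ideal.Quotient.mkₐ k (Ideal.span
    {X 0 * X 1 - aeval (![X 0, X 2, X 3] : Fin 3 → MvPolynomial (Fin 4) k) F})))
    (MvPolynomial.adjoin_range_X (R := k) (σ := Fin 4))
  rw [AlgHom.map_adjoin, ← Set.range_comp, Algebra.map_top,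
    (AlgHom.range_eq_top _).2 (Ideal.Quotient.mkₐ_surjective _ _)] at h
  exact h

end HypersurfaceRing
end

end

section

open MvPolynomial
open LaurentPolynomial (T)

namespace HypersurfaceRing
variable {k : Type*} [Field k] {F F₁ : MvPolynomial (Fin 3) k} {f : MvPolynomial (Fin 2) k}

theorem aeval_eq (hF : F = aeval (![X 1, X 2] : Fin 2 → MvPolynomial (Fin 3) k) f + X 0 * F₁)
    {R : Type*} [CommRing R] [Algebra k R] (x z t : R) :
    aeval ![x, z, t] F = aeval ![z, t] f + x * aeval ![x, z, t] F₁ := by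
  have h : (aeval ![x, z, t]).comp (aeval (![X 1, X 2] : Fin 2 → MvPolynomial (Fin 3) k)) =
      aeval ![z, t] := by
    ext i : 1
    fin_cases i <;> simp
  rw [hF, map_add, map_mul, ← AlgHom.comp_apply, h, aeval_X, Matrix.cons_val_zero]

variable (F₁) in
/-- The class of `y - F₁(x, z, t)`. -/
noncomputable def reducedVar : HypersurfaceRing F :=
  var F 1 - aeval ![var F 0, var F 2, var F 3] F₁

theorem var_mul_reducedVar
    (hF : F = aeval (![X 1, X 2] : Fin 2 → MvPolynomial (Fin 3) k) f + X 0 * F₁) :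
    var F 0 * reducedVar F₁ = aeval ![var F 2, var F 3] f := by
  have h := aeval_eq hF (var F 0) (var F 2) (var F 3)
  rw [reducedVar, mul_sub, var_mul_var, h, add_sub_cancel_right]

/-- The algebra homomorphism attached to a solution of `x y = f(z, t)`. -/
noncomputable def liftReduced
    (hF : F = aeval (![X 1, X 2] : Fin 2 → MvPolynomial (Fin 3) k) f + X 0 * F₁)
    {R : Type*} [CommRing R] [Algebra k R] (x y z t : R) (h : x * y = aeval ![z, t] f) :
    HypersurfaceRing F →ₐ[k] R :=
  lift x (y + aeval ![x, z, t] F₁) z t (by rw [aeval_eq hF, mul_add, h])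

section
variable (hF : F = aeval (![X 1, X 2] : Fin 2 → MvPolynomial (Fin 3) k) f + X 0 * F₁)
  {R : Type*} [CommRing R] [Algebra k R] {x y z t : R} (h : x * y = aeval ![z, t] f)

theorem liftReduced_var_zero : liftReduced hF x y z t h (var F 0) = x := lift_var _ 0

theorem liftReduced_var_two : liftReduced hF x y z t h (var F 2) = z := lift_var _ 2

theorem liftReduced_var_three : liftReduced hF x y z t h (var F 3) = t := lift_var _ 3

theorem liftReduced_reducedVar : liftReduced hF x y z t h (reducedVar F₁) = y := by
  have h1 : (liftReduced hF x y z t h).comp (aeval ![var F 0, var F 2, var F 3]) =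
      aeval ![x, z, t] := by
    refine MvPolynomial.algHom_ext fun i => ?_
    rw [AlgHom.comp_apply, aeval_X, aeval_X]
    fin_cases i
    · exact liftReduced_var_zero hF h
    · exact liftReduced_var_two hF h
    · exact liftReduced_var_three hF h
  rw [reducedVar, map_sub, ← AlgHom.comp_apply, h1]
  exact sub_eq_of_eq_add (lift_var _ 1)

end

variable (F₁) in
theorem adjoin_reducedVar :
    Algebra.adjoin k {var F 0, reducedVar F₁, var F 2, var F 3} = ⊤ := by
  rw [eq_top_iff, ← adjoin_var, Algebra.adjoin_le_iff]
  set S := Algebra.adjoin k {var F 0, reducedVar F₁, var F 2, var F 3}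
  have h0 : var F 0 ∈ S := Algebra.subset_adjoin (by simp)
  have h1 : reducedVar F₁ ∈ S := Algebra.subset_adjoin (by simp)
  have h2 : var F 2 ∈ S := Algebra.subset_adjoin (by simp)
  have h3 : var F 3 ∈ S := Algebra.subset_adjoin (by simp)
  have h4 : aeval ![var F 0, var F 2, var F 3] F₁ ∈ S := by
    have h5 : Algebra.adjoin k (Set.range ![var F 0, var F 2, var F 3]) ≤ S := by
      rw [Algebra.adjoin_le_iff]
      rintro _ ⟨i, rfl⟩
      fin_cases i
      · exact h0
      · exact h2
      · exact h3
    rw [Algebra.adjoin_range_eq_range_aeval] at h5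
    exact h5 ⟨F₁, rfl⟩
  rintro _ ⟨i, rfl⟩
  fin_cases i
  · exact h0
  · have h6 := S.add_mem h1 h4
    rw [reducedVar, sub_add_cancel] at h6
    exact h6
  · exact h2
  · exact h3

variable {R : Type*} [CommRing R] [Algebra k R]

theorem algHom_ext_reducedVar {φ ψ : HypersurfaceRing F →ₐ[k] R} (h0 : φ (var F 0) = ψ (var F 0))
    (h1 : φ (reducedVar F₁) = ψ (reducedVar F₁)) (h2 : φ (var F 2) = ψ (var F 2))
    (h3 : φ (var F 3) = ψ (var F 3)) : φ = ψ := by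
  refine AlgHom.ext_of_adjoin_eq_top (adjoin_reducedVar F₁) ?_
  rintro x (rfl | rfl | rfl | rfl)
  · exact h0
  · exact h1
  · exact h2
  · exact h3

/-- An isomorphism of the coordinate ring with a polynomial ring. -/
noncomputable def data
    (hF : F = aeval (![X 1, X 2] : Fin 2 → MvPolynomial (Fin 3) k) f + X 0 * F₁)
    (e : HypersurfaceRing F ≃ₐ[k] MvPolynomial (Fin 3) k) : HypersurfaceData f where
  x := e (var F 0)
  y := e (reducedVar F₁)
  z := e (var F 2)
  t := e (var F 3)
  ne_zero := by
    rintro rfl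
    have h0 : e (var F 0) * e (reducedVar F₁) = 0 := by
      rw [← map_mul, var_mul_reducedVar hF, map_zero, map_zero]
    rcases mul_eq_zero.1 h0 with h1 | h1
    · rw [map_eq_zero_iff _ e.injective] at h1
      have h2 := liftReduced_var_zero hF (R := k) (x := 1) (y := 0) (z := 0) (t := 0) (by simp)
      rw [h1, map_zero] at h2
      exact zero_ne_one h2
    · rw [map_eq_zero_iff _ e.injective] at h1
      have h2 := liftReduced_reducedVar hF (R := k) (x := 0) (y := 1) (z := 0) (t := 0) (by simp)
      rw [h1, map_zero] at h2
      exact zero_ne_one h2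
  adjoin_eq_top := by
    have h := congrArg (Subalgebra.map e.toAlgHom) (adjoin_reducedVar (F := F) F₁)
    rw [AlgHom.map_adjoin, Algebra.map_top, (AlgHom.range_eq_top e.toAlgHom).2 e.surjective] at h
    rw [Set.image_insert_eq, Set.image_insert_eq, Set.image_pair] at h
    exact h
  mul_eq := by
    have h : e.toAlgHom.comp (aeval ![var F 2, var F 3]) =
        aeval ![e (var F 2), e (var F 3)] := by
      refine MvPolynomial.algHom_ext fun i => ?_
      rw [AlgHom.comp_apply, aeval_X, aeval_X]
      fin_cases i <;> rfl
    rw [← map_mul, var_mul_reducedVar hF, ← h]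
    rfl
  ι := (liftReduced hF (T 1 : LaurentPolynomial (MvPolynomial (Fin 2) k))
    (LaurentPolynomial.C f * T (-1)) (LaurentPolynomial.C (X 0))
    (LaurentPolynomial.C (X 1)) (by
      have h : aeval (![LaurentPolynomial.C (X 0), LaurentPolynomial.C (X 1)] :
            Fin 2 → LaurentPolynomial (MvPolynomial (Fin 2) k)) =
          (Algebra.ofId (MvPolynomial (Fin 2) k)
            (LaurentPolynomial (MvPolynomial (Fin 2) k))).restrictScalars k := by
        refine MvPolynomial.algHom_ext fun i => ?_
        rw [aeval_X]
        fin_cases i <;> rfl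
      rw [h, mul_left_comm, ← LaurentPolynomial.T_add, add_neg_cancel, LaurentPolynomial.T_zero,
        mul_one]
      rfl)).comp e.symm.toAlgHom
  ι_x := by
    have h (a) : e.symm.toAlgHom (e a) = a := e.symm_apply_apply a
    rw [AlgHom.comp_apply, h, liftReduced_var_zero]
  ι_y := by
    have h (a) : e.symm.toAlgHom (e a) = a := e.symm_apply_apply a
    rw [AlgHom.comp_apply, h, liftReduced_reducedVar]
  ι_z := by
    have h (a) : e.symm.toAlgHom (e a) = a := e.symm_apply_apply a
    rw [AlgHom.comp_apply, h, liftReduced_var_two]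
  ι_t := by
    have h (a) : e.symm.toAlgHom (e a) = a := e.symm_apply_apply a
    rw [AlgHom.comp_apply, h, liftReduced_var_three]

end HypersurfaceRing

end

section

open MvPolynomial

theorem RingHom.injective_of_surjective_endomorphism {R : Type*} [CommRing R] [IsNoetherianRing R]
    (φ : R →+* R) (hφ : Function.Surjective φ) : Function.Injective φ := by
  have hs (n : ℕ) : Function.Surjective (φ ^ n : R →+* R) := by
    rw [RingHom.coe_pow]
    exact hφ.iterate n
  obtain ⟨n, hn⟩ := monotone_stabilizes_iff_noetherian.mpr ‹IsNoetherianRing R›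
    ⟨fun n => RingHom.ker (φ ^ n : R →+* R), monotone_nat_of_le_succ fun n a ha => by
      rw [RingHom.mem_ker] at ha ⊢
      rw [pow_succ', RingHom.mul_def, RingHom.comp_apply, ha, map_zero]⟩
  rw [injective_iff_map_eq_zero]
  intro a ha
  obtain ⟨b, rfl⟩ := hs n a
  have h1 : b ∈ RingHom.ker (φ ^ (n + 1) : R →+* R) := by
    rw [RingHom.mem_ker, pow_succ', RingHom.mul_def, RingHom.comp_apply, ha]
  have h2 : RingHom.ker (φ ^ n : R →+* R) = RingHom.ker (φ ^ (n + 1) : R →+* R) :=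
    hn (n + 1) n.le_succ
  rwa [← h2] at h1

theorem exists_algHom_of_adjoin_pair_eq_top {k : Type*} [Field k] {f g : MvPolynomial (Fin 2) k}
    (hg : Algebra.adjoin k {f, g} = ⊤) {R : Type*} [CommRing R] [Algebra k R] (a b : R) :
    ∃ τ : MvPolynomial (Fin 2) k →ₐ[k] R, τ f = a ∧ τ g = b := by
  have hsurj := surjective_aeval_of_adjoin_eq_top hg
  have hinj := RingHom.injective_of_surjective_endomorphism
    (aeval ![f, g] : MvPolynomial (Fin 2) k →ₐ[k] MvPolynomial (Fin 2) k).toRingHom hsurj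
  obtain ⟨σ, hσ⟩ : ∃ σ : MvPolynomial (Fin 2) k ≃ₐ[k] MvPolynomial (Fin 2) k,
      ∀ p, σ p = aeval ![f, g] p :=
    ⟨AlgEquiv.ofBijective (aeval ![f, g]) ⟨hinj, hsurj⟩, fun _ => rfl⟩
  have h0 : σ.symm f = X 0 := by rw [AlgEquiv.symm_apply_eq, hσ]; simp
  have h1 : σ.symm g = X 1 := by rw [AlgEquiv.symm_apply_eq, hσ]; simp
  refine ⟨(aeval ![a, b]).comp σ.symm.toAlgHom, ?_, ?_⟩
  · change aeval ![a, b] (σ.symm f) = a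
    rw [h0, aeval_X, Matrix.cons_val_zero]
  · change aeval ![a, b] (σ.symm g) = b
    rw [h1, aeval_X, Matrix.cons_val_one, Matrix.cons_val_fin_one]

namespace HypersurfaceRing
variable {k : Type*} [Field k] {F F₁ : MvPolynomial (Fin 3) k} {f : MvPolynomial (Fin 2) k}

theorem nonempty_algEquiv_of_adjoin_eq_top
    (hF : F = aeval (![X 1, X 2] : Fin 2 → MvPolynomial (Fin 3) k) f + X 0 * F₁)
    {g : MvPolynomial (Fin 2) k} (hg : Algebra.adjoin k {f, g} = ⊤) :
    Nonempty (HypersurfaceRing F ≃ₐ[k] MvPolynomial (Fin 3) k) := by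
  obtain ⟨τ, hτf, hτg⟩ := exists_algHom_of_adjoin_pair_eq_top hg
    (X 0 * X 1 : MvPolynomial (Fin 3) k) (X 2)
  have hτ : aeval ![τ (X 0), τ (X 1)] = τ := by
    ext i : 1
    fin_cases i <;> simp
  have hmul : (X 0 * X 1 : MvPolynomial (Fin 3) k) = aeval ![τ (X 0), τ (X 1)] f := by
    rw [hτ, hτf]
  let φ := liftReduced hF (X 0 : MvPolynomial (Fin 3) k) (X 1) (τ (X 0)) (τ (X 1)) hmul
  let ev : MvPolynomial (Fin 2) k →ₐ[k] HypersurfaceRing F := aeval ![var F 2, var F 3]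
  let ψ : MvPolynomial (Fin 3) k →ₐ[k] HypersurfaceRing F :=
    aeval ![var F 0, reducedVar F₁, ev g]
  have hφ : φ.comp ev = τ := by
    refine MvPolynomial.algHom_ext fun i => ?_
    rw [AlgHom.comp_apply, aeval_X]
    fin_cases i
    · exact liftReduced_var_two hF hmul
    · exact liftReduced_var_three hF hmul
  have hψ : ψ.comp τ = ev := by
    refine AlgHom.ext_of_adjoin_eq_top hg ?_
    rintro x (rfl | rfl)
    · change ψ (τ x) = ev x
      rw [hτf, map_mul, aeval_X, aeval_X]
      exact var_mul_reducedVar hF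
    · change ψ (τ x) = ev x
      rw [hτg]
      exact aeval_X _ _
  refine ⟨AlgEquiv.ofAlgHom φ ψ ?_ ?_⟩
  · refine MvPolynomial.algHom_ext fun i => ?_
    rw [AlgHom.comp_apply, aeval_X]
    fin_cases i
    · exact liftReduced_var_zero hF hmul
    · exact liftReduced_reducedVar hF hmul
    · change (φ.comp ev) g = X 2
      rw [hφ, hτg]
  · refine algHom_ext_reducedVar (F₁ := F₁) ?_ ?_ ?_ ?_
    · rw [AlgHom.comp_apply, liftReduced_var_zero hF hmul]
      exact aeval_X _ _
    · rw [AlgHom.comp_apply, liftReduced_reducedVar hF hmul]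
      exact aeval_X _ _
    · rw [AlgHom.comp_apply, liftReduced_var_two hF hmul, ← AlgHom.comp_apply, hψ]
      exact aeval_X _ _
    · rw [AlgHom.comp_apply, liftReduced_var_three hF hmul, ← AlgHom.comp_apply, hψ]
      exact aeval_X _ _

end HypersurfaceRing
end

open MvPolynomial

/-- extension of Gupta's theorem: for `k` of characteristic zero and
`A = k[X,Y,Z,T]/(XY − F(X,Z,T))`, one has `A ≅ k^[3]` iff `F(0,Z,T)` is a variable of
`k[Z,T]`. Variables of `k[X,Y,Z,T]` are indexed `0 = X, 1 = Y, 2 = Z, 3 = T`. -/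
theorem stmt_1 {k : Type*} [Field k] [CharZero k] (F : MvPolynomial (Fin 3) k) :
    Nonempty ((MvPolynomial (Fin 4) k ⧸ Ideal.span
        {X 0 * X 1 - aeval (![X 0, X 2, X 3] : Fin 3 → MvPolynomial (Fin 4) k) F})
      ≃ₐ[k] MvPolynomial (Fin 3) k) ↔
    ∃ G : MvPolynomial (Fin 2) k,
      Algebra.adjoin k
        {aeval (![0, X 0, X 1] : Fin 3 → MvPolynomial (Fin 2) k) F, G} = ⊤ := by
  obtain ⟨F₁, hF⟩ := exists_eq_aeval_add_X_mul F
  constructor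
  · rintro ⟨e⟩
    exact (HypersurfaceRing.data hF e).exists_adjoin_eq_top
  · rintro ⟨g, hg⟩
    exact HypersurfaceRing.nonempty_algEquiv_of_adjoin_eq_top hF hg
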